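/- arXiv:1908.08611 — 5 statements merged into one kernel-verified Lean document; each statement's English description precedes it below -/
import Mathlib

section
/- For an integer g ≥ 1 define V₁(g+1) = ζ(6g)·((4g)!/(g!·(3g)!))·3^{−g}·2^{1−2g}·∑_{k=0}^{3g−1} C(6g, 2k+1)·a(g,k). Then V₁(g+1) = √(2/(3πg))·(8/3)^{4g}·(1 + O(1/g)) as g → ∞; precisely, g·( V₁(g+1)·√(3πg/2)·(3/8)^{4g} − 1 ) remains bounded as g → ∞. -/
open Filter

/-- The Riemann zeta value `ζ(s) = ∑_{n ≥ 1} n^{−s}` for a natural exponent `s`. -/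
noncomputable def zetaSum (s : ℕ) : ℝ := ∑' n : ℕ, 1 / ((n : ℝ) + 1) ^ s

/-- The increment `d(g,k)` in Zograf's recursion for the normalized 2-point
intersection numbers of ψ-classes. -/
noncomputable def dZ (g k : ℕ) : ℚ :=
  if k % 3 = 2 then
    -- `k = 3j - 1`
    let j := (k + 1) / 3
    ((Nat.doubleFactorial (6 * j - 1) : ℚ) / (Nat.factorial j : ℚ)) *
      ((Nat.factorial (g - 1) : ℚ) / (Nat.factorial (g - j) : ℚ)) * ((g : ℚ) - 2 * (j : ℚ))
  else if k % 3 = 0 then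
    -- `k = 3j`
    let j := k / 3
    (-2) * ((Nat.doubleFactorial (6 * j + 1) : ℚ) / (Nat.factorial j : ℚ)) *
      ((Nat.factorial (g - 1) : ℚ) / (Nat.factorial (g - 1 - j) : ℚ))
  else
    -- `k = 3j + 1`
    let j := (k - 1) / 3
    2 * ((Nat.doubleFactorial (6 * j + 3) : ℚ) / (Nat.factorial j : ℚ)) *
      ((Nat.factorial (g - 1) : ℚ) / (Nat.factorial (g - 1 - j) : ℚ))

/-- The recursively defined values: `aRec g 0 = 1` and
`aRec g (k+1) = aRec g k + ((6g−3−2k)‼/(6g−1)‼)·d(g,k)`. -/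
noncomputable def aRec (g : ℕ) : ℕ → ℚ
  | 0 => 1
  | k + 1 =>
      aRec g k +
        ((Nat.doubleFactorial (6 * g - 3 - 2 * k) : ℚ) /
          (Nat.doubleFactorial (6 * g - 1) : ℚ)) * dZ g k

/-- The normalized 2-correlators `a(g,k)`. -/
noncomputable def aZ (g k : ℕ) : ℚ :=
  if k ≤ (3 * g - 1) / 2 then aRec g k else aRec g (3 * g - 1 - k)

/-- `V₁(g+1) = ζ(6g)·((4g)!/(g!·(3g)!))·3^{−g}·2^{1−2g}·∑_{k=0}^{3g−1} C(6g,2k+1)·a(g,k)`,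
the contribution of one-cylinder square-tiled surfaces with non-separating core curve to
the Masur–Veech volume in genus `g+1`. -/
noncomputable def V1succ (g : ℕ) : ℝ :=
  zetaSum (6 * g) * ((Nat.factorial (4 * g) : ℝ) /
      ((Nat.factorial g : ℝ) * (Nat.factorial (3 * g) : ℝ))) *
    (3 : ℝ) ^ (-(g : ℤ)) * (2 : ℝ) ^ (1 - 2 * (g : ℤ)) *
    ∑ k ∈ Finset.range (3 * g), (Nat.choose (6 * g) (2 * k + 1) : ℝ) * ((aZ g k : ℚ) : ℝ)


/-- Auxiliary product `C(g,j) (6j-1)!! (6(g-j)-1)!!`. -/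
def auxD (g j : ℕ) : ℕ :=
  Nat.choose g j * Nat.doubleFactorial (6 * j - 1) * Nat.doubleFactorial (6 * (g - j) - 1)

lemma df_six (n : ℕ) : Nat.doubleFactorial (6 * (n + 1) - 1) =
    (6 * n + 5) * (6 * n + 3) * (6 * n + 1) * Nat.doubleFactorial (6 * n - 1) := by
  rcases n with _ | n
  · decide
  · have h1 : 6 * (n + 1 + 1) - 1 = (((6 * n + 5) + 2) + 2) + 2 := by omega
    have h2 : 6 * (n + 1) - 1 = 6 * n + 5 := by omega
    rw [h1, h2, Nat.doubleFactorial_add_two, Nat.doubleFactorial_add_two,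
      Nat.doubleFactorial_add_two]
    ring

lemma auxD_key (n t : ℕ) : (n + 1 + t + 1) * ((6 * n + 5) * (6 * n + 3) * (6 * n + 1)) ≤
    (n + 1) * ((6 * (n + 1 + t) + 5) * (6 * (n + 1 + t) + 3) * (6 * (n + 1 + t) + 1)) := by
  have h1 : (n + 1 + t + 1) * (6 * n + 5) ≤ (n + 1) * (6 * (n + 1 + t) + 5) := by nlinarith
  have h2 : (6 * n + 3) * (6 * n + 1) ≤ (6 * (n + 1 + t) + 3) * (6 * (n + 1 + t) + 1) :=
    Nat.mul_le_mul (by omega) (by omega)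
  have := Nat.mul_le_mul h1 h2
  nlinarith [this]

lemma auxD_anti (g j : ℕ) (h : 2 * (j + 1) ≤ g) : auxD g (j + 1) ≤ auxD g j := by
  obtain ⟨t, rfl⟩ : ∃ t, g = j + (j + 1 + t + 1) := ⟨g - 2 * (j + 1), by omega⟩
  unfold auxD
  have e1 : j + (j + 1 + t + 1) - (j + 1) = j + 1 + t := by omega
  have e2 : j + (j + 1 + t + 1) - j = j + 1 + t + 1 := by omega
  rw [e1, e2, df_six, df_six (j + 1 + t)]
  have hc := Nat.choose_succ_right_eq (j + (j + 1 + t + 1)) j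
  rw [e2] at hc
  have hk := auxD_key j t
  generalize (j + (j + 1 + t + 1)).choose (j + 1) = A at *
  generalize (j + (j + 1 + t + 1)).choose j = B at *
  generalize (6 * j - 1).doubleFactorial = X
  generalize (6 * (j + 1 + t) - 1).doubleFactorial = Y
  have hpos : 0 < j + 1 := by omega
  apply Nat.le_of_mul_le_mul_left _ hpos
  calc (j + 1) * (A * ((6 * j + 5) * (6 * j + 3) * (6 * j + 1) * X) * Y)
      = (A * (j + 1)) * ((6 * j + 5) * (6 * j + 3) * (6 * j + 1)) * (X * Y) := by ring
    _ = ((j + 1 + t + 1) * ((6 * j + 5) * (6 * j + 3) * (6 * j + 1))) * (B * (X * Y)) := by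
        rw [hc]; ring
    _ ≤ _ := Nat.mul_le_mul_right _ hk
    _ = _ := by ring

lemma auxD_one (g : ℕ) (hg : 1 ≤ g) :
    auxD g 1 * g ^ 2 ≤ 15 * Nat.doubleFactorial (6 * g - 1) := by
  obtain ⟨n, rfl⟩ : ∃ n, g = n + 1 := ⟨g - 1, by omega⟩
  unfold auxD
  rw [df_six n]
  have : (6 * 1 - 1 : ℕ).doubleFactorial = 15 := by decide
  rw [this, Nat.choose_one_right]
  simp only [Nat.add_sub_cancel]
  have h : (n + 1) ^ 3 ≤ (6 * n + 5) * (6 * n + 3) * (6 * n + 1) := by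
    have := Nat.mul_le_mul (Nat.mul_le_mul (show n + 1 ≤ 6 * n + 5 by omega)
      (show n + 1 ≤ 6 * n + 3 by omega)) (show n + 1 ≤ 6 * n + 1 by omega)
    calc _ = _ := by ring
      _ ≤ _ := this
  calc _ = (n + 1) ^ 3 * (15 * (6 * n - 1).doubleFactorial) := by ring
    _ ≤ _ := Nat.mul_le_mul_right _ h
    _ = _ := by ring

lemma auxD_bound (g j : ℕ) (hj : 1 ≤ j) (h : 2 * j ≤ g) :
    auxD g j * g ^ 2 ≤ 15 * Nat.doubleFactorial (6 * g - 1) := by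
  induction j, hj using Nat.le_induction with
  | base => exact auxD_one g (by omega)
  | succ j hj ih =>
    exact (Nat.mul_le_mul_right _ (auxD_anti g j h)).trans (ih (by omega))

lemma choose_q (n j : ℕ) (h : j ≤ n) :
    (Nat.choose n j : ℚ) = (Nat.factorial n : ℚ) / (Nat.factorial j * Nat.factorial (n - j)) := by
  exact Nat.cast_choose ℚ h

lemma dZ_two (g j : ℕ) (h : 2 * (j + 1) ≤ g) :
    |dZ g (3 * j + 2)| ≤ (Nat.choose g (j + 1) : ℚ) * Nat.doubleFactorial (6 * (j + 1) - 1) := by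
  unfold dZ
  have h1 : (3 * j + 2) % 3 = 2 := by omega
  have h2 : (3 * j + 2 + 1) / 3 = j + 1 := by omega
  rw [if_pos h1, h2]
  simp only
  rw [choose_q g (j + 1) (by omega)]
  obtain ⟨n, rfl⟩ : ∃ n, g = n + 1 := ⟨g - 1, by omega⟩
  have hq : (2 * ((j : ℚ) + 1)) ≤ n + 1 := by exact_mod_cast h
  have hj : (0 : ℚ) ≤ j := by positivity
  rw [abs_of_nonneg]
  swap
  · apply mul_nonneg (by positivity)
    push_cast; linarith
  rw [Nat.add_sub_cancel, Nat.factorial_succ n]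
  push_cast
  calc _ = (((6 * (j + 1) - 1).doubleFactorial : ℚ) / (Nat.factorial (j + 1)) *
        ((Nat.factorial n : ℚ) / (Nat.factorial (n + 1 - (j + 1))))) * ((n : ℚ) + 1 - 2 * (j + 1)) := by
          push_cast; ring
    _ ≤ (((6 * (j + 1) - 1).doubleFactorial : ℚ) / (Nat.factorial (j + 1)) *
        ((Nat.factorial n : ℚ) / (Nat.factorial (n + 1 - (j + 1))))) * ((n : ℚ) + 1) := by
          apply mul_le_mul_of_nonneg_left (by linarith) (by positivity)
    _ = _ := by rw [Nat.add_sub_add_right]; field_simp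

lemma choose_le_q (g j : ℕ) (h : j + 1 ≤ g) :
    (1 / (Nat.factorial j : ℚ)) * ((Nat.factorial (g - 1) : ℚ) / (Nat.factorial (g - 1 - j) : ℚ))
      ≤ Nat.choose g j := by
  have : (Nat.choose (g - 1) j : ℚ) ≤ Nat.choose g j := by
    exact_mod_cast Nat.choose_le_choose j (by omega)
  rw [choose_q (g - 1) j (by omega)] at this
  refine le_trans (le_of_eq ?_) this
  field_simp

lemma dZ_zero (g j : ℕ) (h : j + 1 ≤ g) :
    |dZ g (3 * j)| ≤ 2 * (Nat.choose g j : ℚ) * Nat.doubleFactorial (6 * j + 1) := by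
  unfold dZ
  have h1 : ¬ (3 * j) % 3 = 2 := by omega
  have h1' : (3 * j) % 3 = 0 := by omega
  have h2 : (3 * j) / 3 = j := by omega
  rw [if_neg h1, if_pos h1', h2]
  simp only
  rw [neg_mul, neg_mul, abs_neg, abs_of_nonneg (by positivity)]
  have := mul_le_mul_of_nonneg_left (choose_le_q g j h)
    (show (0 : ℚ) ≤ 2 * Nat.doubleFactorial (6 * j + 1) by positivity)
  calc _ = _ := by ring
    _ ≤ _ := this
    _ = _ := by ring

lemma dZ_one (g j : ℕ) (h : j + 1 ≤ g) :
    |dZ g (3 * j + 1)| ≤ 2 * (Nat.choose g j : ℚ) * Nat.doubleFactorial (6 * j + 3) := by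
  unfold dZ
  have h1 : ¬ (3 * j + 1) % 3 = 2 := by omega
  have h1' : ¬ (3 * j + 1) % 3 = 0 := by omega
  have h2 : (3 * j + 1 - 1) / 3 = j := by omega
  rw [if_neg h1, if_neg h1', h2]
  simp only
  rw [abs_of_nonneg (by positivity)]
  have := mul_le_mul_of_nonneg_left (choose_le_q g j h)
    (show (0 : ℚ) ≤ 2 * Nat.doubleFactorial (6 * j + 3) by positivity)
  calc _ = _ := by ring
    _ ≤ _ := this
    _ = _ := by ring

lemma df_odd1 (j : ℕ) : Nat.doubleFactorial (6 * j + 1) = (6 * j + 1) * Nat.doubleFactorial (6 * j - 1) := by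
  exact Nat.doubleFactorial_add_one (6 * j)

lemma df_odd3 (j : ℕ) : Nat.doubleFactorial (6 * j + 3) =
    (6 * j + 3) * ((6 * j + 1) * Nat.doubleFactorial (6 * j - 1)) := by
  rw [← df_odd1]; exact Nat.doubleFactorial_add_two (6 * j + 1)

lemma incr_nat (g j : ℕ) (h : 2 * j + 1 ≤ g) :
    Nat.choose g j * Nat.doubleFactorial (6 * j + 1) * Nat.doubleFactorial (6 * g - 3 - 2 * (3 * j))
      ≤ auxD g j := by
  unfold auxD
  rw [df_odd1]
  obtain ⟨t, rfl⟩ : ∃ t, g = j + (j + t + 1) := ⟨g - (2 * j + 1), by omega⟩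
  have e1 : 6 * (j + (j + t + 1)) - 3 - 2 * (3 * j) = 6 * (j + t) + 3 := by omega
  have e2 : 6 * (j + (j + t + 1) - j) - 1 = (6 * (j + t) + 3) + 2 := by omega
  rw [e1, e2, Nat.doubleFactorial_add_two (6 * (j + t) + 3)]
  have : 6 * j + 1 ≤ 6 * (j + t) + 3 + 2 := by omega
  generalize 6 * (j + t) + 3 = y at *
  generalize (j + (j + t + 1)).choose j = c at *
  calc _ = (6 * j + 1) * (c * (6 * j - 1).doubleFactorial *
        y.doubleFactorial) := by ring
    _ ≤ _ := Nat.mul_le_mul_right _ this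
    _ = _ := by ring

lemma incr_nat' (g j : ℕ) (h : 2 * j + 1 ≤ g) :
    Nat.choose g j * Nat.doubleFactorial (6 * j + 3) *
      Nat.doubleFactorial (6 * g - 3 - 2 * (3 * j + 1)) ≤ auxD g j := by
  refine le_trans ?_ (incr_nat g j h)
  obtain ⟨t, rfl⟩ : ∃ t, g = j + (j + t + 1) := ⟨g - (2 * j + 1), by omega⟩
  have e1 : 6 * (j + (j + t + 1)) - 3 - 2 * (3 * j) = (6 * (j + t) + 1) + 2 := by omega
  have e2 : 6 * (j + (j + t + 1)) - 3 - 2 * (3 * j + 1) = 6 * (j + t) + 1 := by omega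
  rw [e1, e2, Nat.doubleFactorial_add_two (6 * (j + t) + 1), Nat.doubleFactorial_add_two (6 * j + 1)]
  have : 6 * j + 1 + 2 ≤ 6 * (j + t) + 1 + 2 := by omega
  generalize 6 * (j + t) + 1 = y at *
  generalize 6 * j + 1 = x at *
  generalize (j + (j + t + 1)).choose j = c at *
  calc _ = (x + 2) * (c * x.doubleFactorial *
        y.doubleFactorial) := by ring
    _ ≤ _ := Nat.mul_le_mul_right _ this
    _ = _ := by ring

lemma incr_bound (g k : ℕ) (hk : 1 ≤ k) (h : 2 * (k + 1) ≤ 3 * g - 1) :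
    (Nat.doubleFactorial (6 * g - 3 - 2 * k) : ℚ) * |dZ g k| * (g : ℚ) ^ 2
      ≤ 30 * Nat.doubleFactorial (6 * g - 1) := by
  have hcases : ∃ j, k = 3 * j ∨ k = 3 * j + 1 ∨ k = 3 * j + 2 := ⟨k / 3, by omega⟩
  obtain ⟨j, rfl | rfl | rfl⟩ := hcases
  · have h1 := dZ_zero g j (by omega)
    have h2 : ((Nat.choose g j * Nat.doubleFactorial (6 * j + 1) *
      Nat.doubleFactorial (6 * g - 3 - 2 * (3 * j)) * g ^ 2 : ℕ) : ℚ) ≤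
        ((15 * Nat.doubleFactorial (6 * g - 1) : ℕ) : ℚ) := by
      exact_mod_cast (Nat.mul_le_mul_right _ (incr_nat g j (by omega))).trans
        (auxD_bound g j (by omega) (by omega))
    push_cast at h2
    calc _ ≤ ((6 * g - 3 - 2 * (3 * j)).doubleFactorial : ℚ) *
          (2 * (Nat.choose g j : ℚ) * Nat.doubleFactorial (6 * j + 1)) * (g : ℚ) ^ 2 := by gcongr
      _ ≤ _ := by linarith
  · rcases Nat.eq_zero_or_pos j with rfl | hj
    · have h1 := dZ_one g 0 (by omega)
      obtain ⟨n, rfl⟩ : ∃ n, g = n + 1 := ⟨g - 1, by omega⟩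
      have h3 : (Nat.doubleFactorial (6 * 0 + 3) : ℚ) = 3 := by
        have : Nat.doubleFactorial (6 * 0 + 3) = 3 := by decide
        rw [this]; norm_num
      rw [h3, Nat.choose_zero_right] at h1
      have e1 : 6 * (n + 1) - 3 - 2 * (3 * 0 + 1) = 6 * n + 1 := by omega
      have e2 : 6 * (n + 1) - 1 = ((6 * n + 1) + 2) + 2 := by omega
      rw [e1, e2, Nat.doubleFactorial_add_two, Nat.doubleFactorial_add_two]
      calc _ ≤ ((6 * n + 1).doubleFactorial : ℚ) * (2 * (1 : ℕ) * 3) * ((n + 1 : ℕ) : ℚ) ^ 2 := by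
            gcongr
        _ = ((6 * n + 1).doubleFactorial : ℚ) * (6 * ((n : ℚ) + 1) ^ 2) := by push_cast; ring
        _ ≤ ((6 * n + 1).doubleFactorial : ℚ) * (30 * ((6 * n + 1 + 2 + 2) * (6 * n + 1 + 2))) := by
            have hn : (0 : ℚ) ≤ n := by positivity
            apply mul_le_mul_of_nonneg_left _ (by positivity)
            nlinarith
        _ = _ := by push_cast; ring
    · have h1 := dZ_one g j (by omega)
      have h2 : ((Nat.choose g j * Nat.doubleFactorial (6 * j + 3) *
        Nat.doubleFactorial (6 * g - 3 - 2 * (3 * j + 1)) * g ^ 2 : ℕ) : ℚ) ≤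
          ((15 * Nat.doubleFactorial (6 * g - 1) : ℕ) : ℚ) := by
        exact_mod_cast (Nat.mul_le_mul_right _ (incr_nat' g j (by omega))).trans
          (auxD_bound g j (by omega) (by omega))
      push_cast at h2
      calc _ ≤ ((6 * g - 3 - 2 * (3 * j + 1)).doubleFactorial : ℚ) *
            (2 * (Nat.choose g j : ℚ) * Nat.doubleFactorial (6 * j + 3)) * (g : ℚ) ^ 2 := by gcongr
        _ ≤ _ := by linarith
  · have h1 := dZ_two g j (by omega)
    have h2 : ((auxD g (j + 1) * g ^ 2 : ℕ) : ℚ) ≤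
        ((15 * Nat.doubleFactorial (6 * g - 1) : ℕ) : ℚ) := by
      exact_mod_cast (auxD_bound g (j + 1) (by omega) (by omega))
    unfold auxD at h2
    have e1 : 6 * g - 3 - 2 * (3 * j + 2) = 6 * (g - (j + 1)) - 1 := by omega
    rw [e1]
    push_cast at h2
    calc _ ≤ ((6 * (g - (j + 1)) - 1).doubleFactorial : ℚ) *
          ((Nat.choose g (j + 1) : ℚ) * Nat.doubleFactorial (6 * (j + 1) - 1)) * (g : ℚ) ^ 2 := by
            gcongr
      _ ≤ _ := by linarith

lemma incr_zero (g : ℕ) (hg : 1 ≤ g) :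
    |((Nat.doubleFactorial (6 * g - 3 - 2 * 0) : ℚ) /
          (Nat.doubleFactorial (6 * g - 1) : ℚ)) * dZ g 0| ≤ 2 / g := by
  obtain ⟨n, rfl⟩ : ∃ n, g = n + 1 := ⟨g - 1, by omega⟩
  have h1 := dZ_zero (n + 1) 0 (by omega)
  simp at h1
  have e1 : 6 * (n + 1) - 3 - 2 * 0 = 6 * n + 3 := by omega
  have e2 : 6 * (n + 1) - 1 = (6 * n + 3) + 2 := by omega
  rw [e1, e2, Nat.doubleFactorial_add_two (6 * n + 3), abs_mul, abs_of_nonneg (by positivity)]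
  have hp : (0 : ℚ) < (6 * n + 3).doubleFactorial := by
    exact_mod_cast Nat.doubleFactorial_pos _
  push_cast
  rw [le_div_iff₀ (by positivity), div_mul_eq_mul_div, div_mul_eq_mul_div, div_le_iff₀ (by positivity)]
  have hn : (0 : ℚ) ≤ n := by positivity
  calc _ ≤ ((6 * n + 3).doubleFactorial : ℚ) * 2 * (n + 1) := by gcongr
    _ ≤ _ := by nlinarith [mul_nonneg hp.le hn]

lemma aRec_bound (g k : ℕ) (hg : 1 ≤ g) (h : 2 * k ≤ 3 * g - 1) :
    |aRec g k - 1| ≤ 2 / g + k * (30 / (g : ℚ) ^ 2) := by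
  induction k with
  | zero =>
    simp only [aRec, sub_self, abs_zero]
    positivity
  | succ k ih =>
    have ih := ih (by omega)
    rw [aRec]
    have hgq : (0 : ℚ) < g := by exact_mod_cast hg
    rcases Nat.eq_zero_or_pos k with rfl | hk
    · have := incr_zero g hg
      simp only [aRec]
      rw [add_sub_cancel_left]
      refine this.trans ?_
      have : (0 : ℚ) ≤ ((0 + 1 : ℕ) : ℚ) * (30 / (g : ℚ) ^ 2) := by positivity
      linarith
    · have hb := incr_bound g k hk h
      have hp : (0 : ℚ) < (6 * g - 1).doubleFactorial := by
        exact_mod_cast Nat.doubleFactorial_pos _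
      have hb' : |((Nat.doubleFactorial (6 * g - 3 - 2 * k) : ℚ) /
          (Nat.doubleFactorial (6 * g - 1) : ℚ)) * dZ g k| ≤ 30 / (g : ℚ) ^ 2 := by
        rw [abs_mul, abs_of_nonneg (by positivity), le_div_iff₀ (by positivity),
          div_mul_eq_mul_div, div_mul_eq_mul_div, div_le_iff₀ hp]
        exact hb
      rw [add_sub_right_comm]
      refine (abs_add_le _ _).trans ?_
      push_cast
      linarith

lemma aZ_bound (g k : ℕ) (hg : 1 ≤ g) (hk : k < 3 * g) : |aZ g k - 1| ≤ 62 / g := by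
  have key : ∀ k, 2 * k ≤ 3 * g - 1 → |aRec g k - 1| ≤ 62 / g := by
    intro k h
    refine (aRec_bound g k hg h).trans ?_
    have hgq : (0 : ℚ) < g := by exact_mod_cast hg
    have hkq : (k : ℚ) ≤ 2 * g := by exact_mod_cast (by omega : k ≤ 2 * g)
    calc _ ≤ 2 / (g : ℚ) + 2 * g * (30 / (g : ℚ) ^ 2) := by gcongr
      _ = _ := by field_simp; norm_num
  unfold aZ
  split_ifs with h
  · exact key _ (by omega)
  · exact key _ (by omega)

lemma sum_pairs (f : ℕ → ℕ) (m : ℕ) :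
    ∑ k ∈ Finset.range m, (f (2 * k) + f (2 * k + 1)) = ∑ i ∈ Finset.range (2 * m), f i := by
  induction m with
  | zero => simp
  | succ m ih =>
    rw [Finset.sum_range_succ, ih, show 2 * (m + 1) = 2 * m + 1 + 1 by ring,
      Finset.sum_range_succ, Finset.sum_range_succ]
    ring

lemma sum_odd (m : ℕ) (hm : 1 ≤ m) :
    ∑ k ∈ Finset.range m, Nat.choose (2 * m) (2 * k + 1) = 2 ^ (2 * m - 1) := by
  obtain ⟨n, rfl⟩ : ∃ n, m = n + 1 := ⟨m - 1, by omega⟩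
  rw [← Nat.sum_range_choose, show 2 * (n + 1) - 1 + 1 = 2 * (n + 1) by omega, ← sum_pairs]
  apply Finset.sum_congr rfl
  intro k _
  rw [show 2 * (n + 1) = (2 * (n + 1) - 1) + 1 by omega, Nat.choose_succ_succ]
  simp

lemma avg_bound (g : ℕ) (hg : 1 ≤ g) :
    |(∑ k ∈ Finset.range (3 * g), (Nat.choose (6 * g) (2 * k + 1) : ℝ) * ((aZ g k : ℚ) : ℝ))
      / 2 ^ (6 * g - 1) - 1| ≤ 62 / g := by
  have hs : ∑ k ∈ Finset.range (3 * g), (Nat.choose (6 * g) (2 * k + 1) : ℝ) = 2 ^ (6 * g - 1) := by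
    have := sum_odd (3 * g) (by omega)
    rw [show 2 * (3 * g) = 6 * g by ring] at this
    exact_mod_cast this
  have hp : (0 : ℝ) < 2 ^ (6 * g - 1) := by positivity
  rw [div_sub_one hp.ne', abs_div, abs_of_pos hp, div_le_iff₀ hp]
  rw [← hs, ← Finset.sum_sub_distrib, Finset.mul_sum]
  refine (Finset.abs_sum_le_sum_abs _ _).trans (Finset.sum_le_sum ?_)
  intro k hk
  have h1 := aZ_bound g k hg (Finset.mem_range.mp hk)
  have h2 : |((aZ g k : ℚ) : ℝ) - 1| ≤ 62 / g := by
    have : ((|aZ g k - 1| : ℚ) : ℝ) ≤ ((62 / g : ℚ) : ℝ) := by exact_mod_cast h1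
    push_cast at this
    exact this
  rw [← mul_sub_one, abs_mul, abs_of_nonneg (by positivity), mul_comm]
  gcongr

lemma zeta_bound : ∃ K : ℝ, ∀ g : ℕ, 1 ≤ g → |zetaSum (6 * g) - 1| ≤ K / g := by
  have hs2 : Summable (fun n : ℕ => 1 / ((n : ℝ) + 1) ^ 2) := by
    have := (summable_nat_add_iff 1).2 (Real.summable_one_div_nat_pow.2 (by norm_num : 1 < 2))
    simpa using this
  have hs2' := (summable_nat_add_iff 1).2 hs2
  refine ⟨∑' n : ℕ, 1 / (((n + 1 : ℕ) : ℝ) + 1) ^ 2, fun g hg => ?_⟩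
  have hs : Summable (fun n : ℕ => 1 / ((n : ℝ) + 1) ^ (6 * g)) := by
    have := (summable_nat_add_iff 1).2 (Real.summable_one_div_nat_pow.2 (by omega : 1 < 6 * g))
    simpa using this
  have hs' := (summable_nat_add_iff 1).2 hs
  unfold zetaSum
  rw [hs.tsum_eq_zero_add]
  simp only [Nat.cast_zero, zero_add, one_pow, div_one, add_sub_cancel_left]
  rw [abs_of_nonneg (tsum_nonneg fun n => by positivity), ← tsum_div_const]
  refine hs'.tsum_le_tsum (fun n => ?_) (hs2'.div_const _)
  rw [div_div]
  have hgR : (0 : ℝ) < g := by exact_mod_cast hg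
  apply one_div_le_one_div_of_le (by positivity)
  rw [show 6 * g = 2 + (6 * g - 2) by omega, pow_add]
  gcongr
  have h1 : (g : ℝ) ≤ 2 ^ g := by exact_mod_cast Nat.lt_two_pow_self.le
  calc (g : ℝ) ≤ 2 ^ g := h1
    _ ≤ 2 ^ (6 * g - 2) := by apply pow_le_pow_right₀ (by norm_num); omega
    _ ≤ _ := by
      apply pow_le_pow_left₀ (by norm_num)
      push_cast
      have : (0 : ℝ) ≤ n := by positivity
      linarith

open Stirling in
lemma log_stirling_upper (n : ℕ) (hn : 1 ≤ n) :
    Real.log (stirlingSeq n) ≤ Real.log (√Real.pi) + 1 / (12 * n) := by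
  have hstep : ∀ m : ℕ, Real.log (stirlingSeq n) - Real.log (stirlingSeq (n + m)) ≤
      1 / (12 * n) - 1 / (12 * ((n + m : ℕ) : ℝ)) := by
    intro m
    induction m with
    | zero => simp
    | succ m ih =>
      have h := log_stirlingSeq_sdiff_le (n + m)
      have hnR : (0 : ℝ) < ((n + m : ℕ) : ℝ) := by exact_mod_cast (by omega : 0 < n + m)
      have e : 1 / (12 * ((n + m : ℕ) : ℝ) * (((n + m : ℕ) : ℝ) + 1)) =
        1 / (12 * ((n + m : ℕ) : ℝ)) - 1 / (12 * ((n + (m + 1) : ℕ) : ℝ)) := by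
        rw [show ((n + (m + 1) : ℕ) : ℝ) = ((n + m : ℕ) : ℝ) + 1 by push_cast; ring]
        field_simp
        ring
      rw [e] at h
      rw [show n + (m + 1) = n + m + 1 by ring] at *
      linarith
  have hlim : Tendsto (fun m : ℕ => Real.log (stirlingSeq (n + m))) atTop
      (nhds (Real.log (√Real.pi))) := by
    have h1 : Tendsto (fun m : ℕ => stirlingSeq (n + m)) atTop (nhds (√Real.pi)) := by
      have := (tendsto_add_atTop_iff_nat n).2 tendsto_stirlingSeq_sqrt_pi
      simpa [add_comm] using this
    exact h1.log (by positivity)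
  have := ge_of_tendsto' hlim (b := Real.log (stirlingSeq n) - 1 / (12 * n)) (fun m => by
    have h := hstep m
    have : (0 : ℝ) ≤ 1 / (12 * ((n + m : ℕ) : ℝ)) := by positivity
    linarith)
  linarith

open Stirling in
lemma log_stirling_lower (n : ℕ) (hn : 1 ≤ n) :
    Real.log (√Real.pi) ≤ Real.log (stirlingSeq n) :=
  Real.log_le_log (by positivity) (sqrt_pi_le_stirlingSeq (by omega))

open Stirling in
lemma fact_eq (n : ℕ) (hn : 1 ≤ n) :
    (Nat.factorial n : ℝ) = stirlingSeq n * (√(2 * n : ℝ) * (n / Real.exp 1) ^ n) := by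
  have : (0 : ℝ) < n := by exact_mod_cast hn
  unfold stirlingSeq
  field_simp

open Stirling in
lemma pref_eq (g : ℕ) (hg : 1 ≤ g) :
    ((Nat.factorial (4 * g) : ℝ) / ((Nat.factorial g : ℝ) * (Nat.factorial (3 * g) : ℝ))) *
      √(3 * Real.pi * g / 2) * ((27 : ℝ) / 256) ^ g =
    stirlingSeq (4 * g) * √Real.pi / (stirlingSeq g * stirlingSeq (3 * g)) := by
  have hgR : (0 : ℝ) < g := by exact_mod_cast hg
  rw [fact_eq (4 * g) (by omega), fact_eq g hg, fact_eq (3 * g) (by omega)]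
  have p1 : 0 < stirlingSeq g := (Real.sqrt_pos.2 Real.pi_pos).trans_le (sqrt_pi_le_stirlingSeq (by omega))
  have p2 : 0 < stirlingSeq (3 * g) :=
    (Real.sqrt_pos.2 Real.pi_pos).trans_le (sqrt_pi_le_stirlingSeq (by omega))
  have hsq : √(2 * ((4 * g : ℕ) : ℝ)) * √(3 * Real.pi * g / 2) =
      √Real.pi * (√(2 * g : ℝ) * √(2 * ((3 * g : ℕ) : ℝ))) := by
    rw [← Real.sqrt_mul (by positivity), ← Real.sqrt_mul (by positivity),
      ← Real.sqrt_mul (by positivity)]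
    congr 1
    push_cast; ring
  have hpow : (((4 * g : ℕ) : ℝ) / Real.exp 1) ^ (4 * g) * ((27 : ℝ) / 256) ^ g =
      ((g : ℝ) / Real.exp 1) ^ g * (((3 * g : ℕ) : ℝ) / Real.exp 1) ^ (3 * g) := by
    rw [pow_mul, pow_mul, ← mul_pow, ← mul_pow]
    congr 1
    push_cast
    field_simp
    norm_num
  have q1 : 0 < √(2 * g : ℝ) := by positivity
  have q2 : 0 < √(2 * ((3 * g : ℕ) : ℝ)) := by push_cast; positivity
  have q3 : 0 < ((g : ℝ) / Real.exp 1) ^ g := by positivity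
  have q4 : 0 < (((3 * g : ℕ) : ℝ) / Real.exp 1) ^ (3 * g) := by push_cast; positivity
  rw [div_mul_eq_mul_div, div_mul_eq_mul_div, div_eq_div_iff (by positivity) (by positivity)]
  calc _ = stirlingSeq (4 * g) * (√(2 * ((4 * g : ℕ) : ℝ)) * √(3 * Real.pi * g / 2)) *
        ((((4 * g : ℕ) : ℝ) / Real.exp 1) ^ (4 * g) * ((27 : ℝ) / 256) ^ g) *
          (stirlingSeq g * stirlingSeq (3 * g)) := by ring
    _ = _ := by rw [hsq, hpow]; ring

open Stirling in
lemma pref_bound (g : ℕ) (hg : 1 ≤ g) :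
    |((Nat.factorial (4 * g) : ℝ) / ((Nat.factorial g : ℝ) * (Nat.factorial (3 * g) : ℝ))) *
      √(3 * Real.pi * g / 2) * ((27 : ℝ) / 256) ^ g - 1| ≤ 2 / g := by
  rw [pref_eq g hg]
  have hgR : (1 : ℝ) ≤ g := by exact_mod_cast hg
  have hpi : 0 < √Real.pi := Real.sqrt_pos.2 Real.pi_pos
  have p1 : 0 < stirlingSeq g := hpi.trans_le (sqrt_pi_le_stirlingSeq (by omega))
  have p2 : 0 < stirlingSeq (3 * g) := hpi.trans_le (sqrt_pi_le_stirlingSeq (by omega))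
  have p3 : 0 < stirlingSeq (4 * g) := hpi.trans_le (sqrt_pi_le_stirlingSeq (by omega))
  set x := stirlingSeq (4 * g) * √Real.pi / (stirlingSeq g * stirlingSeq (3 * g)) with hx
  have hxp : 0 < x := by positivity
  have hl : Real.log x = Real.log (stirlingSeq (4 * g)) + Real.log (√Real.pi) -
      (Real.log (stirlingSeq g) + Real.log (stirlingSeq (3 * g))) := by
    rw [hx, Real.log_div (by positivity) (by positivity), Real.log_mul p3.ne' hpi.ne',
      Real.log_mul p1.ne' p2.ne']
  have u1 := log_stirling_upper g hg
  have u2 := log_stirling_upper (3 * g) (by omega)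
  have u3 := log_stirling_upper (4 * g) (by omega)
  have l1 := log_stirling_lower g hg
  have l2 := log_stirling_lower (3 * g) (by omega)
  have l3 := log_stirling_lower (4 * g) (by omega)
  have hi : (1 : ℝ) / g ≤ 1 := by rw [div_le_one (by positivity)]; exact hgR
  have hi0 : 0 < (1 : ℝ) / g := by positivity
  have f1 : 1 / (12 * (g : ℝ)) = 1 / 12 * (1 / g) := by field_simp
  have f2 : 1 / (12 * ((3 * g : ℕ) : ℝ)) = 1 / 36 * (1 / g) := by push_cast; field_simp; norm_num
  have f3 : 1 / (12 * ((4 * g : ℕ) : ℝ)) = 1 / 48 * (1 / g) := by push_cast; field_simp; norm_num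
  rw [f1] at u1
  rw [f2] at u2
  rw [f3] at u3
  have habs : |Real.log x| ≤ 1 / g := by
    rw [abs_le]; constructor <;> linarith
  have := Real.abs_exp_sub_one_le (habs.trans hi)
  rw [Real.exp_log hxp] at this
  calc _ ≤ _ := this
    _ ≤ 2 * (1 / g) := by gcongr
    _ = _ := by ring

lemma V1_factor (g : ℕ) (hg : 1 ≤ g) :
    V1succ g * Real.sqrt (3 * Real.pi * g / 2) * ((3 : ℝ) / 8) ^ (4 * g) =
      zetaSum (6 * g) *
      (((Nat.factorial (4 * g) : ℝ) / ((Nat.factorial g : ℝ) * (Nat.factorial (3 * g) : ℝ))) *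
        √(3 * Real.pi * g / 2) * ((27 : ℝ) / 256) ^ g) *
      ((∑ k ∈ Finset.range (3 * g), (Nat.choose (6 * g) (2 * k + 1) : ℝ) * ((aZ g k : ℚ) : ℝ))
      / 2 ^ (6 * g - 1)) := by
  have hpow : (3 : ℝ) ^ (-(g : ℤ)) * (2 : ℝ) ^ (1 - 2 * (g : ℤ)) * ((3 : ℝ) / 8) ^ (4 * g) =
      ((27 : ℝ) / 256) ^ g / 2 ^ (6 * g - 1) := by
    have e : (2 : ℝ) ^ (6 * g - 1) = (64 : ℝ) ^ g / 2 := by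
      rw [eq_div_iff (by norm_num), ← pow_succ, show 6 * g - 1 + 1 = 6 * g by omega, pow_mul]
      norm_num
    rw [e, zpow_neg, zpow_natCast, zpow_sub₀ (by norm_num), zpow_mul, zpow_natCast, pow_mul, zpow_one]
    have h27 : ((27 : ℝ) / 256) ^ g = ((3 : ℝ) ^ g)⁻¹ * (((2 : ℝ) ^ (2 : ℤ)) ^ g)⁻¹ *
        (((3 : ℝ) / 8) ^ 4) ^ g * 64 ^ g := by
      rw [← inv_pow, ← inv_pow, ← mul_pow, ← mul_pow, ← mul_pow]
      norm_num
    rw [h27]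
    field_simp
  unfold V1succ
  generalize (∑ k ∈ Finset.range (3 * g), (Nat.choose (6 * g) (2 * k + 1) : ℝ) *
    ((aZ g k : ℚ) : ℝ)) = S
  calc _ = zetaSum (6 * g) * ((Nat.factorial (4 * g) : ℝ) /
      ((Nat.factorial g : ℝ) * (Nat.factorial (3 * g) : ℝ))) * S * √(3 * Real.pi * g / 2) *
      ((3 : ℝ) ^ (-(g : ℤ)) * (2 : ℝ) ^ (1 - 2 * (g : ℤ)) * ((3 : ℝ) / 8) ^ (4 * g)) := by ring
    _ = _ := by rw [hpow]; ring

lemma mul_near_one {x y a b t : ℝ} (ht : 0 ≤ t) (ht1 : t ≤ 1) (ha : |x - 1| ≤ a * t)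
    (hb : |y - 1| ≤ b * t) (ha0 : 0 ≤ a) (hb0 : 0 ≤ b) :
    |x * y - 1| ≤ (a * b + a + b) * t := by
  have e : x * y - 1 = (x - 1) * (y - 1) + (x - 1) + (y - 1) := by ring
  rw [e]
  refine (abs_add_le _ _).trans ((add_le_add (abs_add_le _ _) le_rfl).trans ?_)
  rw [abs_mul]
  have h1 : |x - 1| * |y - 1| ≤ (a * t) * (b * t) :=
    mul_le_mul ha hb (abs_nonneg _) (by positivity)
  have h2 : (a * t) * (b * t) ≤ a * b * t := by
    have : t * t ≤ t := by nlinarith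
    nlinarith [mul_le_mul_of_nonneg_left this (mul_nonneg ha0 hb0)]
  linarith

/-- `V₁(g+1) = √(2/(3πg))·(8/3)^{4g}·(1 + O(1/g))` as `g → ∞`; precisely,
`g·(V₁(g+1)·√(3πg/2)·(3/8)^{4g} − 1)` remains bounded as `g → ∞`. -/
theorem V1_asymptotics :
    ∃ C : ℝ, ∀ᶠ g : ℕ in atTop,
      |(g : ℝ) * (V1succ g * Real.sqrt (3 * Real.pi * g / 2) * ((3 : ℝ) / 8) ^ (4 * g) - 1)|
        ≤ C := by
  obtain ⟨K, hK⟩ := zeta_bound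
  have hK0 : 0 ≤ K := by
    have := (abs_nonneg _).trans (hK 1 le_rfl)
    simpa using this
  refine ⟨(K * 2 + K + 2) * 62 + (K * 2 + K + 2) + 62, ?_⟩
  filter_upwards [eventually_ge_atTop 1] with g hg
  have hgR : (1 : ℝ) ≤ g := by exact_mod_cast hg
  have hg0 : (0 : ℝ) < g := by linarith
  have ht : (0 : ℝ) ≤ 1 / g := by positivity
  have ht1 : (1 : ℝ) / g ≤ 1 := by rw [div_le_one hg0]; exact hgR
  have hz := hK g hg
  have hp := pref_bound g hg
  have ha := avg_bound g hg
  rw [div_eq_mul_one_div K] at hz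
  rw [div_eq_mul_one_div 2] at hp
  rw [div_eq_mul_one_div 62] at ha
  have h1 := mul_near_one ht ht1 hz hp hK0 (by norm_num)
  have h2 := mul_near_one ht ht1 h1 ha (by positivity) (by norm_num)
  rw [V1_factor g hg, abs_mul, abs_of_pos hg0]
  calc _ ≤ (g : ℝ) * (((K * 2 + K + 2) * 62 + (K * 2 + K + 2) + 62) * (1 / g)) :=
        mul_le_mul_of_nonneg_left h2 hg0.le
    _ = _ := by field_simp
end

section
/- Define W(g) = 2·ζ(6g−6)·C(4g−4, g)·12^{−g}·∑_{i=1}^{g−1} C(g,i)·C(3g−4, 3i−2) for integers g ≥ 2. Then W(g) is asymptotically equivalent to (2/(3πg))·(1/4^g)·(8/3)^{4g−4} as g → ∞, i.e. the ratio of the two quantities tends to 1. -/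
open Filter

/-- `W(g) = 2·ζ(6g−6)·C(4g−4,g)·12^{−g}·∑_{i=1}^{g−1} C(g,i)·C(3g−4,3i−2)`, the total
contribution of one-cylinder square-tiled surfaces with separating core curve to the
Masur–Veech volume of the moduli space of holomorphic quadratic differentials in genus `g`. -/
noncomputable def Wsep (g : ℕ) : ℝ :=
  2 * zetaSum (6 * g - 6) * (Nat.choose (4 * g - 4) g : ℝ) * (12 : ℝ) ^ (-(g : ℤ)) *
    ∑ i ∈ Finset.Icc 1 (g - 1), (Nat.choose g i : ℝ) * (Nat.choose (3 * g - 4) (3 * i - 2) : ℝ)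

lemma zeta_lim : Tendsto (fun g : ℕ => zetaSum (6 * g - 6)) atTop (nhds 1) := by
  have h1 : (1:ℝ) = ∑' n : ℕ, (if n = 0 then (1:ℝ) else 0) := by simp
  rw [h1]
  unfold zetaSum
  refine tendsto_tsum_of_dominated_convergence (bound := fun n : ℕ => 1 / ((n : ℝ) + 1) ^ 2) ?_ ?_ ?_
  · have := (summable_nat_add_iff 1).2 (Real.summable_one_div_nat_pow.2 (by norm_num : 1 < 2))
    simpa using this
  · intro k
    rcases Nat.eq_zero_or_pos k with rfl | hk
    · simp
    · have hk' : k ≠ 0 := by omega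
      simp only [hk', if_false]
      have h2 : Tendsto (fun g : ℕ => 6 * g - 6) atTop atTop := by
        apply tendsto_atTop_mono (f := fun g => g - 2) (fun g => by omega)
        exact tendsto_sub_atTop_nat 2
      have h3 : Tendsto (fun m : ℕ => (1 / ((k:ℝ)+1))^m) atTop (nhds 0) := by
        apply tendsto_pow_atTop_nhds_zero_of_lt_one (by positivity)
        rw [div_lt_one (by positivity)]
        have : (0:ℝ) < k := by exact_mod_cast hk
        linarith
      have h4 := h3.comp h2
      refine h4.congr (fun g => ?_)
      simp
  · filter_upwards [eventually_ge_atTop 2] with g hg k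
    rw [Real.norm_of_nonneg (by positivity)]
    apply one_div_le_one_div_of_le (by positivity)
    apply pow_le_pow_right₀
    · have : (0:ℝ) ≤ k := by positivity
      linarith
    · omega

lemma fact_stirling (n : ℕ) (hn : 0 < n) :
    (n.factorial : ℝ) = Stirling.stirlingSeq n * (√(2 * n : ℝ) * (n / Real.exp 1) ^ n) := by
  unfold Stirling.stirlingSeq
  have : (0:ℝ) < n := by exact_mod_cast hn
  rw [div_mul_cancel₀]
  positivity

lemma choose_four (g : ℕ) (hg : 0 < g) :
    (Nat.choose (4 * g) g : ℝ) * √g * (27/256)^g =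
      Stirling.stirlingSeq (4*g) / (Stirling.stirlingSeq g * Stirling.stirlingSeq (3*g)) * √(2/3) := by
  have hgR : (0:ℝ) < g := by exact_mod_cast hg
  have h := Nat.cast_choose ℝ (show g ≤ 4 * g by omega)
  rw [show 4 * g - g = 3 * g by omega, fact_stirling (4*g) (by omega), fact_stirling g hg,
    fact_stirling (3*g) (by omega)] at h
  have hs : ∀ n : ℕ, 0 < n → Stirling.stirlingSeq n ≠ 0 := by
    intro n hn
    obtain ⟨m, rfl⟩ := Nat.exists_eq_succ_of_ne_zero hn.ne'
    exact (Stirling.stirlingSeq'_pos m).ne'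
  have h1 := hs (4*g) (by omega)
  have h2 := hs g hg
  have h3 := hs (3*g) (by omega)
  rw [h]
  have e1 : √(2 * ((4 * g : ℕ) : ℝ)) = 2 * √(2 * g) := by
    rw [show 2 * ((4 * g : ℕ) : ℝ) = 2^2 * (2 * g) by push_cast; ring, Real.sqrt_mul (by positivity),
      Real.sqrt_sq (by norm_num)]
  have e2 : √(2 * ((3 * g : ℕ) : ℝ)) = √6 * √g := by
    rw [show 2 * ((3 * g : ℕ) : ℝ) = 6 * g by push_cast; ring, Real.sqrt_mul (by positivity)]
  have e3 : √(2/3 : ℝ) = 2 / √6 := by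
    rw [show (2/3:ℝ) = 2^2/6 by norm_num, Real.sqrt_div (by positivity), Real.sqrt_sq (by norm_num)]
  have e4 : (((4 * g : ℕ) : ℝ) / Real.exp 1)^(4*g) = 256^g * ((g / Real.exp 1)^g)^4 := by
    push_cast
    rw [mul_div_assoc, mul_pow, pow_mul]
    norm_num [← pow_mul]
    ring
  have e5 : (((3 * g : ℕ) : ℝ) / Real.exp 1)^(3*g) = 27^g * ((g / Real.exp 1)^g)^3 := by
    push_cast
    rw [mul_div_assoc, mul_pow, pow_mul]
    norm_num [← pow_mul]
    ring
  rw [e1, e2, e3, e4, e5, div_pow (27:ℝ) 256]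
  have : (g / Real.exp 1)^g ≠ 0 := by positivity
  generalize (g / Real.exp 1)^g = X at *
  have a1 : √(2 * (g:ℝ)) ≠ 0 := by positivity
  field_simp

lemma choose_four_lim :
    Tendsto (fun g : ℕ => (Nat.choose (4 * g) g : ℝ) * √g * (27/256)^g) atTop
      (nhds (√(2/3) / √Real.pi)) := by
  have h0 := Stirling.tendsto_stirlingSeq_sqrt_pi
  have h4 : Tendsto (fun g : ℕ => 4 * g) atTop atTop := tendsto_id.const_mul_atTop' (by norm_num)
  have h3 : Tendsto (fun g : ℕ => 3 * g) atTop atTop := tendsto_id.const_mul_atTop' (by norm_num)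
  have hp : √Real.pi ≠ 0 := by positivity
  have := (((h0.comp h4).div (h0.mul (h0.comp h3)) (by positivity)).mul_const (√(2/3)))
  rw [show √(2/3) / √Real.pi = √Real.pi / (√Real.pi * √Real.pi) * √(2/3) by field_simp]
  refine this.congr' ?_
  filter_upwards [eventually_gt_atTop 0] with g hg
  rw [choose_four g hg]
  simp

lemma choose_shift (m : ℕ) : (Nat.choose (4 * m) (m+1) : ℝ) =
    Nat.choose (4 * (m+1)) (m+1) *
      (((3*m+3 : ℝ)/(4*m+4)) * ((3*m+2)/(4*m+3)) * ((3*m+1)/(4*m+2)) * ((3*m)/(4*m+1))) := by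
  have key : ∀ n : ℕ, m ≤ n → (Nat.choose n (m+1) : ℝ) = Nat.choose (n+1) (m+1) * (((n:ℝ) - m)/(n+1)) := by
    intro n hn
    have := Nat.choose_mul_succ_eq n (m+1)
    rw [show n + 1 - (m+1) = n - m by omega] at this
    have h2 : (Nat.choose n (m+1) : ℝ) * (n+1) = Nat.choose (n+1) (m+1) * ((n:ℝ) - m) := by
      rw [← Nat.cast_sub hn]; exact_mod_cast this
    rw [← mul_div_assoc, ← h2]
    field_simp
  rw [key (4*m) (by omega), key (4*m+1) (by omega), key (4*m+1+1) (by omega), key (4*m+1+1+1) (by omega)]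
  rw [show 4*m+1+1+1+1 = 4*(m+1) by ring]
  push_cast
  have a1 : (4*(m:ℝ)+1) ≠ 0 := by positivity
  have a2 : (4*(m:ℝ)+1+1) ≠ 0 := by positivity
  have a3 : (4*(m:ℝ)+1+1+1) ≠ 0 := by positivity
  have a4 : (4*(m:ℝ)+1+1+1+1) ≠ 0 := by positivity
  rw [show 4*(m:ℝ)+2 = 4*m+1+1 by ring, show 4*(m:ℝ)+3 = 4*m+1+1+1 by ring, show 4*(m:ℝ)+4 = 4*m+1+1+1+1 by ring]
  field_simp
  ring

lemma frac_lim (a b : ℝ) : Tendsto (fun m : ℕ => (3 * (m:ℝ) + a)/(4*m+b)) atTop (nhds (3/4)) := by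
  have h : ∀ c : ℝ, Tendsto (fun m : ℕ => c / (m:ℝ)) atTop (nhds 0) := fun c =>
    tendsto_const_div_atTop_nhds_zero_nat c
  have := ((h a).const_add 3).div ((h b).const_add 4) (by norm_num)
  simp only [add_zero] at this
  refine this.congr' ?_
  filter_upwards [eventually_gt_atTop 0] with m hm
  have : (m:ℝ) ≠ 0 := by positivity
  simp only [Pi.div_apply]
  rw [← mul_div_mul_right _ _ this]
  congr 1 <;> field_simp

lemma choose_lim :
    Tendsto (fun g : ℕ => (Nat.choose (4 * g - 4) g : ℝ) * √g * (27/256)^g) atTop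
      (nhds (√(2/3) / √Real.pi * (81/256))) := by
  rw [← tendsto_add_atTop_iff_nat 1]
  have h1 := (tendsto_add_atTop_iff_nat 1).2 choose_four_lim
  have h2 := h1.mul ((((frac_lim 3 4).mul (frac_lim 2 3)).mul (frac_lim 1 2)).mul (frac_lim 0 1))
  rw [show (3/4*(3/4)*(3/4)*(3/4) : ℝ) = 81/256 by norm_num] at h2
  refine h2.congr (fun m => ?_)
  rw [show 4 * (m+1) - 4 = 4 * m by omega, choose_shift]
  simp only [add_zero]
  ring

lemma exp_orth (k : ℤ) : (∫ u in (-(Real.pi/2))..(Real.pi/2), Complex.exp ((2 * k * Complex.I) * u)) =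
    if k = 0 then (Real.pi : ℂ) else 0 := by
  split_ifs with h
  · subst h
    simp
  · have hk : (k:ℂ) ≠ 0 := by exact_mod_cast h
    rw [integral_exp_mul_complex (by simp [hk])]
    rw [show (2 * k * Complex.I) * ((Real.pi/2 : ℝ):ℂ) = k * (Real.pi * Complex.I) by push_cast; ring]
    rw [show (2 * k * Complex.I) * ((-(Real.pi/2) : ℝ):ℂ) = k * (Real.pi * Complex.I) - k * (2 * Real.pi * Complex.I) by push_cast; ring]
    rw [Complex.exp_sub, Complex.exp_int_mul_two_pi_mul_I]
    simp

lemma integrand_expand (m : ℕ) (u : ℝ) :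
    (2:ℂ)^(4*m+4) * ((Real.cos (3*u) ^ (m+2) * Real.cos u ^ (3*m+2) : ℝ) : ℂ) =
    ∑ i ∈ Finset.range (m+3), ∑ j ∈ Finset.range (3*m+3),
      ((Nat.choose (m+2) i : ℂ) * (Nat.choose (3*m+2) j : ℂ)) *
        Complex.exp ((2 * ((3 * (i:ℤ) - j - 2 : ℤ) : ℂ) * Complex.I) * u) := by
  push_cast
  rw [show (2:ℂ)^(4*m+4) * (Complex.cos (3*u) ^ (m+2) * Complex.cos u ^ (3*m+2)) =
    (2 * Complex.cos (3*u))^(m+2) * (2*Complex.cos u)^(3*m+2) by rw [mul_pow, mul_pow]; ring]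
  rw [Complex.two_cos, Complex.two_cos]
  rw [add_pow, add_comm (Complex.exp (u * Complex.I)), add_pow, Finset.sum_mul_sum]
  refine Finset.sum_congr rfl fun i hi => Finset.sum_congr rfl fun j hj => ?_
  have hi' : i ≤ m + 2 := by simp at hi; omega
  have hj' : j ≤ 3*m + 2 := by simp at hj; omega
  rw [← Complex.exp_nat_mul, ← Complex.exp_nat_mul, ← Complex.exp_nat_mul, ← Complex.exp_nat_mul]
  rw [show ∀ a b c d e f : ℂ, a * b * c * (d * e * f) = c * f * (a * b * d * e) by intros; ring]
  rw [← Complex.exp_add, ← Complex.exp_add, ← Complex.exp_add]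
  congr 2
  rw [Nat.cast_sub hi', Nat.cast_sub hj']
  push_cast
  ring

lemma sum_eq_integral (m : ℕ) :
    Real.pi * ∑ i ∈ Finset.Icc 1 (m+1), (Nat.choose (m+2) i : ℝ) * (Nat.choose (3*m+2) (3 * i - 2) : ℝ)
     = 2^(4*m+4) * ∫ u in (-(Real.pi/2))..(Real.pi/2), Real.cos (3*u) ^ (m+2) * Real.cos u ^ (3*m+2) := by
  have h : ((2^(4*m+4) * ∫ u in (-(Real.pi/2))..(Real.pi/2), Real.cos (3*u) ^ (m+2) * Real.cos u ^ (3*m+2) : ℝ) : ℂ)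
     = ∑ i ∈ Finset.range (m+3), ∑ j ∈ Finset.range (3*m+3),
      ((Nat.choose (m+2) i : ℂ) * (Nat.choose (3*m+2) j : ℂ)) * (if (3 * (i:ℤ) - j - 2 : ℤ) = 0 then (Real.pi : ℂ) else 0) := by
    rw [Complex.ofReal_mul, ← intervalIntegral.integral_ofReal]
    push_cast
    rw [← intervalIntegral.integral_const_mul]
    have := integrand_expand m
    push_cast at this
    simp_rw [this]
    rw [intervalIntegral.integral_finsetSum]
    · refine Finset.sum_congr rfl fun i hi => ?_
      rw [intervalIntegral.integral_finsetSum]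
      · refine Finset.sum_congr rfl fun j hj => ?_
        rw [intervalIntegral.integral_const_mul]
        congr 1
        have := exp_orth (3 * (i:ℤ) - j - 2)
        push_cast at this
        exact this
      · intro j hj
        apply Continuous.intervalIntegrable
        fun_prop
    · intro i hi
      apply Continuous.intervalIntegrable
      fun_prop
  apply Complex.ofReal_injective
  rw [h]
  push_cast
  rw [Finset.mul_sum]
  symm
  have hsub : Finset.Icc 1 (m+1) ⊆ Finset.range (m+3) := by
    intro i hi
    simp at hi ⊢
    omega
  rw [← Finset.sum_subset hsub]
  · refine Finset.sum_congr rfl fun i hi => ?_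
    simp at hi
    rw [Finset.sum_eq_single (3 * i - 2)]
    · rw [if_pos (by omega)]
      ring
    · intro j hj hne
      rw [if_neg (by omega)]
      simp
    · intro hn
      simp at hn
      omega
  · intro i hi hni
    simp at hi hni
    apply Finset.sum_eq_zero
    intro j hj
    simp at hj
    rw [if_neg (by omega)]
    simp

lemma cos_scaled_lim (x : ℝ) : Tendsto (fun n : ℕ => (n:ℝ) * (Real.cos (x / √n) - 1)) atTop (nhds (-x^2/2)) := by
  rw [tendsto_iff_norm_sub_tendsto_zero]
  have hz : Tendsto (fun n : ℕ => (x^4 * (5/96)) / (n:ℝ)) atTop (nhds 0) := tendsto_const_div_atTop_nhds_zero_nat _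
  refine squeeze_zero' (Eventually.of_forall fun _ => norm_nonneg _) ?_ hz
  filter_upwards [eventually_gt_atTop 0, eventually_ge_atTop (Nat.ceil (x^2))] with n hn hx
  have hn' : (0:ℝ) < n := by exact_mod_cast hn
  have hx' : x^2 ≤ n := Nat.ceil_le.1 hx
  have hsq : (√(n:ℝ))^2 = n := Real.sq_sqrt hn'.le
  have hy : |x / √n| ≤ 1 := by
    rw [abs_le_one_iff_mul_self_le_one, ← pow_two, div_pow, hsq, div_le_one hn']
    exact hx'
  have hb := Real.cos_bound hy
  have h4 : |x / √n|^4 = x^4 / n^2 := by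
    rw [show |x / √n|^4 = (|x / √n|^2)^2 by ring, sq_abs, div_pow, hsq]; ring
  rw [h4, div_pow, hsq] at hb
  rw [Real.norm_eq_abs, show (n:ℝ) * (Real.cos (x / √n) - 1) - -x^2/2 = n * (Real.cos (x/√n) - (1 - x^2/n/2)) by field_simp; ring,
    abs_mul, abs_of_pos hn']
  calc _ ≤ (n:ℝ) * (x^4/n^2 * (5/96)) := by gcongr
    _ = _ := by field_simp

lemma cos_pow_lim (x : ℝ) : Tendsto (fun n : ℕ => Real.cos (x / √n) ^ n) atTop (nhds (Real.exp (-x^2/2))) := by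
  refine (Real.tendsto_one_add_pow_exp_of_tendsto (cos_scaled_lim x)).congr (fun n => ?_)
  simp

lemma integrand_lim (t : ℝ) : Tendsto (fun g : ℕ => Real.cos (3 * (t / √g)) ^ g * Real.cos (t / √g) ^ (3*g-4)) atTop
    (nhds (Real.exp (-6 * t^2))) := by
  have h1 := cos_pow_lim (3 * t)
  have h2 := (cos_pow_lim t).pow 3
  have h0 : Tendsto (fun g : ℕ => Real.cos (t / √g)) atTop (nhds 1) := by
    have : Tendsto (fun g : ℕ => t / √g) atTop (nhds 0) :=
      Tendsto.const_div_atTop (Real.tendsto_sqrt_atTop.comp tendsto_natCast_atTop_atTop) t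
    have h := (Real.continuous_cos.tendsto 0).comp this
    rw [Real.cos_zero] at h
    exact h
  have h3 := (h1.mul h2).div (h0.pow 4) (by norm_num)
  have e : Real.exp (-(3*t)^2/2) * Real.exp (-t^2/2)^3 / 1^4 = Real.exp (-6 * t^2) := by
    rw [← Real.exp_nat_mul, ← Real.exp_add]
    simp
    ring
  rw [e] at h3
  refine h3.congr' ?_
  filter_upwards [eventually_ge_atTop 2, h0.eventually_ne (by norm_num : (1:ℝ) ≠ 0)] with g hg hne
  simp only [Pi.div_apply]
  rw [mul_div_assoc 3 t, mul_div_assoc]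
  congr 1
  rw [div_eq_iff (by positivity), ← pow_mul, ← pow_add]
  congr 1
  omega

open MeasureTheory in
lemma integral_lim : Tendsto (fun g : ℕ => √g * ∫ u in (-(Real.pi/2))..(Real.pi/2), Real.cos (3*u) ^ g * Real.cos u ^ (3*g-4))
    atTop (nhds (√(Real.pi / 6))) := by
  rw [← integral_gaussian 6]
  have hpi := Real.pi_pos
  have hd : Tendsto (fun g : ℕ => ∫ t : ℝ, Set.indicator (Set.Ioc (-(Real.pi/2) * √g) (Real.pi/2 * √g))
      (fun t => Real.cos (3 * (t / √g)) ^ (g) * Real.cos (t / √g) ^ (3*g-4)) t) atTop (nhds (∫ t : ℝ, Real.exp (-6 * t^2))) := by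
    rw [← tendsto_add_atTop_iff_nat 2]
    refine tendsto_integral_of_dominated_convergence
      (fun t => Real.exp (-(2/Real.pi^2) * t^2)) (fun g => ?_) ?_ (fun g => ?_) ?_
    · apply Measurable.aestronglyMeasurable
      apply Measurable.indicator _ measurableSet_Ioc
      fun_prop
    · exact integrable_exp_neg_mul_sq (by positivity)
    · refine Eventually.of_forall fun t => ?_
      by_cases ht : t ∈ Set.Ioc (-(Real.pi/2) * √((g+2 : ℕ) : ℝ)) (Real.pi/2 * √((g+2 : ℕ) : ℝ))
      · rw [Set.indicator_of_mem ht]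
        have hg : (0:ℝ) < ((g+2 : ℕ) : ℝ) := by positivity
        have hs : 0 < √((g+2 : ℕ) : ℝ) := by positivity
        have hu1 : -(Real.pi/2) ≤ t / √((g+2 : ℕ) : ℝ) := by
          rw [le_div_iff₀ hs]; exact ht.1.le
        have hu2 : t / √((g+2 : ℕ) : ℝ) ≤ Real.pi/2 := by
          rw [div_le_iff₀ hs]; exact ht.2
        have hsq : (t / √((g+2 : ℕ) : ℝ))^2 * ((g+2 : ℕ) : ℝ) = t^2 := by
          rw [div_pow, Real.sq_sqrt hg.le]; field_simp
        generalize t / √((g+2 : ℕ) : ℝ) = u at *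
        have hc0 : 0 ≤ Real.cos u := Real.cos_nonneg_of_neg_pi_div_two_le_of_le hu1 hu2
        have hc1 : Real.cos u ≤ Real.exp (-(2/Real.pi^2) * u^2) := by
          have h1 := Real.cos_le_one_sub_mul_cos_sq (x := u) (abs_le.2 ⟨by linarith, by linarith⟩)
          have h2 := Real.add_one_le_exp (-(2/Real.pi^2) * u^2)
          linarith
        rw [norm_mul, norm_pow, norm_pow, Real.norm_eq_abs, Real.norm_eq_abs, abs_of_nonneg hc0]
        calc |Real.cos (3*u)|^(g+2) * Real.cos u ^ (3*(g+2)-4)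
            ≤ 1 * Real.cos u ^ (g+2) := by
              apply mul_le_mul _ _ (by positivity) (by norm_num)
              · exact pow_le_one₀ (abs_nonneg _) (Real.abs_cos_le_one _)
              · exact pow_le_pow_of_le_one hc0 (Real.cos_le_one _) (by omega)
          _ ≤ (Real.exp (-(2/Real.pi^2) * u^2))^(g+2) := by
              rw [one_mul]; gcongr
          _ = Real.exp (-(2/Real.pi^2) * t^2) := by
              rw [← Real.exp_nat_mul, ← hsq]; congr 1; ring
      · rw [Set.indicator_of_notMem ht]
        simp only [norm_zero]
        positivity
    · refine Eventually.of_forall fun t => ?_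
      refine (((tendsto_add_atTop_iff_nat 2).2 (integrand_lim t))).congr' ?_
      have hbig : Tendsto (fun g : ℕ => Real.pi/2 * √((g+2 : ℕ) : ℝ)) atTop atTop := by
        apply Tendsto.const_mul_atTop (by positivity)
        exact (tendsto_add_atTop_iff_nat 2).2 (Real.tendsto_sqrt_atTop.comp tendsto_natCast_atTop_atTop)
      filter_upwards [hbig.eventually_gt_atTop |t|] with g hg
      rw [Set.indicator_of_mem]
      have := abs_lt.1 hg
      exact ⟨by linarith [this.1], this.2.le⟩
  refine hd.congr' ?_
  filter_upwards [eventually_gt_atTop 0] with g hg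
  have hs : 0 < √(g : ℝ) := by positivity
  rw [integral_indicator measurableSet_Ioc, ← intervalIntegral.integral_of_le (by nlinarith)]
  have := intervalIntegral.integral_comp_div (a := -(Real.pi/2) * √g) (b := Real.pi/2 * √g)
    (fun u => Real.cos (3*u) ^ g * Real.cos u ^ (3*g-4)) hs.ne'
  rw [this, mul_div_cancel_right₀ _ hs.ne', mul_div_cancel_right₀ _ hs.ne', smul_eq_mul]

lemma sum_lim : Tendsto (fun g : ℕ => (∑ i ∈ Finset.Icc 1 (g - 1),
      (Nat.choose g i : ℝ) * (Nat.choose (3 * g - 4) (3 * i - 2) : ℝ)) * √g / 2 ^ (4 * g - 4))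
    atTop (nhds (√(Real.pi / 6) / Real.pi)) := by
  refine (integral_lim.div_const Real.pi).congr' ?_
  filter_upwards [eventually_ge_atTop 2] with g hg
  obtain ⟨m, rfl⟩ := Nat.exists_eq_add_of_le' hg
  have h := sum_eq_integral m
  rw [show 3 * (m+2) - 4 = 3*m+2 by omega, show 4 * (m+2) - 4 = 4*m+4 by omega,
    show m + 2 - 1 = m+1 by omega]
  have hpi : Real.pi ≠ 0 := Real.pi_ne_zero
  rw [div_eq_div_iff hpi (by positivity)]
  linear_combination (-√((m+2 : ℕ) : ℝ)) * h

/-- `W(g)` is asymptotically equivalent to `(2/(3πg))·(1/4^g)·(8/3)^{4g−4}` as `g → ∞`,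
i.e. the ratio of the two quantities tends to `1`. -/
theorem Wsep_asymptotics :
    Filter.Tendsto
      (fun g : ℕ =>
        Wsep g / ((2 / (3 * Real.pi * g)) * (1 / (4 : ℝ) ^ g) * ((8 : ℝ) / 3) ^ (4 * g - 4)))
      atTop (nhds 1) := by
  have hpi := Real.pi_pos
  have h := ((zeta_lim.mul choose_lim).mul sum_lim).mul_const (3 * Real.pi * (256/81))
  have e : 1 * (√(2/3) / √Real.pi * (81/256)) * (√(Real.pi / 6) / Real.pi) *
      (3 * Real.pi * (256/81)) = 1 := by
    have h1 : √(Real.pi / 6) = √Real.pi / √6 := Real.sqrt_div hpi.le 6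
    have h2 : √(2/3 : ℝ) = 2 / √6 := by
      rw [show (2/3:ℝ) = 2^2/6 by norm_num, Real.sqrt_div (by positivity), Real.sqrt_sq (by norm_num)]
    have h3 : √(6:ℝ)^2 = 6 := Real.sq_sqrt (by norm_num)
    rw [h1, h2]
    field_simp
    rw [h3]
    norm_num
  rw [e] at h
  refine h.congr' ?_
  filter_upwards [eventually_ge_atTop 2] with g hg
  unfold Wsep
  have hg0 : (0:ℝ) < g := by positivity
  have hsq : √(g:ℝ) * √(g:ℝ) = g := Real.mul_self_sqrt hg0.le
  generalize zetaSum (6 * g - 6) = z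
  generalize (∑ i ∈ Finset.Icc 1 (g - 1),
      (Nat.choose g i : ℝ) * (Nat.choose (3 * g - 4) (3 * i - 2) : ℝ)) = S
  generalize (Nat.choose (4 * g - 4) g : ℝ) = c
  obtain ⟨m, rfl⟩ := Nat.exists_eq_add_of_le' hg
  rw [show 4 * (m+2) - 4 = 4*(m+1) by omega, zpow_neg, zpow_natCast, pow_mul, pow_mul]
  have p1 : (12:ℝ)^(m+2) = 4^(m+2) * 3^(m+2) := by rw [← mul_pow]; norm_num
  have p2 : ((8/3 : ℝ)^4)^(m+1) = 16^(m+1) * 16^(m+1) * 16^(m+1) / (27^(m+1) * 3^(m+1)) := by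
    rw [← mul_pow, ← mul_pow, ← mul_pow, ← div_pow]; norm_num
  have p3 : (27/256 : ℝ)^(m+2) = 27^(m+2) / (16^(m+2) * 16^(m+2)) := by
    rw [← mul_pow, ← div_pow]; norm_num
  rw [p1, p2, p3, show (2:ℝ)^4 = 16 by norm_num]
  have hm : √((m+2 : ℕ) : ℝ) ^ 2 = ((m+2 : ℕ) : ℝ) := by rw [pow_two, hsq]
  field_simp
  rw [hm]
  ring
end

section
/- Let p ≥ 1 and q ≥ 0 be integers, let a₁,…,a_p and r₁,…,r_q be positive integers, and let b₁,…,b_p, c₁,…,c_p, s₁,…,s_q, t₁,…,t_q be integers, satisfying A := (a₁+⋯+a_p) − (r₁+⋯+r_q) > 0. For a positive integer n let Σ(n) be the sum, over all integers k with 0 ≤ k ≤ n such that 0 ≤ aᵢk+cᵢ ≤ aᵢn+bᵢ for every i and 0 ≤ rⱼk+tⱼ ≤ rⱼn+sⱼ for every j, of the ratio ∏_{i=1}^{p} C(aᵢn+bᵢ, aᵢk+cᵢ) / ∏_{j=1}^{q} C(rⱼn+sⱼ, rⱼk+tⱼ). Then as n → ∞, Σ(n) is asymptotically equivalent to (πn/2)^{(q−p+1)/2}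 · 2^{An + (b₁+⋯+b_p) − (s₁+⋯+s_q)} · ((r₁⋯r_q)/(a₁⋯a_p))^{1/2} · A^{−1/2}, where for q = 0 the empty product r₁⋯r_q equals 1 and the empty sum s₁+⋯+s_q equals 0. -/
open Filter

/-- The sum `Σ(n)` of the ratios `∏ᵢ C(aᵢn+bᵢ, aᵢk+cᵢ) / ∏ⱼ C(rⱼn+sⱼ, rⱼk+tⱼ)` over all
`0 ≤ k ≤ n` for which all the binomial coefficients appearing in the numerator and the
denominator are well-defined (i.e. `0 ≤ aᵢk+cᵢ ≤ aᵢn+bᵢ` and `0 ≤ rⱼk+tⱼ ≤ rⱼn+sⱼ`). -/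
noncomputable def hypSum (p q : ℕ) (a : Fin p → ℕ) (b c : Fin p → ℤ)
    (r : Fin q → ℕ) (s t : Fin q → ℤ) (n : ℕ) : ℝ :=
  ∑ k ∈ Finset.range (n + 1),
    if (∀ i, 0 ≤ (a i : ℤ) * (k : ℤ) + c i ∧
          (a i : ℤ) * (k : ℤ) + c i ≤ (a i : ℤ) * (n : ℤ) + b i) ∧
       (∀ j, 0 ≤ (r j : ℤ) * (k : ℤ) + t j ∧
          (r j : ℤ) * (k : ℤ) + t j ≤ (r j : ℤ) * (n : ℤ) + s j) then
      (∏ i, (Nat.choose ((a i : ℤ) * (n : ℤ) + b i).toNat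
          ((a i : ℤ) * (k : ℤ) + c i).toNat : ℝ)) /
      (∏ j, (Nat.choose ((r j : ℤ) * (n : ℤ) + s j).toNat
          ((r j : ℤ) * (k : ℤ) + t j).toNat : ℝ))
    else 0


lemma hs_choose_step (m d : ℕ) (hd : d ≤ m) :
    (Nat.choose (2*m) (m+d+1) : ℝ) * ((m:ℝ)+d+1) = (Nat.choose (2*m) (m+d) : ℝ) * ((m:ℝ)-d) := by
  have h := Nat.choose_succ_right_eq (2*m) (m+d)
  have h2 : 2*m - (m+d) = m - d := by omega
  rw [h2] at h
  have h3 := congrArg (Nat.cast : ℕ → ℝ) h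
  push_cast [Nat.cast_sub hd] at h3
  linarith

lemma hs_choose_upper (m D : ℕ) (d : ℕ) (hd : d ≤ D) (hdm : d ≤ m) :
    (Nat.choose (2*m) (m+d) : ℝ) ≤ (Nat.choose (2*m) m : ℝ) * Real.exp (-((d:ℝ)^2/((m:ℝ)+D))) := by
  induction d with
  | zero => simp
  | succ d ih =>
    have ih := ih (by omega) (by omega)
    have hs := hs_choose_step m d (by omega)
    have hdD : (d:ℝ)+1 ≤ D := by exact_mod_cast hd
    have hdm' : (d:ℝ)+1 ≤ m := by exact_mod_cast hdm
    have hd0 : (0:ℝ) ≤ d := by positivity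
    have hpos : (0:ℝ) < (m:ℝ)+d+1 := by positivity
    have e1 : (Nat.choose (2*m) (m+(d+1)) : ℝ) = (Nat.choose (2*m) (m+d) : ℝ) * (((m:ℝ)-d)/((m:ℝ)+d+1)) := by
      rw [← add_assoc]; field_simp; linarith
    have e2 : ((m:ℝ)-d)/((m:ℝ)+d+1) ≤ Real.exp (-((2*d+1)/((m:ℝ)+D))) := by
      have h1 : ((m:ℝ)-d)/((m:ℝ)+d+1) = -((2*d+1)/((m:ℝ)+d+1)) + 1 := by field_simp; ring
      rw [h1]
      refine (Real.add_one_le_exp _).trans (Real.exp_le_exp.2 (neg_le_neg ?_))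
      apply div_le_div_of_nonneg_left <;> linarith
    rw [e1]
    calc _ ≤ ((Nat.choose (2*m) m : ℝ) * Real.exp (-((d:ℝ)^2/((m:ℝ)+D)))) * Real.exp (-((2*d+1)/((m:ℝ)+D))) := by
          apply mul_le_mul ih e2 (div_nonneg (by linarith) hpos.le) (by positivity)
      _ = _ := by
          rw [mul_assoc, ← Real.exp_add]; congr 2; push_cast; ring

lemma hs_choose_lower (m D : ℕ) (hD : D < m) (d : ℕ) (hd : d ≤ D) :
    (Nat.choose (2*m) m : ℝ) * Real.exp (-((d:ℝ)^2/((m:ℝ)-D))) ≤ (Nat.choose (2*m) (m+d) : ℝ) := by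
  induction d with
  | zero => simp
  | succ d ih =>
    have ih := ih (by omega)
    have hs := hs_choose_step m d (by omega)
    have hdD : (d:ℝ)+1 ≤ D := by exact_mod_cast hd
    have hDm : (D:ℝ) < m := by exact_mod_cast hD
    have hd0 : (0:ℝ) ≤ d := by positivity
    have hpos : (0:ℝ) < (m:ℝ)+d+1 := by positivity
    have hmd : (0:ℝ) < (m:ℝ)-d := by linarith
    have e1 : (Nat.choose (2*m) (m+(d+1)) : ℝ) = (Nat.choose (2*m) (m+d) : ℝ) * (((m:ℝ)-d)/((m:ℝ)+d+1)) := by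
      rw [← add_assoc]; field_simp; linarith
    have e2 : Real.exp (-((2*d+1)/((m:ℝ)-D))) ≤ ((m:ℝ)-d)/((m:ℝ)+d+1) := by
      rw [Real.exp_neg, ← inv_div ((m:ℝ)+d+1) ((m:ℝ)-d)]
      apply inv_anti₀ (by positivity)
      have h1 : ((m:ℝ)+d+1)/((m:ℝ)-d) = ((2*d+1)/((m:ℝ)-d)) + 1 := by field_simp; ring
      rw [h1]
      refine (Real.add_one_le_exp _).trans (Real.exp_le_exp.2 ?_)
      apply div_le_div_of_nonneg_left <;> linarith
    rw [e1]
    calc _ = ((Nat.choose (2*m) m : ℝ) * Real.exp (-((d:ℝ)^2/((m:ℝ)-D)))) * Real.exp (-((2*d+1)/((m:ℝ)-D))) := by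
          rw [mul_assoc, ← Real.exp_add]; congr 2; push_cast; ring
      _ ≤ _ := by
          apply mul_le_mul ih e2 (by positivity) (by positivity)

lemma hs_central_le (m : ℕ) : (Nat.choose (2*m) m : ℝ) * Real.sqrt (2*m+1) ≤ 4^m := by
  have key : (Nat.centralBinom m : ℝ)^2 * (2*m+1) ≤ 16^m := by
    induction m with
    | zero => simp
    | succ m ih =>
      have h := congrArg (Nat.cast : ℕ → ℝ) (Nat.succ_mul_centralBinom_succ m)
      push_cast at h
      have hp : (0:ℝ) < (m:ℝ)+1 := by positivity
      have h1 : (Nat.centralBinom (m+1) : ℝ) = 2*(2*m+1)*Nat.centralBinom m/((m:ℝ)+1) := by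
        field_simp; linarith
      rw [h1, div_pow, div_mul_eq_mul_div, div_le_iff₀ (by positivity)]
      push_cast
      have h2 : (2 * (2 * (m:ℝ) + 1) * Nat.centralBinom m) ^ 2 * (2 * (m + 1) + 1) 
          = 4 * ((2*m+1)*(2*m+3)) * ((Nat.centralBinom m : ℝ)^2 * (2*m+1)) := by ring
      rw [h2]
      have h3 : ((2*(m:ℝ)+1)*(2*m+3)) ≤ 4*(m+1)^2 := by nlinarith
      calc _ ≤ 4 * (4*((m:ℝ)+1)^2) * 16^m := by gcongr
        _ = _ := by ring
  rw [← Nat.centralBinom_eq_two_mul_choose]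
  apply (pow_le_pow_iff_left₀ (by positivity) (by positivity) two_ne_zero).1
  rw [mul_pow, Real.sq_sqrt (by positivity), ← pow_mul, mul_comm m 2, pow_mul]
  norm_num
  exact key

lemma hs_central_lim : Tendsto (fun m : ℕ => (Nat.choose (2*m) m : ℝ) * Real.sqrt m / 4^m) atTop
    (nhds (1/Real.sqrt Real.pi)) := by
  have hs := Stirling.tendsto_stirlingSeq_sqrt_pi
  have h2 : Tendsto (fun m : ℕ => 2*m) atTop atTop := tendsto_id.const_mul_atTop' (by norm_num)
  have hne : Real.sqrt Real.pi ≠ 0 := by positivity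
  have h := (hs.comp h2).div (hs.pow 2) (by positivity)
  have e : Real.sqrt Real.pi / Real.sqrt Real.pi ^ 2 = 1/Real.sqrt Real.pi := by field_simp
  rw [e] at h
  refine h.congr' ?_
  filter_upwards [eventually_gt_atTop 0] with m hm
  have hm' : (0:ℝ) < m := by exact_mod_cast hm
  simp only [Function.comp, Pi.div_apply, Stirling.stirlingSeq]
  have hc : (Nat.choose (2*m) m : ℝ) = (2*m).factorial / (m.factorial * m.factorial) := by
    rw [Nat.cast_choose ℝ (by omega : m ≤ 2*m)]
    congr 4; omega
  rw [hc]
  have e3 : Real.sqrt (2 * ((2*m : ℕ):ℝ)) = 2 * Real.sqrt m := by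
    push_cast
    rw [← mul_assoc, Real.sqrt_mul (by norm_num), show (2*2:ℝ) = 2^2 by norm_num, Real.sqrt_sq (by norm_num)]
  rw [e3]
  have e4 : (((2*m : ℕ):ℝ) / Real.exp 1)^(2*m) = 4^m * ((m/Real.exp 1)^m)^2 := by
    push_cast
    rw [mul_div_assoc, mul_pow, pow_mul, ← pow_mul _ m 2, mul_comm m 2]; norm_num
  rw [e4]
  have e5 : Real.sqrt (2*(m:ℝ))^2 = 2 * Real.sqrt m ^2 := by
    rw [Real.sq_sqrt (by positivity), Real.sq_sqrt (by positivity)]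
  have hx : (0:ℝ) < ((m/Real.exp 1)^m) := by positivity
  generalize ((m/Real.exp 1)^m) = X at hx
  have hsm : 0 < Real.sqrt m := by positivity
  have hf : (0:ℝ) < m.factorial := by positivity
  rw [div_pow, mul_pow, e5]
  field_simp

lemma hs_local_even (m K : ℕ → ℕ) (y : ℝ) (hm : Tendsto m atTop atTop)
    (hK : Tendsto (fun n => ((K n : ℝ) - m n)/Real.sqrt (m n)) atTop (nhds y)) :
    Tendsto (fun n => (Nat.choose (2*m n) (K n) : ℝ) * Real.sqrt (m n) / 4^(m n)) atTop
    (nhds (1/Real.sqrt Real.pi * Real.exp (-y^2))) := by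
  set d : ℕ → ℕ := fun n => Int.natAbs ((K n : ℤ) - m n) with hd
  have hdr : ∀ n, (d n : ℝ) = |(K n : ℝ) - m n| := by
    intro n; simp [hd, Nat.cast_natAbs]
  have hmr : Tendsto (fun n => (m n : ℝ)) atTop atTop := tendsto_natCast_atTop_atTop.comp hm
  have hsq : Tendsto (fun n => Real.sqrt (m n)) atTop atTop := Real.tendsto_sqrt_atTop.comp hmr
  have hmpos : ∀ᶠ n in atTop, 0 < m n := hm.eventually_gt_atTop 0
  have t1 : Tendsto (fun n => (d n : ℝ)/Real.sqrt (m n)) atTop (nhds |y|) := by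
    refine hK.abs.congr fun n => ?_
    rw [hdr, abs_div, abs_of_nonneg (Real.sqrt_nonneg _)]
  have t2 : Tendsto (fun n => (d n : ℝ)/m n) atTop (nhds 0) := by
    have := t1.mul hsq.inv_tendsto_atTop
    rw [mul_zero] at this
    refine this.congr fun n => ?_
    simp only [Pi.inv_apply]
    rw [div_mul_eq_mul_div, ← div_eq_mul_inv, div_div, Real.mul_self_sqrt (by positivity)]
  have t3 : Tendsto (fun n => ((d n : ℝ)/Real.sqrt (m n))^2) atTop (nhds (y^2)) := by
    simpa using t1.pow 2
  have hlt : ∀ᶠ n in atTop, d n < m n := by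
    filter_upwards [t2.eventually_lt_const (show (0:ℝ) < 1 by norm_num), hmpos] with n h1 h2
    rw [div_lt_one (by exact_mod_cast h2)] at h1
    exact_mod_cast h1
  have hsym : ∀ᶠ n in atTop, (Nat.choose (2*m n) (K n)) = Nat.choose (2*m n) (m n + d n) := by
    filter_upwards [hlt] with n h
    rcases le_total (m n) (K n) with h1 | h1
    · congr 1; simp only [hd]; omega
    · apply Nat.choose_symm_of_eq_add; simp only [hd] at h ⊢; omega
  have tu : Tendsto (fun n => (d n:ℝ)^2/((m n:ℝ)+d n)) atTop (nhds (y^2)) := by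
    have := t3.div (t2.const_add 1) (by norm_num)
    rw [add_zero, div_one] at this
    refine this.congr' ?_
    filter_upwards [hmpos] with n h
    have : (0:ℝ) < m n := by exact_mod_cast h
    simp only [Pi.div_apply]
    rw [div_pow, Real.sq_sqrt this.le]; field_simp
  have tl : Tendsto (fun n => (d n:ℝ)^2/((m n:ℝ)-d n)) atTop (nhds (y^2)) := by
    have := t3.div (t2.const_sub 1) (by norm_num)
    rw [sub_zero, div_one] at this
    refine this.congr' ?_
    filter_upwards [hmpos] with n h
    have : (0:ℝ) < m n := by exact_mod_cast h
    simp only [Pi.div_apply]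
    rw [div_pow, Real.sq_sqrt this.le]; field_simp
  have c := hs_central_lim.comp hm
  have U := c.mul ((Real.continuous_exp.tendsto _).comp tu.neg)
  have L := c.mul ((Real.continuous_exp.tendsto _).comp tl.neg)
  refine tendsto_of_tendsto_of_tendsto_of_le_of_le' L U ?_ ?_
  · filter_upwards [hlt, hsym] with n h1 h2
    rw [h2]
    have := hs_choose_lower (m n) (d n) h1 (d n) le_rfl
    simp only [Function.comp]
    rw [div_mul_eq_mul_div, mul_right_comm]
    gcongr
  · filter_upwards [hlt, hsym] with n h1 h2
    rw [h2]
    have := hs_choose_upper (m n) (d n) (d n) le_rfl h1.le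
    simp only [Function.comp]
    rw [div_mul_eq_mul_div, mul_right_comm]
    gcongr


lemma hs_local (N K : ℕ → ℕ) (y : ℝ) (hN : Tendsto N atTop atTop)
    (hK : Tendsto (fun n => ((K n : ℝ) - (N n : ℝ)/2)/Real.sqrt (N n)) atTop (nhds y)) :
    Tendsto (fun n => (Nat.choose (N n) (K n) : ℝ) * Real.sqrt (N n) / 2^(N n)) atTop
    (nhds (Real.sqrt (2/Real.pi) * Real.exp (-2*y^2))) := by
  set m : ℕ → ℕ := fun n => (N n + 1)/2 with hmdef
  have hm : Tendsto m atTop atTop := by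
    rw [tendsto_atTop] at hN ⊢
    intro b
    filter_upwards [hN (2*b)] with n h
    simp only [hmdef]; omega
  have hNr : Tendsto (fun n => (N n : ℝ)) atTop atTop := tendsto_natCast_atTop_atTop.comp hN
  have hmr : Tendsto (fun n => (m n : ℝ)) atTop atTop := tendsto_natCast_atTop_atTop.comp hm
  have hmpos : ∀ᶠ n in atTop, 0 < m n := hm.eventually_gt_atTop 0
  have hNpos : ∀ᶠ n in atTop, 0 < N n := hN.eventually_gt_atTop 0
  have hcase : ∀ n, N n = 2 * m n ∨ N n + 1 = 2 * m n := by
    intro n; simp only [hmdef]; omega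
  have hdiff : ∀ n, 0 ≤ (m n : ℝ) - (N n : ℝ)/2 ∧ (m n : ℝ) - (N n : ℝ)/2 ≤ 1/2 := by
    intro n
    rcases hcase n with h | h
    · have : (N n : ℝ) = 2 * m n := by exact_mod_cast h
      constructor <;> linarith
    · have : (N n : ℝ) + 1 = 2 * m n := by exact_mod_cast h
      constructor <;> linarith
  have hsm : Tendsto (fun n => Real.sqrt (m n)) atTop atTop := Real.tendsto_sqrt_atTop.comp hmr
  have hsN : Tendsto (fun n => Real.sqrt (N n)) atTop atTop := Real.tendsto_sqrt_atTop.comp hNr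
  have hratio : Tendsto (fun n => (N n : ℝ)/m n) atTop (nhds 2) := by
    have h0 : Tendsto (fun n => ((m n : ℝ) - (N n : ℝ)/2)/(m n)) atTop (nhds 0) := by
      have hh : Tendsto (fun n => (1/2:ℝ)/(m n)) atTop (nhds 0) := hmr.const_div_atTop _
      refine squeeze_zero (fun n => div_nonneg (hdiff n).1 (by positivity)) (fun n => ?_) hh
      have := (hdiff n).2
      gcongr
    have h1 := (h0.const_mul 2).const_sub 2
    rw [mul_zero, sub_zero] at h1
    refine h1.congr' ?_
    filter_upwards [hmpos] with n h
    have : (0:ℝ) < m n := by exact_mod_cast h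
    field_simp; ring
  have hsr : Tendsto (fun n => Real.sqrt (N n)/Real.sqrt (m n)) atTop (nhds (Real.sqrt 2)) := by
    refine ((Real.continuous_sqrt.tendsto _).comp hratio).congr fun n => ?_
    simp [Real.sqrt_div]
  have hK' : Tendsto (fun n => ((K n : ℝ) - m n)/Real.sqrt (m n)) atTop (nhds (y * Real.sqrt 2)) := by
    have h0 : Tendsto (fun n => ((m n : ℝ) - (N n : ℝ)/2)/Real.sqrt (m n)) atTop (nhds 0) := by
      have hh : Tendsto (fun n => (1/2:ℝ)/Real.sqrt (m n)) atTop (nhds 0) := hsm.const_div_atTop _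
      refine squeeze_zero (fun n => div_nonneg (hdiff n).1 (by positivity)) (fun n => ?_) hh
      have := (hdiff n).2
      gcongr
    have h1 := (hK.mul hsr).sub h0
    rw [sub_zero] at h1
    refine h1.congr' ?_
    filter_upwards [hmpos, hNpos] with n h h'
    have : (0:ℝ) < Real.sqrt (m n) := by positivity
    have : (0:ℝ) < Real.sqrt (N n) := by positivity
    field_simp; ring
  have hE := hs_local_even m K _ hm hK'
  have hKN : Tendsto (fun n => 2*(((N n:ℝ)+1-K n)/((N n:ℝ)+1))) atTop (nhds 1) := by
    have h1 : Tendsto (fun n => ((K n : ℝ) - (N n : ℝ)/2)/(N n : ℝ)) atTop (nhds 0) := by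
      have := hK.mul hsN.inv_tendsto_atTop
      rw [mul_zero] at this
      refine this.congr fun n => ?_
      simp only [Pi.inv_apply]
      rw [div_mul_eq_mul_div, ← div_eq_mul_inv, div_div, Real.mul_self_sqrt (by positivity)]
    have h2 : Tendsto (fun n => 1/(N n:ℝ)) atTop (nhds 0) := hNr.const_div_atTop _
    have h3 := (((h1.const_sub (1/2)).add h2).div (h2.const_add 1) (by norm_num)).const_mul 2
    norm_num at h3
    refine h3.congr' ?_
    filter_upwards [hNpos] with n h
    have : (0:ℝ) < N n := by exact_mod_cast h
    field_simp; ring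
  have hth : Tendsto (fun n => if N n = 2 * m n then (1:ℝ) else 2*(((N n:ℝ)+1-K n)/((N n:ℝ)+1)))
      atTop (nhds 1) := tendsto_const_nhds.if' hKN
  have hKle : ∀ᶠ n in atTop, 0 < 2*(((N n:ℝ)+1-K n)/((N n:ℝ)+1)) := hKN.eventually_const_lt (by norm_num)
  have hF := (hE.mul hth).mul hsr
  have elim : 1/Real.sqrt Real.pi * Real.exp (-(y*Real.sqrt 2)^2) * 1 * Real.sqrt 2
      = Real.sqrt (2/Real.pi) * Real.exp (-2*y^2) := by
    rw [mul_pow, Real.sq_sqrt (by norm_num), Real.sqrt_div (by norm_num),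
      show -(y^2*2) = -2*y^2 by ring]
    ring
  rw [elim] at hF
  refine hF.congr' ?_
  filter_upwards [hmpos, hNpos, hKle] with n h h' h''
  have p1 : (0:ℝ) < Real.sqrt (m n) := by positivity
  have p2 : (0:ℝ) < Real.sqrt (N n) := by positivity
  by_cases hc : N n = 2 * m n
  · rw [if_pos hc]
    have e : (2:ℝ)^(N n) = 4^(m n) := by rw [hc, pow_mul]; norm_num
    rw [e, ← hc]; field_simp
  · rw [if_neg hc]
    have hc' : N n + 1 = 2 * m n := by rcases hcase n with h | h <;> omega
    have e : (4:ℝ)^(m n) = 2^(N n) * 2 := by rw [← pow_succ, hc', pow_mul]; norm_num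
    have hkn : K n < N n + 1 := by
      have : (0:ℝ) < (N n:ℝ)+1 := by positivity
      have h3 : 0 < (N n:ℝ)+1-K n := by
        by_contra hcon
        have : 2*(((N n:ℝ)+1-K n)/((N n:ℝ)+1)) ≤ 0 := by
          have := div_nonpos_of_nonpos_of_nonneg (not_lt.1 hcon) this.le
          linarith
        linarith
      have : (K n:ℝ) < ((N n + 1 : ℕ):ℝ) := by push_cast; linarith
      exact_mod_cast this
    have hch := congrArg (Nat.cast : ℕ → ℝ) (Nat.choose_mul_succ_eq (N n) (K n))
    push_cast [Nat.cast_sub hkn.le] at hch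
    rw [← hc', e]
    have : (0:ℝ) < (N n:ℝ)+1 := by positivity
    have h5 : (Nat.choose (N n) (K n) : ℝ) = (Nat.choose (N n + 1) (K n) : ℝ) * ((N n:ℝ)+1-K n)/((N n:ℝ)+1) := by
      field_simp; linarith
    rw [h5]; field_simp

lemma hs_riemann (h : ℕ → ℕ → ℝ) (g : ℝ → ℝ) (C : ℝ)
    (h0 : ∀ n k, k ≤ n → 0 ≤ h n k)
    (hb : ∀ n k, 0 < n → k ≤ n → h n k ≤ C / (1 + (((k:ℝ) - (n:ℝ)/2)/Real.sqrt n)^2))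
    (hlim : ∀ (x : ℝ) (k : ℕ → ℕ), Tendsto (fun n => ((k n : ℝ) - (n:ℝ)/2)/Real.sqrt n) atTop (nhds x) →
      Tendsto (fun n => h n (k n)) atTop (nhds (g x))) :
    Tendsto (fun n : ℕ => (∑ k ∈ Finset.range (n+1), h n k) / Real.sqrt n) atTop (nhds (∫ x, g x)) := by
  set I : ℕ → ℕ → Set ℝ := fun n k => Set.Ico (((k:ℝ) - (n:ℝ)/2)/Real.sqrt n) (((k:ℝ) + 1 - (n:ℝ)/2)/Real.sqrt n) with hI
  set G : ℕ → ℝ → ℝ := fun n x => ∑ k ∈ Finset.range (n+1), (I n k).indicator (fun _ => h n k) x with hG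
  have hmem : ∀ n k x, 0 < n → (x ∈ I n k ↔ (k:ℝ) ≤ x * Real.sqrt n + (n:ℝ)/2 ∧ x * Real.sqrt n + (n:ℝ)/2 < k+1) := by
    intro n k x hn
    have : 0 < Real.sqrt n := by positivity
    simp only [hI, Set.mem_Ico, div_le_iff₀ this, lt_div_iff₀ this]
    constructor <;> rintro ⟨a, b⟩ <;> constructor <;> linarith
  have hval : ∀ n k x, 0 < n → k ≤ n → x ∈ I n k → G n x = h n k := by
    intro n k x hn hk hx
    simp only [hG]
    rw [Finset.sum_eq_single k]
    · simp [hx]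
    · intro j _ hj
      apply Set.indicator_of_notMem
      intro hxj
      apply hj
      rw [hmem n _ x hn] at hx hxj
      have a1 : (j:ℝ) < k + 1 := by linarith
      have a2 : (k:ℝ) < j + 1 := by linarith
      have a1 : j < k + 1 := by exact_mod_cast a1
      have a2 : k < j + 1 := by exact_mod_cast a2
      omega
    · intro hk'; simp at hk'; omega
  have hintg : ∀ n : ℕ, 0 < n → ∫ x, G n x = (∑ k ∈ Finset.range (n+1), h n k) / Real.sqrt n := by
    intro n hn
    have hs : 0 < Real.sqrt n := by positivity
    simp only [hG]
    rw [MeasureTheory.integral_finsetSum]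
    · rw [Finset.sum_div]
      refine Finset.sum_congr rfl fun k _ => ?_
      rw [MeasureTheory.integral_indicator measurableSet_Ico]
      simp only [MeasureTheory.integral_const, smul_eq_mul]
      rw [MeasureTheory.measureReal_restrict_apply_univ, Real.volume_real_Ico_of_le (by gcongr; linarith)]
      field_simp; ring
    · intro k _
      refine MeasureTheory.IntegrableOn.integrable_indicator ?_ measurableSet_Ico
      exact MeasureTheory.integrableOn_const (by simp [hI])
  have hC : 0 ≤ C := by
    have a := (h0 1 0 (by norm_num)).trans (hb 1 0 (by norm_num) (by norm_num))
    by_contra hc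
    have := div_neg_of_neg_of_pos (not_le.1 hc) (show 0 < 1 + ((((0:ℕ):ℝ) - ((1:ℕ):ℝ)/2)/Real.sqrt (1:ℕ))^2 by positivity)
    linarith
  have key : Tendsto (fun n => ∫ x, G n x) atTop (nhds (∫ x, g x)) := by
    refine MeasureTheory.tendsto_integral_filter_of_dominated_convergence (fun x => (3*C) * (1+x^2)⁻¹) ?_ ?_ ?_ ?_
    · filter_upwards with n
      apply Measurable.aestronglyMeasurable
      simp only [hG]
      refine Finset.measurable_sum _ fun k _ => ?_
      exact measurable_const.indicator measurableSet_Ico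
    · filter_upwards [eventually_gt_atTop 0] with n hn
      refine Eventually.of_forall fun x => ?_
      by_cases hx : ∃ k, k ≤ n ∧ x ∈ I n k
      · obtain ⟨k, hk, hx⟩ := hx
        rw [hval n k x hn hk hx, Real.norm_of_nonneg (h0 n k hk)]
        refine (hb n k hn hk).trans ?_
        have hs : 1 ≤ Real.sqrt n := by
          rw [Real.one_le_sqrt]; exact_mod_cast hn
        have hx' := hx
        simp only [hI, Set.mem_Ico] at hx'
        set ξ := ((k:ℝ) - (n:ℝ)/2)/Real.sqrt n
        have e : ((k:ℝ) + 1 - (n:ℝ)/2)/Real.sqrt n = ξ + 1/Real.sqrt n := by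
          simp only [ξ]; ring
        have e2 : 1/Real.sqrt n ≤ 1 := by rw [div_le_one (by linarith)]; exact hs
        rw [e] at hx'
        obtain ⟨a1, a2⟩ := hx'
        rw [← div_eq_mul_inv, div_le_div_iff₀ (by positivity) (by positivity)]
        have : 1 + x^2 ≤ 3 * (1+ξ^2) := by nlinarith [sq_nonneg (ξ - (x-ξ)), sq_nonneg ξ]
        nlinarith
      · have : G n x = 0 := by
          simp only [hG]
          refine Finset.sum_eq_zero fun k hk => ?_
          apply Set.indicator_of_notMem
          intro hxx
          exact hx ⟨k, by simp at hk; omega, hxx⟩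
        rw [this, norm_zero]; positivity
    · exact integrable_inv_one_add_sq.const_mul _
    · refine Eventually.of_forall fun x => ?_
      have hsq : Tendsto (fun n : ℕ => Real.sqrt n) atTop atTop :=
        Real.tendsto_sqrt_atTop.comp tendsto_natCast_atTop_atTop
      have hev : ∀ᶠ n : ℕ in atTop, 2 * |x| + 1 ≤ Real.sqrt n := hsq.eventually_ge_atTop _
      set k : ℕ → ℕ := fun n => ⌊x * Real.sqrt n + (n:ℝ)/2⌋₊ with hk
      have hpos : ∀ᶠ n : ℕ in atTop, 0 ≤ x * Real.sqrt n + (n:ℝ)/2 ∧ x * Real.sqrt n + (n:ℝ)/2 ≤ n := by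
        filter_upwards [hev] with n hn
        have e : Real.sqrt n * Real.sqrt n = n := Real.mul_self_sqrt (by positivity)
        have := neg_abs_le x
        have := le_abs_self x
        have := abs_nonneg x
        constructor <;> nlinarith
      have hin : ∀ᶠ n : ℕ in atTop, x ∈ I n (k n) ∧ k n ≤ n := by
        filter_upwards [hpos, eventually_gt_atTop 0] with n hn h1
        refine ⟨(hmem n (k n) x h1).2 ⟨Nat.floor_le hn.1, Nat.lt_floor_add_one _⟩, ?_⟩
        exact Nat.floor_le_of_le hn.2
      have hl : Tendsto (fun n => ((k n : ℝ) - (n:ℝ)/2)/Real.sqrt n) atTop (nhds x) := by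
        have i0 : Tendsto (fun n : ℕ => x - 1/Real.sqrt n) atTop (nhds x) := by
          simpa using (hsq.const_div_atTop 1).const_sub x
        refine tendsto_of_tendsto_of_tendsto_of_le_of_le' i0 tendsto_const_nhds ?_ ?_
        · filter_upwards [hin] with n hn
          have := hn.1.2
          have e : ((k n:ℝ) + 1 - (n:ℝ)/2)/Real.sqrt n = ((k n:ℝ) - (n:ℝ)/2)/Real.sqrt n + 1/Real.sqrt n := by
            ring
          linarith
        · filter_upwards [hin] with n hn
          exact hn.1.1
      refine (hlim x k hl).congr' ?_
      filter_upwards [hin, eventually_gt_atTop 0] with n hn h1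
      exact (hval n (k n) x h1 hn.2 hn.1).symm
  refine key.congr' ?_
  filter_upwards [eventually_gt_atTop 0] with n hn
  exact hintg n hn


/-- Two positive reals that agree up to the factor `K`. -/
def hsC (K x y : ℝ) : Prop := 0 < x ∧ 0 < y ∧ x ≤ K * y ∧ y ≤ K * x

lemma hsC.Kpos {K x y : ℝ} (h : hsC K x y) : 0 < K := by
  obtain ⟨a, b, c, d⟩ := h
  exact pos_of_mul_pos_left (a.trans_le c) b.le

lemma hsC.symm {K x y : ℝ} (h : hsC K x y) : hsC K y x := ⟨h.2.1, h.1, h.2.2.2, h.2.2.1⟩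

lemma hsC.mul {K x y L z w : ℝ} (h : hsC K x y) (h' : hsC L z w) : hsC (K*L) (x*z) (y*w) := by
  have hK := h.Kpos
  have hL := h'.Kpos
  obtain ⟨a, b, c, d⟩ := h
  obtain ⟨a', b', c', d'⟩ := h'
  refine ⟨by positivity, by positivity, ?_, ?_⟩
  · calc x*z ≤ (K*y)*(L*w) := by gcongr
      _ = _ := by ring
  · calc y*w ≤ (K*x)*(L*z) := by gcongr
      _ = _ := by ring

lemma hsC.inv {K x y : ℝ} (h : hsC K x y) : hsC K x⁻¹ y⁻¹ := by
  have hK := h.Kpos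
  obtain ⟨a, b, c, d⟩ := h
  refine ⟨by positivity, by positivity, ?_, ?_⟩
  · rw [← div_eq_mul_inv, inv_eq_one_div, div_le_div_iff₀ a b]; linarith
  · rw [← div_eq_mul_inv, inv_eq_one_div, div_le_div_iff₀ b a]; linarith

lemma hsC.div {K x y L z w : ℝ} (h : hsC K x y) (h' : hsC L z w) : hsC (K*L) (x/z) (y/w) := by
  rw [div_eq_mul_inv, div_eq_mul_inv]; exact h.mul h'.inv

lemma hsC.pow {K x y : ℝ} (h : hsC K x y) (n : ℕ) : hsC (K^n) (x^n) (y^n) := by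
  have hK := h.Kpos
  obtain ⟨a, b, c, d⟩ := h
  refine ⟨by positivity, by positivity, ?_, ?_⟩
  · rw [← mul_pow]; gcongr
  · rw [← mul_pow]; gcongr

lemma hsC.trans {K x y L z : ℝ} (h : hsC K x y) (h' : hsC L y z) : hsC (K*L) x z := by
  have hK := h.Kpos
  have hL := h'.Kpos
  obtain ⟨a, b, c, d⟩ := h
  obtain ⟨a', b', c', d'⟩ := h'
  refine ⟨a, b', ?_, ?_⟩
  · calc x ≤ K * y := c
      _ ≤ K * (L * z) := by gcongr
      _ = _ := by ring
  · calc z ≤ L * y := d'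
      _ ≤ L * (K * x) := by gcongr
      _ = _ := by ring

lemma hsC.refl {x : ℝ} (h : 0 < x) : hsC 1 x x := ⟨h, h, by simp, by simp⟩

lemma hs_pow_self_pos (m : ℕ) : (0:ℝ) < ((m:ℝ)/Real.exp 1)^m := by
  rcases Nat.eq_zero_or_pos m with rfl | h
  · simp
  · positivity

lemma hs_stir : ∃ K : ℝ, ∀ m : ℕ, hsC K (m.factorial : ℝ) (Real.sqrt (m+1) * ((m:ℝ)/Real.exp 1)^m) := by
  set S := Stirling.stirlingSeq 1 with hS
  refine ⟨S * 2 + 1, fun m => ?_⟩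
  have hS0 : 0 < S := Stirling.stirlingSeq'_pos 0
  have hX := hs_pow_self_pos m
  refine ⟨by positivity, by positivity, ?_⟩
  rcases Nat.eq_zero_or_pos m with rfl | hm
  · simp; linarith
  have hm' : (1:ℝ) ≤ m := by exact_mod_cast hm
  have hlow : 1 ≤ Stirling.stirlingSeq m := by
    refine le_trans ?_ (Stirling.sqrt_pi_le_stirlingSeq hm.ne')
    rw [Real.one_le_sqrt]
    linarith [Real.pi_gt_three]
  have hup : Stirling.stirlingSeq m ≤ S := by
    have := Stirling.stirlingSeq'_antitone (Nat.zero_le (m-1))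
    simp only [Function.comp, Nat.succ_eq_add_one] at this
    rwa [Nat.sub_add_cancel hm] at this
  generalize hXX : ((m:ℝ)/Real.exp 1)^m = X at hX
  have hf : (m.factorial : ℝ) = Stirling.stirlingSeq m * (Real.sqrt (2*m) * X) := by
    rw [Stirling.stirlingSeq, hXX]
    field_simp
  have s1 : Real.sqrt (m+1) ≤ Real.sqrt (2*m) := Real.sqrt_le_sqrt (by linarith)
  have s2 : Real.sqrt (2*m) ≤ 2 * Real.sqrt (m+1) := by
    rw [Real.sqrt_le_left (by positivity), mul_pow, Real.sq_sqrt (by positivity)]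
    linarith
  have s3 : 0 < Real.sqrt (m+1) := by positivity
  rw [hf]
  generalize Stirling.stirlingSeq m = T at *
  constructor
  · calc T * (Real.sqrt (2*m) * X) ≤ S * ((2 * Real.sqrt (m+1)) * X) := by gcongr
      _ = S * 2 * (Real.sqrt (m+1) * X) := by ring
      _ ≤ _ := by gcongr; linarith
  · calc Real.sqrt (m+1) * X ≤ 1 * (1 * (Real.sqrt (2*m) * X)) := by
          rw [one_mul, one_mul]; gcongr
      _ ≤ _ := by gcongr; linarith

lemma hs_fact_mul (a : ℕ) (ha : 0 < a) : ∃ K : ℝ, ∀ k : ℕ,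
    hsC K ((a*k).factorial : ℝ) (Real.sqrt (k+1) ^ (1 - (a:ℤ)) * ((a:ℝ)^(a*k) * (k.factorial:ℝ)^a)) := by
  obtain ⟨K, hK⟩ := hs_stir
  refine ⟨K * (a * K^a), fun k => ?_⟩
  have ha' : (1:ℝ) ≤ a := by exact_mod_cast ha
  have hs : 0 < Real.sqrt ((k:ℝ)+1) := by positivity
  have h1 := hK (a*k)
  have h2 := (hK k).pow a
  refine h1.trans ?_
  have h3 : hsC (a:ℝ) (Real.sqrt ((a*k:ℕ)+1)) (Real.sqrt (k+1)) := by
    have hk : (0:ℝ) ≤ k := by positivity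
    refine ⟨by positivity, by positivity, ?_, ?_⟩
    · rw [Real.sqrt_le_left (by positivity), mul_pow, Real.sq_sqrt (by positivity)]
      push_cast
      nlinarith [mul_nonneg hk (mul_nonneg (sub_nonneg.2 ha') (by linarith : (0:ℝ) ≤ a))]
    · rw [Real.sqrt_le_left (by positivity), mul_pow, Real.sq_sqrt (by positivity)]
      push_cast
      nlinarith [mul_nonneg hk (mul_nonneg (sub_nonneg.2 ha') (by linarith : (0:ℝ) ≤ a)),
        mul_nonneg hk (sub_nonneg.2 ha'), 
        mul_nonneg (mul_nonneg hk (mul_nonneg (sub_nonneg.2 ha') (by linarith : (0:ℝ) ≤ a))) (by linarith : (0:ℝ) ≤ a)]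
  have hX := hs_pow_self_pos k
  have e1 : (((a*k:ℕ):ℝ)/Real.exp 1)^(a*k) = (a:ℝ)^(a*k) * (((k:ℝ)/Real.exp 1)^k)^a := by
    push_cast
    rw [mul_div_assoc, mul_pow, ← pow_mul ((k:ℝ)/Real.exp 1) k a, mul_comm k a]
  rw [e1]
  rw [mul_pow] at h2
  have hp : (0:ℝ) < (a:ℝ)^(a*k) := by positivity
  generalize ((k:ℝ)/Real.exp 1)^k = X at *
  have h4 := (h3.mul (h2.symm.mul (hsC.refl (div_pos hp (pow_pos hs a)))))
  rw [mul_one] at h4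
  convert h4 using 1
  · field_simp
  · rw [zpow_sub₀ hs.ne', zpow_one, zpow_natCast]; field_simp

lemma hs_fact_shift (a : ℕ) (ha : 0 < a) (c : ℤ) : ∃ K : ℝ, ∀ k m : ℕ, (m:ℤ) = a * k + c →
    hsC K (m.factorial : ℝ) (((k:ℝ)+1)^c * ((a*k).factorial : ℝ)) := by
  have ha' : (1:ℝ) ≤ a := by exact_mod_cast ha
  obtain ⟨e, rfl | rfl⟩ := c.eq_nat_or_neg
  · refine ⟨((a:ℝ)+e)^e, fun k m hm => ?_⟩
    have hm : m = a*k+e := by exact_mod_cast hm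
    have hlo := @Nat.factorial_mul_pow_le_factorial (a*k) e
    have hup : (a*k+e).factorial ≤ (a*k).factorial * (a*k+e)^e := by
      rw [← Nat.factorial_mul_ascFactorial]
      exact Nat.mul_le_mul_left _ (Nat.ascFactorial_le_pow_add _ _)
    have hlo' : ((a*k).factorial : ℝ) * ((a:ℝ)*k+1)^e ≤ ((a*k+e).factorial : ℝ) := by exact_mod_cast hlo
    have hup' : ((a*k+e).factorial : ℝ) ≤ ((a*k).factorial : ℝ) * ((a:ℝ)*k+e)^e := by exact_mod_cast hup
    rw [hm, zpow_natCast]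
    refine ⟨by positivity, by positivity, ?_, ?_⟩
    · refine hup'.trans ?_
      calc _ ≤ ((a*k).factorial : ℝ) * (((a:ℝ)+e)*(k+1))^e := by
            gcongr
            nlinarith [mul_nonneg (Nat.cast_nonneg (α := ℝ) e) (Nat.cast_nonneg (α := ℝ) k)]
        _ = _ := by rw [mul_pow]; ring
    · have h1 : (1:ℝ) ≤ ((a:ℝ)+e)^e := one_le_pow₀ (by have := Nat.cast_nonneg (α := ℝ) e; linarith)
      calc ((k:ℝ)+1)^e * ((a*k).factorial : ℝ) ≤ ((a:ℝ)*k+1)^e * ((a*k).factorial : ℝ) := by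
            gcongr; nlinarith [Nat.cast_nonneg (α := ℝ) k]
        _ ≤ 1 * ((a*k+e).factorial : ℝ) := by linarith
        _ ≤ _ := by gcongr
  · refine ⟨((a:ℝ)+e)^e, fun k m hm => ?_⟩
    have hm : a*k = m+e := by zify; linarith
    have hmr : (a:ℝ)*k = m+e := by exact_mod_cast hm
    have hlo := @Nat.factorial_mul_pow_le_factorial m e
    have hup : (m+e).factorial ≤ m.factorial * (m+e)^e := by
      rw [← Nat.factorial_mul_ascFactorial]
      exact Nat.mul_le_mul_left _ (Nat.ascFactorial_le_pow_add _ _)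
    have hlo' : (m.factorial : ℝ) * ((m:ℝ)+1)^e ≤ ((m+e).factorial : ℝ) := by exact_mod_cast hlo
    have hup' : ((m+e).factorial : ℝ) ≤ (m.factorial : ℝ) * ((m:ℝ)+e)^e := by exact_mod_cast hup
    rw [hm, zpow_neg, zpow_natCast]
    have hk0 := Nat.cast_nonneg (α := ℝ) k
    have he0 := Nat.cast_nonneg (α := ℝ) e
    have hm0 := Nat.cast_nonneg (α := ℝ) m
    have hP : (0:ℝ) < ((k:ℝ)+1)^e := by positivity
    refine ⟨by positivity, by positivity, ?_, ?_⟩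
    · have h1 : (m.factorial:ℝ) * ((k:ℝ)+1)^e ≤ ((a:ℝ)+e)^e * ((m+e).factorial:ℝ) := by
        calc _ ≤ (m.factorial:ℝ) * (((a:ℝ)+e)*(m+1))^e := by
              gcongr
              nlinarith [mul_nonneg he0 hm0, mul_nonneg (sub_nonneg.2 ha') hk0, mul_nonneg (sub_nonneg.2 ha') hm0]
          _ = ((a:ℝ)+e)^e * ((m.factorial:ℝ) * ((m:ℝ)+1)^e) := by rw [mul_pow]; ring
          _ ≤ _ := by gcongr
      calc (m.factorial:ℝ) = (m.factorial:ℝ) * ((k:ℝ)+1)^e * (((k:ℝ)+1)^e)⁻¹ := by field_simp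
        _ ≤ (((a:ℝ)+e)^e * ((m+e).factorial:ℝ)) * (((k:ℝ)+1)^e)⁻¹ := by gcongr
        _ = _ := by ring
    · calc (((k:ℝ)+1)^e)⁻¹ * ((m+e).factorial:ℝ) ≤ (((k:ℝ)+1)^e)⁻¹ * ((m.factorial : ℝ) * ((m:ℝ)+e)^e) := by gcongr
        _ ≤ (((k:ℝ)+1)^e)⁻¹ * ((m.factorial : ℝ) * (((a:ℝ)+e)*(k+1))^e) := by
            gcongr
            nlinarith [mul_nonneg he0 hk0]
        _ = _ := by rw [mul_pow]; field_simp

lemma hs_fact (a : ℕ) (ha : 0 < a) (c : ℤ) : ∃ K : ℝ, ∀ k m : ℕ, (m:ℤ) = a * k + c →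
    hsC K (m.factorial : ℝ) (Real.sqrt (k+1) ^ (2*c + 1 - (a:ℤ)) * ((a:ℝ)^(a*k) * (k.factorial:ℝ)^a)) := by
  obtain ⟨K, hK⟩ := hs_fact_shift a ha c
  obtain ⟨L, hL⟩ := hs_fact_mul a ha
  refine ⟨K * (1 * L), fun k m hm => (hK k m hm).trans ?_⟩
  have hs : 0 < Real.sqrt ((k:ℝ)+1) := by positivity
  have h := (hsC.refl (show 0 < ((k:ℝ)+1)^c by positivity)).mul (hL k)
  have e : ((k:ℝ)+1)^c = Real.sqrt (k+1) ^ (2*c) := by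
    rw [zpow_mul, zpow_two, Real.mul_self_sqrt (by positivity)]
  convert h using 1
  have e' : Real.sqrt ((k:ℝ)+1) ^ (2*c + 1 - (a:ℤ)) =
      Real.sqrt ((k:ℝ)+1) ^ (2*c) * Real.sqrt ((k:ℝ)+1) ^ (1 - (a:ℤ)) := by
    rw [← zpow_add₀ hs.ne']; congr 1; ring
  rw [e', e]; ring

/-- normalised binomial coefficient -/
noncomputable def hsD (n k : ℕ) : ℝ := Real.sqrt (n+1) * (Nat.choose n k : ℝ) / 2^n

/-- edge weight -/
noncomputable def hsT (n k : ℕ) : ℝ :=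
  (Real.sqrt (k+1) / Real.sqrt (n+1))^2 * (Real.sqrt ((n-k:ℕ)+1) / Real.sqrt (n+1))^2

lemma hs_zpow_bounds (w : ℝ) (hw : 0 < w) (hw1 : w ≤ 1) (e : ℤ) (M : ℕ) (hM : e.natAbs ≤ M) :
    w^e ≤ ((w^2)^M)⁻¹ ∧ (w^2)^M ≤ w^e := by
  have e1 : (w^2)^M = w^((2*M:ℕ):ℤ) := by rw [zpow_natCast, pow_mul]
  rw [e1, ← zpow_neg]
  constructor
  · exact zpow_le_zpow_right_of_le_one₀ hw hw1 (by push_cast; omega)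
  · exact zpow_le_zpow_right_of_le_one₀ hw hw1 (by push_cast; omega)

lemma hs_choose_cmp (a : ℕ) (ha : 0 < a) (b c : ℤ) : ∃ (K : ℝ) (M : ℕ), 0 < K ∧ ∀ n k N J : ℕ, k ≤ n → J ≤ N →
    (N:ℤ) = a * n + b → (J:ℤ) = a * k + c →
    Real.sqrt (n+1) * (Nat.choose N J : ℝ) / (2:ℝ)^((a:ℤ)*n+b) ≤ K * (hsD n k ^ a * (hsT n k ^ M)⁻¹) ∧
    hsD n k ^ a * hsT n k ^ M ≤ K * (Real.sqrt (n+1) * (Nat.choose N J : ℝ) / (2:ℝ)^((a:ℤ)*n+b)) := by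
  obtain ⟨K1, h1⟩ := hs_fact a ha b
  obtain ⟨K2, h2⟩ := hs_fact a ha c
  obtain ⟨K3, h3⟩ := hs_fact a ha (b-c)
  set e1 : ℤ := -(2*c+1-a) with he1
  set e2 : ℤ := -(2*(b-c)+1-a) with he2
  set B : ℝ := (2:ℝ)^b with hB
  have hB0 : 0 < B := by positivity
  set K0 : ℝ := |K1*(K2*K3)| with hK0
  refine ⟨(K0+1) * (B + B⁻¹), e1.natAbs + e2.natAbs, by positivity, ?_⟩
  intro n k N J hk hJ hN hJ'
  set Mx := e1.natAbs + e2.natAbs with hMx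
  have f1 := h1 n N hN
  have f2 := h2 k J hJ'
  have f3 := h3 (n-k) (N-J) (by push_cast [Nat.cast_sub hk, Nat.cast_sub hJ]; rw [hN, hJ']; ring)
  have f := f1.div (f2.mul f3)
  have hKpos := f.Kpos
  have hK0' : K1*(K2*K3) ≤ K0 := le_abs_self _
  rw [← Nat.cast_choose ℝ hJ] at f
  set σ := Real.sqrt ((n:ℝ)+1) with hσ
  have hσ0 : 0 < σ := by positivity
  set σ1 := Real.sqrt ((k:ℝ)+1) with hσ1
  have hσ10 : 0 < σ1 := by positivity
  set σ2 := Real.sqrt (((n-k:ℕ):ℝ)+1) with hσ2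
  have hσ20 : 0 < σ2 := by positivity
  set w := σ1/σ with hw
  set z := σ2/σ with hz
  have hw0 : 0 < w := by positivity
  have hz0 : 0 < z := by positivity
  have hw1 : w ≤ 1 := by
    rw [hw, div_le_one hσ0]; apply Real.sqrt_le_sqrt
    have : (k:ℝ) ≤ n := by exact_mod_cast hk
    linarith
  have hz1 : z ≤ 1 := by
    rw [hz, div_le_one hσ0]; apply Real.sqrt_le_sqrt
    have : ((n-k:ℕ):ℝ) ≤ n := by exact_mod_cast Nat.sub_le n k
    linarith
  have hs1 : σ1 = w * σ := by rw [hw]; field_simp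
  have hs2 : σ2 = z * σ := by rw [hz]; field_simp
  have hT : hsT n k = w^2 * z^2 := rfl
  have eD : hsD n k = σ * (Nat.choose n k : ℝ) / 2^n := rfl
  have hch : (0:ℝ) < (Nat.choose n k : ℝ) := by exact_mod_cast Nat.choose_pos hk
  have key : σ ^ (2*b+1-(a:ℤ)) * ((a:ℝ)^(a*n) * (n.factorial:ℝ)^a) /
      ((σ1 ^ (2*c+1-(a:ℤ)) * ((a:ℝ)^(a*k) * (k.factorial:ℝ)^a)) *
       (σ2 ^ (2*(b-c)+1-(a:ℤ)) * ((a:ℝ)^(a*(n-k)) * ((n-k).factorial:ℝ)^a)))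
      = (Nat.choose n k : ℝ)^a * σ^((a:ℤ)-1) * (w^e1 * z^e2) := by
    have g1 : (a:ℝ)^(a*n) = (a:ℝ)^(a*k) * (a:ℝ)^(a*(n-k)) := by
      rw [← pow_add, ← Nat.mul_add, Nat.add_sub_cancel' hk]
    rw [Nat.cast_choose ℝ hk, g1, hs1, hs2, mul_zpow, mul_zpow, he1, he2, zpow_neg, zpow_neg]
    have g2 : σ ^ (2*b+1-(a:ℤ)) = σ^((a:ℤ)-1) * (σ ^ (2*c+1-(a:ℤ)) * σ ^ (2*(b-c)+1-(a:ℤ))) := by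
      rw [← zpow_add₀ hσ0.ne', ← zpow_add₀ hσ0.ne']; congr 1; ring
    rw [g2]
    have : (0:ℝ) < a := by exact_mod_cast ha
    have q1 : 0 < σ ^ (2*c+1-(a:ℤ)) := by positivity
    have q2 : 0 < σ ^ (2*(b-c)+1-(a:ℤ)) := by positivity
    have q3 : 0 < w ^ (2*c+1-(a:ℤ)) := by positivity
    have q4 : 0 < z ^ (2*(b-c)+1-(a:ℤ)) := by positivity
    generalize σ ^ (2*c+1-(a:ℤ)) = Q1 at *
    generalize σ ^ (2*(b-c)+1-(a:ℤ)) = Q2 at *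
    generalize w ^ (2*c+1-(a:ℤ)) = Q3 at *
    generalize z ^ (2*(b-c)+1-(a:ℤ)) = Q4 at *
    rw [div_pow, mul_pow]
    field_simp
  rw [key] at f
  obtain ⟨w1, w2⟩ := hs_zpow_bounds w hw0 hw1 e1 Mx (by omega)
  obtain ⟨z1, z2⟩ := hs_zpow_bounds z hz0 hz1 e2 Mx (by omega)
  have hW : w^e1 * z^e2 ≤ (hsT n k ^ Mx)⁻¹ := by
    rw [hT, mul_pow, mul_inv]
    exact mul_le_mul w1 z1 (by positivity) (by positivity)
  have hW' : hsT n k ^ Mx ≤ w^e1 * z^e2 := by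
    rw [hT, mul_pow]
    exact mul_le_mul w2 z2 (by positivity) (by positivity)
  have hT0 : 0 < hsT n k := by rw [hT]; positivity
  have hD0 : 0 < hsD n k := by rw [eD]; positivity
  obtain ⟨-, -, f4, f5⟩ := f
  have e2p : (2:ℝ)^((a:ℤ)*n+b) = ((2:ℝ)^n)^a * B := by
    rw [zpow_add₀ (by norm_num), hB, ← pow_mul, mul_comm n a]; norm_cast
  have hrel : σ * ((Nat.choose n k : ℝ)^a * σ^((a:ℤ)-1)) / (((2:ℝ)^n)^a * B) = hsD n k ^a * B⁻¹ := by
    rw [eD, div_pow, mul_pow, zpow_sub₀ hσ0.ne', zpow_one, zpow_natCast]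
    field_simp
  set W := w^e1 * z^e2 with hWdef
  have hW0 : 0 < W := by positivity
  have hden : 0 < ((2:ℝ)^n)^a * B := by positivity
  rw [e2p]
  constructor
  · calc σ * (Nat.choose N J : ℝ) / (((2:ℝ)^n)^a * B)
        ≤ σ * (K1*(K2*K3) * ((Nat.choose n k : ℝ)^a * σ^((a:ℤ)-1) * W)) / (((2:ℝ)^n)^a * B) := by gcongr
      _ = (K1*(K2*K3)) * B⁻¹ * ((σ * ((Nat.choose n k : ℝ)^a * σ^((a:ℤ)-1)) / (((2:ℝ)^n)^a * B)) * B * W) := by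
          field_simp
      _ = (K1*(K2*K3)) * B⁻¹ * (hsD n k ^a * W) := by rw [hrel]; field_simp
      _ ≤ ((K0+1) * (B + B⁻¹)) * (hsD n k ^ a * (hsT n k ^ Mx)⁻¹) := by
          gcongr <;> linarith
  · calc hsD n k ^ a * hsT n k ^ Mx ≤ hsD n k ^ a * W := by gcongr
      _ = B * (σ * ((Nat.choose n k : ℝ)^a * σ^((a:ℤ)-1) * W) / (((2:ℝ)^n)^a * B)) := by
          have : hsD n k ^ a = (hsD n k ^ a * B⁻¹) * B := by field_simp
          rw [this, ← hrel]; field_simp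
      _ ≤ B * (σ * (K1*(K2*K3) * (Nat.choose N J : ℝ)) / (((2:ℝ)^n)^a * B)) := by gcongr
      _ = ((K1*(K2*K3)) * B) * (σ * (Nat.choose N J : ℝ) / (((2:ℝ)^n)^a * B)) := by ring
      _ ≤ _ := by
          have : 0 < B⁻¹ := by positivity
          gcongr <;> linarith


lemma hsD_pos (n k : ℕ) (hk : k ≤ n) : 0 < hsD n k := by
  have hch : (0:ℝ) < (Nat.choose n k : ℝ) := by exact_mod_cast Nat.choose_pos hk
  unfold hsD; positivity

lemma hsT_pos (n k : ℕ) : 0 < hsT n k := by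
  unfold hsT; positivity

lemma hs_even_bound (m J : ℕ) (hm : 0 < m) (hJ : J ≤ 2*m) :
    (Nat.choose (2*m) J : ℝ) * (1 + ((J:ℝ)-m)^2/(2*m)) ≤ Nat.choose (2*m) m := by
  set d := Int.natAbs ((J:ℤ)-m) with hd
  have hdr : ((d:ℕ):ℝ)^2 = ((J:ℝ)-m)^2 := by
    rw [hd, Nat.cast_natAbs]; push_cast; rw [sq_abs]
  have hsym : Nat.choose (2*m) J = Nat.choose (2*m) (m+d) := by
    rcases le_total m J with h1 | h1
    · congr 1; omega
    · apply Nat.choose_symm_of_eq_add; omega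
  have hu := hs_choose_upper m m d (by omega) (by omega)
  rw [hsym, ← hdr]
  have e : (m:ℝ)+m = 2*m := by ring
  rw [e] at hu
  have h1 := Real.add_one_le_exp ((d:ℝ)^2/(2*m))
  calc _ ≤ ((Nat.choose (2*m) m : ℝ) * Real.exp (-((d:ℝ)^2/(2*m)))) * Real.exp ((d:ℝ)^2/(2*m)) := by
        gcongr; linarith
    _ = _ := by rw [mul_assoc, ← Real.exp_add]; simp

lemma hs_choose_enlarge (M n k : ℕ) (hk : k ≤ n) :
    (Nat.choose n k : ℝ) * ((n:ℝ)+1)^(2*M) ≤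
      ((M:ℝ)+1)^(2*M) * (((k:ℝ)+1)*((n-k:ℕ)+1))^M * Nat.choose (n+2*M) (k+M) := by
  have hup : ∀ j : ℕ, ((j+M).factorial : ℝ) ≤ (j.factorial : ℝ) * (((M:ℝ)+1)*((j:ℝ)+1))^M := by
    intro j
    have : (j+M).factorial ≤ j.factorial * (j+M)^M := by
      rw [← Nat.factorial_mul_ascFactorial]
      exact Nat.mul_le_mul_left _ (Nat.ascFactorial_le_pow_add _ _)
    have : ((j+M).factorial : ℝ) ≤ (j.factorial : ℝ) * ((j:ℝ)+M)^M := by exact_mod_cast this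
    refine this.trans ?_
    gcongr
    nlinarith [mul_nonneg (Nat.cast_nonneg (α := ℝ) M) (Nat.cast_nonneg (α := ℝ) j)]
  have hlo : (n.factorial : ℝ) * ((n:ℝ)+1)^(2*M) ≤ ((n+2*M).factorial : ℝ) := by
    exact_mod_cast @Nat.factorial_mul_pow_le_factorial n (2*M)
  have h1 := hup k
  have h2 := hup (n-k)
  rw [Nat.cast_choose ℝ hk, Nat.cast_choose ℝ (show k+M ≤ n+2*M by omega),
    show n+2*M-(k+M) = n-k+M by omega]
  rw [div_mul_eq_mul_div, mul_div_assoc', div_le_div_iff₀ (by positivity) (by positivity)]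
  calc _ ≤ ((n+2*M).factorial : ℝ) * (((k.factorial : ℝ) * (((M:ℝ)+1)*((k:ℝ)+1))^M) *
        (((n-k).factorial : ℝ) * (((M:ℝ)+1)*(((n-k:ℕ):ℝ)+1))^M)) := by gcongr
    _ = _ := by simp only [mul_pow, pow_mul']; ring

set_option maxHeartbeats 1000000 in
lemma hsD_bound (M : ℕ) : ∃ C : ℝ, 0 < C ∧ ∀ n k : ℕ, 0 < n → k ≤ n →
    hsD n k * (hsT n k ^ M)⁻¹ ≤ C / (1 + (((k:ℝ) - (n:ℝ)/2)/Real.sqrt n)^2) := by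
  refine ⟨((M:ℝ)+1)^(2*M) * 2^(2*M+1) * (4*M+4), by positivity, fun n k hn hk => ?_⟩
  set m := (n+2*M+1)/2 with hm
  have hm0 : 0 < m := by omega
  have hm1 : n + 2*M ≤ 2*m := by omega
  have hm2 : 2*m ≤ n+2*M+1 := by omega
  have b1 := hs_choose_enlarge M n k hk
  have b2 : (Nat.choose (n+2*M) (k+M) : ℝ) ≤ Nat.choose (2*m) (k+M) := by
    exact_mod_cast Nat.choose_le_choose (k+M) hm1
  have b3 := hs_even_bound m (k+M) hm0 (by omega)
  have b4 := hs_central_le m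
  have hTe : hsT n k = ((k:ℝ)+1)*((n-k:ℕ)+1) / ((n:ℝ)+1)^2 := by
    unfold hsT
    rw [div_pow, div_pow, Real.sq_sqrt (by positivity), Real.sq_sqrt (by positivity), Real.sq_sqrt (by positivity)]
    field_simp
  set P := 1 + (((k+M:ℕ):ℝ)-m)^2/(2*m) with hP
  have hP0 : 0 < P := by positivity
  have hTp := hsT_pos n k
  have hn1 : (1:ℝ) ≤ n := by exact_mod_cast hn
  have hm1' : (n:ℝ)+2*M ≤ 2*m := by exact_mod_cast hm1
  have hm2' : 2*(m:ℝ) ≤ n+2*M+1 := by exact_mod_cast hm2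
  have hM0 : (0:ℝ) ≤ M := by positivity
  have b5 : hsD n k * (hsT n k ^ M)⁻¹ ≤ ((M:ℝ)+1)^(2*M) * 2^(2*M+1) / P := by
    have hpos : (0:ℝ) < (((k:ℝ)+1)*((n-k:ℕ)+1))^M := by positivity
    have c1 : (Nat.choose n k : ℝ) * (hsT n k ^ M)⁻¹ ≤ ((M:ℝ)+1)^(2*M) * Nat.choose (n+2*M) (k+M) := by
      rw [hTe, div_pow, inv_div, ← pow_mul, mul_div_assoc', div_le_iff₀ hpos]
      linarith
    have c2 : Real.sqrt (n+1) ≤ Real.sqrt (2*m+1) := Real.sqrt_le_sqrt (by linarith)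
    have c3 : (Nat.choose (2*m) (k+M) : ℝ) * Real.sqrt (2*m+1) ≤ 2^(2*M+1) * 2^n / P := by
      rw [le_div_iff₀ hP0]
      calc _ = ((Nat.choose (2*m) (k+M) : ℝ) * P) * Real.sqrt (2*m+1) := by ring
        _ ≤ (Nat.choose (2*m) m : ℝ) * Real.sqrt (2*m+1) := by gcongr
        _ ≤ 4^m := b4
        _ = 2^(2*m) := by rw [pow_mul]; norm_num
        _ ≤ 2^(2*M+1+n) := pow_le_pow_right₀ (by norm_num) (by omega)
        _ = _ := pow_add _ _ _
    calc hsD n k * (hsT n k ^ M)⁻¹ = Real.sqrt (n+1) * ((Nat.choose n k : ℝ) * (hsT n k ^ M)⁻¹) / 2^n := by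
          unfold hsD; ring
      _ ≤ Real.sqrt (2*m+1) * (((M:ℝ)+1)^(2*M) * Nat.choose (2*m) (k+M)) / 2^n := by
          have c1' := c1.trans (mul_le_mul_of_nonneg_left b2 (by positivity : (0:ℝ) ≤ ((M:ℝ)+1)^(2*M)))
          exact div_le_div_of_nonneg_right (mul_le_mul c2 c1' (by positivity) (by positivity)) (by positivity)
      _ = ((M:ℝ)+1)^(2*M) * ((Nat.choose (2*m) (k+M) : ℝ) * Real.sqrt (2*m+1)) / 2^n := by ring
      _ ≤ ((M:ℝ)+1)^(2*M) * (2^(2*M+1) * 2^n / P) / 2^n := by gcongr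
      _ = _ := by field_simp
  refine b5.trans ?_
  have hQ : 0 < 1 + (((k:ℝ) - (n:ℝ)/2)/Real.sqrt n)^2 := by positivity
  rw [div_le_div_iff₀ hP0 hQ]
  suffices hfin : 1 + (((k:ℝ) - (n:ℝ)/2)/Real.sqrt n)^2 ≤ (4*M+4)*P by
    calc _ ≤ ((M:ℝ)+1)^(2*M) * 2^(2*M+1) * ((4*M+4)*P) :=
          mul_le_mul_of_nonneg_left hfin (by positivity)
      _ = _ := by ring
  rw [div_pow, Real.sq_sqrt (by positivity)]
  set δ := ((k+M:ℕ):ℝ)-m with hδ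
  have d1 : ((k:ℝ) - (n:ℝ)/2)^2 ≤ 2*δ^2 + 1/2 := by
    have hx : ∃ t : ℝ, (k:ℝ) - (n:ℝ)/2 = δ + t ∧ 0 ≤ t ∧ t ≤ 1/2 := by
      refine ⟨m - M - (n:ℝ)/2, ?_, ?_, ?_⟩
      · rw [hδ]; push_cast; ring
      · linarith
      · linarith
    obtain ⟨t, ht, t0, t1⟩ := hx
    rw [ht]
    nlinarith [sq_nonneg (δ - t)]
  have d2 : δ^2/n ≤ (2*M+2) * (δ^2/(2*m)) := by
    have hmp : (0:ℝ) < m := by exact_mod_cast hm0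
    rw [mul_div_assoc', div_le_div_iff₀ (by positivity) (by positivity)]
    have : 2*(m:ℝ) ≤ (2*M+2)*n := by nlinarith
    nlinarith [mul_le_mul_of_nonneg_left this (sq_nonneg δ)]
  have d3 : ((k:ℝ) - (n:ℝ)/2)^2/n ≤ 2*(δ^2/n) + 1/2 := by
    rw [div_le_iff₀ (by positivity)]
    have : (2 * (δ ^ 2 / n) + 1 / 2) * (n:ℝ) = 2*δ^2 + n/2 := by field_simp
    rw [this]; linarith
  rw [hP]
  nlinarith

lemma hs_cmp_prod {p : ℕ} (a : Fin p → ℕ) (ha : ∀ i, 0 < a i) (b c : Fin p → ℤ) :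
    ∃ (K : ℝ) (M : ℕ), 0 < K ∧ ∀ n k : ℕ, k ≤ n →
    (∀ i, 0 ≤ (a i : ℤ) * (k : ℤ) + c i ∧
          (a i : ℤ) * (k : ℤ) + c i ≤ (a i : ℤ) * (n : ℤ) + b i) →
    (∏ i, Real.sqrt (n+1) * (Nat.choose ((a i : ℤ) * (n : ℤ) + b i).toNat
          ((a i : ℤ) * (k : ℤ) + c i).toNat : ℝ) / (2:ℝ)^((a i:ℤ)*n+b i))
        ≤ K * (hsD n k ^ (∑ i, a i) * (hsT n k ^ M)⁻¹) ∧
    hsD n k ^ (∑ i, a i) * hsT n k ^ M ≤ K * (∏ i, Real.sqrt (n+1) * (Nat.choose ((a i : ℤ) * (n : ℤ) + b i).toNat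
          ((a i : ℤ) * (k : ℤ) + c i).toNat : ℝ) / (2:ℝ)^((a i:ℤ)*n+b i)) := by
  choose K M hK h using fun i => hs_choose_cmp (a i) (ha i) (b i) (c i)
  refine ⟨∏ i, K i, ∑ i, M i, Finset.prod_pos fun i _ => hK i, fun n k hk hv => ?_⟩
  have hh := fun i => h i n k ((a i : ℤ) * (n : ℤ) + b i).toNat ((a i : ℤ) * (k : ℤ) + c i).toNat hk
    (by have := hv i; omega) (by have := hv i; omega) (by have := hv i; omega)
  have hD := hsD_pos n k hk
  have hT := hsT_pos n k
  constructor
  · refine (Finset.prod_le_prod (fun i _ => by positivity) (fun i _ => (hh i).1)).trans (le_of_eq ?_)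
    rw [Finset.prod_mul_distrib, Finset.prod_mul_distrib, Finset.prod_pow_eq_pow_sum, Finset.prod_inv_distrib,
      Finset.prod_pow_eq_pow_sum]
  · rw [← Finset.prod_mul_distrib, ← Finset.prod_pow_eq_pow_sum, ← Finset.prod_pow_eq_pow_sum,
      ← Finset.prod_mul_distrib]
    exact Finset.prod_le_prod (fun i _ => by positivity) (fun i _ => (hh i).2)

lemma hs_valid (a : ℕ) (ha : 0 < a) (b c : ℤ) (x : ℝ) (k : ℕ → ℕ)
    (hk : Tendsto (fun n => ((k n : ℝ) - (n:ℝ)/2)/Real.sqrt n) atTop (nhds x)) :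
    ∀ᶠ n : ℕ in atTop, 0 ≤ (a : ℤ) * (k n : ℤ) + c ∧
          (a : ℤ) * (k n : ℤ) + c ≤ (a : ℤ) * (n : ℤ) + b := by
  have ha' : (0:ℝ) < a := by exact_mod_cast ha
  have hn : Tendsto (fun n : ℕ => (n:ℝ)) atTop atTop := tendsto_natCast_atTop_atTop
  have hsn : Tendsto (fun n : ℕ => Real.sqrt n) atTop atTop := Real.tendsto_sqrt_atTop.comp hn
  have h1 : Tendsto (fun n => ((k n : ℝ) - (n : ℝ)/2)/(n : ℝ)) atTop (nhds 0) := by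
    have := hk.mul hsn.inv_tendsto_atTop
    rw [mul_zero] at this
    refine this.congr fun n => ?_
    simp only [Pi.inv_apply]
    rw [div_mul_eq_mul_div, ← div_eq_mul_inv, div_div, Real.mul_self_sqrt (by positivity)]
  have hc : Tendsto (fun n : ℕ => (c:ℝ)/n) atTop (nhds 0) := hn.const_div_atTop _
  have hb : Tendsto (fun n : ℕ => ((b:ℝ)-c)/n) atTop (nhds 0) := hn.const_div_atTop _
  have t1 : Tendsto (fun n : ℕ => (a:ℝ) * (((k n : ℝ) - (n : ℝ)/2)/(n : ℝ)) + a/2 + c/n) atTop (nhds (a/2)) := by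
    have := ((h1.const_mul (a:ℝ)).add_const ((a:ℝ)/2)).add hc
    simpa using this
  have t2 : Tendsto (fun n : ℕ => -((a:ℝ) * (((k n : ℝ) - (n : ℝ)/2)/(n : ℝ))) + a/2 + (b-c)/n) atTop (nhds (a/2)) := by
    have := ((h1.const_mul (a:ℝ)).neg.add_const ((a:ℝ)/2)).add hb
    simpa using this
  filter_upwards [t1.eventually_const_lt (show (0:ℝ) < a/2 by positivity),
    t2.eventually_const_lt (show (0:ℝ) < a/2 by positivity), eventually_gt_atTop 0] with n g1 g2 hn0
  have hn0' : (0:ℝ) < n := by exact_mod_cast hn0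
  have e1 : (a:ℝ) * (((k n : ℝ) - (n : ℝ)/2)/(n : ℝ)) + a/2 + c/n = (a * k n + c)/n := by
    field_simp; ring
  have e2 : -((a:ℝ) * (((k n : ℝ) - (n : ℝ)/2)/(n : ℝ))) + a/2 + (b-c)/n = (a * n + b - (a * k n + c))/n := by
    field_simp; ring
  rw [e1] at g1
  rw [e2] at g2
  have g1 := (div_pos_iff_of_pos_right hn0').1 g1
  have g2 := (div_pos_iff_of_pos_right hn0').1 g2
  constructor
  · have : (0:ℤ) < (a : ℤ) * (k n : ℤ) + c := by exact_mod_cast g1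
    exact this.le
  · have : (0:ℤ) < (a : ℤ) * (n : ℤ) + b - ((a : ℤ) * (k n : ℤ) + c) := by exact_mod_cast g2
    linarith

lemma hs_term_lim (a : ℕ) (ha : 0 < a) (b c : ℤ) (x : ℝ) (k : ℕ → ℕ)
    (hk : Tendsto (fun n => ((k n : ℝ) - (n:ℝ)/2)/Real.sqrt n) atTop (nhds x)) :
    Tendsto (fun n : ℕ => (Nat.choose ((a : ℤ) * (n : ℤ) + b).toNat
          ((a : ℤ) * (k n : ℤ) + c).toNat : ℝ) / (2:ℝ)^((a:ℤ)*n+b) * (Real.sqrt (Real.pi * n / 2) * Real.sqrt a))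
      atTop (nhds (Real.exp (-2 * x^2 * a))) := by
  have ha' : (0:ℝ) < a := by exact_mod_cast ha
  have hv := hs_valid a ha b c x k hk
  have hn : Tendsto (fun n : ℕ => (n:ℝ)) atTop atTop := tendsto_natCast_atTop_atTop
  have hsn : Tendsto (fun n : ℕ => Real.sqrt n) atTop atTop := Real.tendsto_sqrt_atTop.comp hn
  set N : ℕ → ℕ := fun n => ((a : ℤ) * (n : ℤ) + b).toNat with hN
  set J : ℕ → ℕ := fun n => ((a : ℤ) * (k n : ℤ) + c).toNat with hJ
  have hNr : ∀ᶠ n : ℕ in atTop, (N n : ℝ) = a * n + b := by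
    filter_upwards [hv] with n h
    have : ((N n : ℕ) : ℤ) = (a : ℤ) * (n : ℤ) + b := Int.toNat_of_nonneg (h.1.trans h.2)
    exact_mod_cast this
  have hJr : ∀ᶠ n : ℕ in atTop, (J n : ℝ) = a * k n + c := by
    filter_upwards [hv] with n h
    have : ((J n : ℕ) : ℤ) = (a : ℤ) * (k n : ℤ) + c := Int.toNat_of_nonneg h.1
    exact_mod_cast this
  have hNat : Tendsto (fun n => (N n : ℝ)) atTop atTop := by
    have : Tendsto (fun n : ℕ => (a:ℝ) * n + b) atTop atTop :=
      tendsto_atTop_add_const_right _ _ (hn.const_mul_atTop ha')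
    refine this.congr' ?_
    filter_upwards [hNr] with n h using h.symm
  have hNt : Tendsto N atTop atTop := tendsto_natCast_atTop_iff.1 hNat
  have hrat : Tendsto (fun n : ℕ => (N n:ℝ)/n) atTop (nhds a) := by
    have h1 : Tendsto (fun n : ℕ => (a:ℝ) + b/n) atTop (nhds a) := by
      simpa using (hn.const_div_atTop (b:ℝ)).const_add (a:ℝ)
    refine h1.congr' ?_
    filter_upwards [hNr, eventually_gt_atTop 0] with n h h0
    have : (0:ℝ) < n := by exact_mod_cast h0
    rw [h]; field_simp
  have hsr : Tendsto (fun n : ℕ => Real.sqrt n / Real.sqrt (N n)) atTop (nhds (1/Real.sqrt a)) := by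
    have h1 := ((Real.continuous_sqrt.tendsto _).comp hrat).inv₀ (by positivity)
    rw [one_div]
    refine h1.congr fun n => ?_
    simp only [Function.comp]
    rw [Real.sqrt_div (by positivity), inv_div]
  have hKt : Tendsto (fun n => ((J n : ℝ) - (N n : ℝ)/2)/Real.sqrt (N n)) atTop (nhds (Real.sqrt a * x)) := by
    have h0 : Tendsto (fun n : ℕ => ((c:ℝ)-b/2)/Real.sqrt n) atTop (nhds 0) := hsn.const_div_atTop _
    have h1 := ((hk.const_mul (a:ℝ)).add h0).mul hsr
    have e : ((a:ℝ) * x + 0) * (1/Real.sqrt a) = Real.sqrt a * x := by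
      have : Real.sqrt a * Real.sqrt a = a := Real.mul_self_sqrt ha'.le
      rw [add_zero]; field_simp; rw [sq, this]; ring
    rw [e] at h1
    refine h1.congr' ?_
    filter_upwards [hNr, hJr, eventually_gt_atTop 0] with n e1 e2 h0
    have : (0:ℝ) < Real.sqrt n := by positivity
    rw [e1, e2]
    have e5 : (a:ℝ) * (((k n : ℝ) - (n:ℝ)/2)/Real.sqrt n) + ((c:ℝ)-b/2)/Real.sqrt n
        = ((a:ℝ) * (k n : ℝ) + c - ((a:ℝ)*n+b)/2)/Real.sqrt n := by
      rw [mul_div_assoc', ← add_div]; congr 1; ring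
    rw [e5, div_mul_div_cancel₀ this.ne']
  have hL := (hs_local N J _ hNt hKt).mul ((hsr.mul_const (Real.sqrt (Real.pi/2))).mul_const (Real.sqrt a))
  have e : Real.sqrt (2 / Real.pi) * Real.exp (-2 * (Real.sqrt a * x) ^ 2) *
      (1 / Real.sqrt a * Real.sqrt (Real.pi / 2) * Real.sqrt a) = Real.exp (-2 * x^2 * a) := by
    have h1 : Real.sqrt (2 / Real.pi) * Real.sqrt (Real.pi / 2) = 1 := by
      rw [← Real.sqrt_mul (by positivity), div_mul_div_cancel₀' (by positivity)]; simp
    rw [mul_pow, Real.sq_sqrt ha'.le, show -2 * (a * x^2) = -2*x^2*a by ring]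
    have : 0 < Real.sqrt a := by positivity
    calc _ = (Real.sqrt (2 / Real.pi) * Real.sqrt (Real.pi / 2)) * Real.exp (-2*x^2*a) *
          (1 / Real.sqrt a * Real.sqrt a) := by ring
      _ = _ := by rw [h1, one_div, inv_mul_cancel₀ this.ne', one_mul, mul_one]
  rw [e] at hL
  refine hL.congr' ?_
  filter_upwards [hv, hNt.eventually_gt_atTop 0] with n h hp
  have e3 : (2:ℝ)^((a:ℤ)*n+b) = 2^(N n) := by
    have : ((N n : ℕ) : ℤ) = (a : ℤ) * (n : ℤ) + b := Int.toNat_of_nonneg (h.1.trans h.2)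
    rw [← this, zpow_natCast]
  rw [e3, show Real.pi * n / 2 = n * (Real.pi/2) by ring, Real.sqrt_mul (by positivity)]
  have : 0 < Real.sqrt (N n) := by positivity
  field_simp
  ring


lemma hs_lam (n : ℕ) (hn : 0 < n) :
    Real.sqrt (Real.pi * n / 2) ≤ 2 * Real.sqrt (n+1) ∧ Real.sqrt (n+1) ≤ 2 * Real.sqrt (Real.pi * n / 2) := by
  have hn' : (1:ℝ) ≤ n := by exact_mod_cast hn
  have h3 := Real.pi_gt_three
  have h4 := Real.pi_le_four
  constructor
  · rw [Real.sqrt_le_left (by positivity), mul_pow, Real.sq_sqrt (by positivity)]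
    nlinarith
  · rw [Real.sqrt_le_left (by positivity), mul_pow, Real.sq_sqrt (by positivity)]
    nlinarith

/-- the product of normalised binomial coefficients -/
noncomputable def hsX {p : ℕ} (a : Fin p → ℕ) (b c : Fin p → ℤ) (n k : ℕ) : ℝ :=
  ∏ i, ((Nat.choose ((a i : ℤ) * (n : ℤ) + b i).toNat
          ((a i : ℤ) * (k : ℤ) + c i).toNat : ℝ) / (2:ℝ)^((a i:ℤ)*n+b i) *
            (Real.sqrt (Real.pi * n / 2) * Real.sqrt (a i)))

lemma hsX_eq {p : ℕ} (a : Fin p → ℕ) (b c : Fin p → ℤ) (n k : ℕ) :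
    hsX a b c n k = (∏ i, (Nat.choose ((a i : ℤ) * (n : ℤ) + b i).toNat
          ((a i : ℤ) * (k : ℤ) + c i).toNat : ℝ)) / (2:ℝ)^((∑ i, (a i:ℤ))*n+∑ i, b i) *
            (Real.sqrt (Real.pi * n / 2)^p * Real.sqrt (∏ i, (a i:ℝ))) := by
  unfold hsX
  rw [Finset.prod_mul_distrib, Finset.prod_mul_distrib, Finset.prod_div_distrib, Finset.prod_const,
    Finset.card_univ, Fintype.card_fin, Real.sqrt_prod _ (fun i _ => by positivity)]
  congr 2
  rw [Finset.sum_mul, ← Finset.sum_add_distrib]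
  induction (Finset.univ : Finset (Fin p)) using Finset.induction_on with
  | empty => simp
  | insert i s hi ih => rw [Finset.prod_insert hi, Finset.sum_insert hi, ih,
      ← zpow_add₀ (by norm_num : (2:ℝ) ≠ 0)]

lemma hsX_rel {p : ℕ} (a : Fin p → ℕ) (b c : Fin p → ℤ) (n k : ℕ) :
    hsX a b c n k * Real.sqrt (n+1)^p =
      (∏ i, Real.sqrt (n+1) * (Nat.choose ((a i : ℤ) * (n : ℤ) + b i).toNat
          ((a i : ℤ) * (k : ℤ) + c i).toNat : ℝ) / (2:ℝ)^((a i:ℤ)*n+b i)) *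
            (Real.sqrt (Real.pi * n / 2)^p * Real.sqrt (∏ i, (a i:ℝ))) := by
  unfold hsX
  have e1 : ∀ y : ℝ, y^p = ∏ _i : Fin p, y := by intro y; simp
  rw [e1, e1, Real.sqrt_prod _ (fun i _ => by positivity), ← Finset.prod_mul_distrib,
    ← Finset.prod_mul_distrib, ← Finset.prod_mul_distrib]
  refine Finset.prod_congr rfl fun i _ => ?_
  ring

lemma hsX_bounds {p : ℕ} (a : Fin p → ℕ) (ha : ∀ i, 0 < a i) (b c : Fin p → ℤ) :
    ∃ (K : ℝ) (M : ℕ), 0 < K ∧ ∀ n k : ℕ, 0 < n → k ≤ n →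
    (∀ i, 0 ≤ (a i : ℤ) * (k : ℤ) + c i ∧
          (a i : ℤ) * (k : ℤ) + c i ≤ (a i : ℤ) * (n : ℤ) + b i) →
    hsX a b c n k ≤ K * (hsD n k ^ (∑ i, a i) * (hsT n k ^ M)⁻¹) ∧
    hsD n k ^ (∑ i, a i) * hsT n k ^ M ≤ K * hsX a b c n k := by
  obtain ⟨K, M, hK, h⟩ := hs_cmp_prod a ha b c
  set S := Real.sqrt (∏ i, (a i:ℝ)) with hS
  have hS0 : 0 < S := by
    apply Real.sqrt_pos.2
    exact Finset.prod_pos fun i _ => by exact_mod_cast ha i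
  refine ⟨K * 2^p * (S + S⁻¹), M, by positivity, fun n k hn hk hv => ?_⟩
  obtain ⟨h1, h2⟩ := h n k hk hv
  obtain ⟨l1, l2⟩ := hs_lam n hn
  have hrel := hsX_rel a b c n k
  rw [← hS] at hrel
  have hD := hsD_pos n k hk
  have hT := hsT_pos n k
  have hX0 : 0 ≤ hsX a b c n k := Finset.prod_nonneg fun i _ => by positivity
  set Y := ∏ i, Real.sqrt (n+1) * (Nat.choose ((a i : ℤ) * (n : ℤ) + b i).toNat
          ((a i : ℤ) * (k : ℤ) + c i).toNat : ℝ) / (2:ℝ)^((a i:ℤ)*n+b i) with hY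
  have hY0 : 0 ≤ Y := Finset.prod_nonneg fun i _ => by positivity
  set σ := Real.sqrt ((n:ℝ)+1) with hσ
  set ρ := Real.sqrt (Real.pi * n / 2) with hρ
  have hσ0 : 0 < σ := by positivity
  have hρ0 : 0 < ρ := by positivity
  have hSi : 0 < S⁻¹ := by positivity
  have m1 : hsX a b c n k ≤ 2^p * S * Y := by
    have : hsX a b c n k * σ^p ≤ (2^p * S * Y) * σ^p := by
      rw [hrel]
      calc Y * (ρ^p * S) ≤ Y * ((2*σ)^p * S) := by gcongr
        _ = _ := by rw [mul_pow]; ring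
    exact le_of_mul_le_mul_right this (by positivity)
  have m2 : Y ≤ 2^p * S⁻¹ * hsX a b c n k := by
    have : Y * (ρ^p * S) ≤ (2^p * S⁻¹ * hsX a b c n k) * (ρ^p * S) := by
      rw [← hrel]
      calc hsX a b c n k * σ^p ≤ hsX a b c n k * (2*ρ)^p := by gcongr
        _ = _ := by rw [mul_pow]; field_simp
    exact le_of_mul_le_mul_right this (by positivity)
  constructor
  · calc _ ≤ 2^p * S * Y := m1
      _ ≤ 2^p * S * (K * (hsD n k ^ (∑ i, a i) * (hsT n k ^ M)⁻¹)) := by gcongr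
      _ = (K * 2^p * S) * (hsD n k ^ (∑ i, a i) * (hsT n k ^ M)⁻¹) := by ring
      _ ≤ _ := by gcongr; linarith
  · calc _ ≤ K * Y := h2
      _ ≤ K * (2^p * S⁻¹ * hsX a b c n k) := by gcongr
      _ = (K * 2^p * S⁻¹) * hsX a b c n k := by ring
      _ ≤ _ := by gcongr; linarith

lemma hsX_lim {p : ℕ} (a : Fin p → ℕ) (ha : ∀ i, 0 < a i) (b c : Fin p → ℤ) (x : ℝ) (k : ℕ → ℕ)
    (hk : Tendsto (fun n => ((k n : ℝ) - (n:ℝ)/2)/Real.sqrt n) atTop (nhds x)) :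
    Tendsto (fun n : ℕ => hsX a b c n (k n)) atTop (nhds (Real.exp (-2 * x^2 * ∑ i, (a i:ℝ)))) := by
  rw [Finset.mul_sum, Real.exp_sum]
  unfold hsX
  exact tendsto_finsetProd _ fun i _ => hs_term_lim (a i) (ha i) (b i) (c i) x k hk

theorem hypSum_asymptotics (p q : ℕ) (hp : 1 ≤ p)
    (a : Fin p → ℕ) (ha : ∀ i, 0 < a i) (b c : Fin p → ℤ)
    (r : Fin q → ℕ) (hr : ∀ j, 0 < r j) (s t : Fin q → ℤ)
    (A : ℤ) (hA : A = (∑ i, (a i : ℤ)) - ∑ j, (r j : ℤ)) (hApos : 0 < A) :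
    Filter.Tendsto
      (fun n : ℕ =>
        hypSum p q a b c r s t n /
          ((Real.pi * n / 2) ^ (((q : ℝ) - (p : ℝ) + 1) / 2) *
            (2 : ℝ) ^ (A * (n : ℤ) + (∑ i, b i) - ∑ j, s j) *
            Real.sqrt ((∏ j, (r j : ℝ)) / ∏ i, (a i : ℝ)) / Real.sqrt (A : ℝ)))
      atTop (nhds 1) := by
  classical
  have hAr : (0:ℝ) < A := by exact_mod_cast hApos
  have hAr' : (A:ℝ) = (∑ i, (a i:ℝ)) - ∑ j, (r j:ℝ) := by rw [hA]; push_cast; rfl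
  obtain ⟨A', rfl⟩ : ∃ A' : ℕ, A = (A':ℤ) + 1 := ⟨(A-1).toNat, by omega⟩
  have hsum : ∑ i, a i = (A' + 1) + ∑ j, r j := by zify; linarith
  set V : ℕ → ℕ → Prop := fun n k => (∀ i, 0 ≤ (a i : ℤ) * (k : ℤ) + c i ∧
          (a i : ℤ) * (k : ℤ) + c i ≤ (a i : ℤ) * (n : ℤ) + b i) ∧
       (∀ j, 0 ≤ (r j : ℤ) * (k : ℤ) + t j ∧
          (r j : ℤ) * (k : ℤ) + t j ≤ (r j : ℤ) * (n : ℤ) + s j) with hV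
  set h : ℕ → ℕ → ℝ := fun n k => if V n k then hsX a b c n k / hsX r s t n k else 0 with hh
  obtain ⟨K1, M1, hK1, B1⟩ := hsX_bounds a ha b c
  obtain ⟨K2, M2, hK2, B2⟩ := hsX_bounds r hr s t
  obtain ⟨C0, hC0, D0⟩ := hsD_bound 0
  obtain ⟨C1, hC1, D1⟩ := hsD_bound (M1+M2)
  have main := hs_riemann h (fun x => Real.exp (-(2*((A':ℝ)+1)) * x^2)) (K1*K2*C0^A'*C1) ?_ ?_ ?_
  · rw [integral_gaussian] at main
    have hA2 : ((((A':ℤ)+1 : ℤ)):ℝ) = (A':ℝ)+1 := by push_cast; rfl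
    rw [hA2] at hAr ⊢
    have hne : Real.sqrt (Real.pi / (2*((A':ℝ)+1))) ≠ 0 := by positivity
    have main2 := main.div_const (Real.sqrt (Real.pi / (2*((A':ℝ)+1))))
    rw [div_self hne] at main2
    refine main2.congr' ?_
    filter_upwards [eventually_gt_atTop 0] with n hn
    have hn' : (0:ℝ) < n := by exact_mod_cast hn
    set ρ := Real.sqrt (Real.pi * n / 2) with hρ
    have hρ0 : 0 < ρ := by positivity
    have hPa : 0 < Real.sqrt (∏ i, (a i:ℝ)) :=
      Real.sqrt_pos.2 (Finset.prod_pos fun i _ => by exact_mod_cast ha i)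
    have hPr : 0 < Real.sqrt (∏ j, (r j:ℝ)) :=
      Real.sqrt_pos.2 (Finset.prod_pos fun i _ => by exact_mod_cast hr i)
    have e1 : (Real.pi * n / 2) ^ (((q : ℝ) - (p : ℝ) + 1) / 2) = ρ^q / ρ^p * ρ := by
      rw [hρ, Real.sqrt_eq_rpow, ← Real.rpow_natCast, ← Real.rpow_natCast, ← Real.rpow_mul (by positivity),
        ← Real.rpow_mul (by positivity), ← Real.rpow_sub (by positivity), ← Real.rpow_add (by positivity)]
      congr 1; ring
    have e2 : (2 : ℝ) ^ (((A':ℤ)+1) * (n : ℤ) + (∑ i, b i) - ∑ j, s j) =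
        (2:ℝ)^((∑ i, (a i:ℤ))*n+∑ i, b i) / (2:ℝ)^((∑ j, (r j:ℤ))*n+∑ j, s j) := by
      rw [← zpow_sub₀ (by norm_num)]; congr 1
      rw [hA]; ring
    have e3 : Real.sqrt ((∏ j, (r j : ℝ)) / ∏ i, (a i : ℝ)) =
        Real.sqrt (∏ j, (r j:ℝ)) / Real.sqrt (∏ i, (a i:ℝ)) :=
      Real.sqrt_div (Finset.prod_nonneg fun i _ => by positivity) _
    have e4 : Real.sqrt n * Real.sqrt (Real.pi / (2*((A':ℝ)+1))) = ρ / Real.sqrt ((A':ℝ)+1) := by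
      rw [← Real.sqrt_mul hn'.le, hρ, ← Real.sqrt_div (by positivity)]
      congr 1; field_simp
    set E1 := (2:ℝ)^((∑ i, (a i:ℤ))*n+∑ i, b i) with hE1
    set E2 := (2:ℝ)^((∑ j, (r j:ℤ))*n+∑ j, s j) with hE2
    have hE10 : 0 < E1 := by positivity
    have hE20 : 0 < E2 := by positivity
    set Q := ρ^q / ρ^p * (E1/E2) * (Real.sqrt (∏ j, (r j:ℝ)) / Real.sqrt (∏ i, (a i:ℝ))) with hQ
    have hQ0 : 0 < Q := by positivity
    have e5 : ∑ k ∈ Finset.range (n+1), h n k = hypSum p q a b c r s t n / Q := by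
      unfold hypSum
      rw [Finset.sum_div]
      refine Finset.sum_congr rfl fun k _ => ?_
      simp only [hh]
      by_cases hvk : V n k
      · rw [if_pos hvk, if_pos hvk, hsX_eq, hsX_eq, ← hρ, ← hE1, ← hE2, hQ]
        have : (0:ℝ) < ∏ j, (Nat.choose ((r j : ℤ) * (n : ℤ) + s j).toNat
          ((r j : ℤ) * (k : ℤ) + t j).toNat : ℝ) := by
          refine Finset.prod_pos fun j _ => ?_
          have := hvk.2 j
          exact_mod_cast Nat.choose_pos (by omega)
        field_simp
      · rw [if_neg hvk, if_neg hvk, zero_div]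
    rw [e5, div_div, e4, e1, e2, e3, div_div]
    congr 1
    rw [hQ]; ring
  · intro n k _
    simp only [hh]
    split_ifs
    · exact div_nonneg (Finset.prod_nonneg fun i _ => by positivity) (Finset.prod_nonneg fun i _ => by positivity)
    · exact le_rfl
  · intro n k hn hk
    simp only [hh]
    split_ifs with hv
    · obtain ⟨x1, -⟩ := B1 n k hn hk hv.1
      obtain ⟨-, x2⟩ := B2 n k hn hk hv.2
      have hD := hsD_pos n k hk
      have hT := hsT_pos n k
      have d0 : hsD n k ≤ C0 := by
        have := D0 n k hn hk
        simp only [pow_zero, inv_one, mul_one] at this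
        refine this.trans (div_le_self hC0.le ?_)
        have := sq_nonneg (((k:ℝ) - (n:ℝ)/2)/Real.sqrt n)
        linarith
      have d1 := D1 n k hn hk
      have hX2 : 0 < hsX r s t n k := by
        have : 0 < K2 * hsX r s t n k := lt_of_lt_of_le (by positivity) x2
        exact pos_of_mul_pos_right this hK2.le
      rw [div_le_iff₀ hX2]
      calc hsX a b c n k ≤ K1 * (hsD n k ^ (∑ i, a i) * (hsT n k ^ M1)⁻¹) := x1
        _ = K1 * (hsD n k ^ A' * (hsD n k * (hsT n k ^ (M1+M2))⁻¹)) * (hsD n k ^ (∑ j, r j) * hsT n k ^ M2) := by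
            rw [hsum, pow_add, pow_add, pow_add]; field_simp
        _ ≤ K1 * (C0 ^ A' * (C1 / (1 + (((k:ℝ) - (n:ℝ)/2)/Real.sqrt n)^2))) * (K2 * hsX r s t n k) := by
            gcongr
        _ = _ := by ring
    · positivity
  · intro x k hk
    have l1 := hsX_lim a ha b c x k hk
    have l2 := hsX_lim r hr s t x k hk
    have l3 := l1.div l2 (Real.exp_pos _).ne'
    rw [← Real.exp_sub] at l3
    have e : -2 * x^2 * (∑ i, (a i:ℝ)) - -2 * x^2 * (∑ j, (r j:ℝ)) = -(2*((A':ℝ)+1)) * x^2 := by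
      push_cast at hAr'
      rw [hAr']; ring
    rw [e] at l3
    refine l3.congr' ?_
    have v1 : ∀ᶠ n : ℕ in atTop, ∀ i, 0 ≤ (a i : ℤ) * (k n : ℤ) + c i ∧
          (a i : ℤ) * (k n : ℤ) + c i ≤ (a i : ℤ) * (n : ℤ) + b i :=
      eventually_all.2 fun i => hs_valid (a i) (ha i) (b i) (c i) x k hk
    have v2 : ∀ᶠ n : ℕ in atTop, ∀ j, 0 ≤ (r j : ℤ) * (k n : ℤ) + t j ∧
          (r j : ℤ) * (k n : ℤ) + t j ≤ (r j : ℤ) * (n : ℤ) + s j :=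
      eventually_all.2 fun i => hs_valid (r i) (hr i) (s i) (t i) x k hk
    filter_upwards [v1, v2] with n w1 w2
    simp only [hh]
    rw [if_pos ⟨w1, w2⟩]
    rfl
end

section
/- As the integer m tends to infinity: (i) ∑_{k=1}^{m−1} 1/(k·(m−k)) = (2/m)·( log m + γ + O(1/m) ), and (ii) ∑_{k=1}^{m−1} ζ(2k)·ζ(2(m−k))/(k·(m−k)) = (2/m)·( log(2m) + γ + O(1/m) ). Precisely, the quantities m·( (m/2)·∑_{k=1}^{m−1} 1/(k(m−k)) − log m − γ ) and m·( (m/2)·∑_{k=1}^{m−1} ζ(2k)ζ(2(m−k))/(k(m−k)) − log(2m) − γ ) remain bounded as m → ∞. -/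
open Filter

lemma dh_sym (f : ℕ → ℝ) (n : ℕ) :
    ((n + 1 : ℕ) : ℝ) / 2 * (∑ k ∈ Finset.Icc 1 (n + 1 - 1),
      f k * f (n + 1 - k) / ((k : ℝ) * ((n + 1 - k : ℕ) : ℝ))) =
    ∑ i ∈ Finset.range n, f (i + 1) * f (n - 1 - i + 1) / ((i : ℝ) + 1) := by
  have h1 : ∑ k ∈ Finset.Icc 1 (n + 1 - 1),
      f k * f (n + 1 - k) / ((k : ℝ) * ((n + 1 - k : ℕ) : ℝ)) =
      ∑ i ∈ Finset.range n, f (i + 1) * f (n - 1 - i + 1) /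
        (((i : ℝ) + 1) * (((n - 1 - i : ℕ) : ℝ) + 1)) := by
    have : Finset.Icc 1 (n + 1 - 1) = Finset.Ico 1 (n + 1) := by ext; simp
    rw [this, Finset.sum_Ico_eq_sum_range]
    apply Finset.sum_congr (by simp)
    intro i hi
    have hi' : i < n := by simpa using hi
    have e : n + 1 - (1 + i) = n - 1 - i + 1 := by omega
    rw [e, add_comm 1 i]
    push_cast
    rfl
  have h2 := Finset.sum_range_reflect
    (fun i => f (i + 1) * f (n - 1 - i + 1) / ((i : ℝ) + 1)) n
  have h3 : ((n + 1 : ℕ) : ℝ) * ∑ i ∈ Finset.range n, f (i + 1) * f (n - 1 - i + 1) /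
        (((i : ℝ) + 1) * (((n - 1 - i : ℕ) : ℝ) + 1)) =
      ∑ i ∈ Finset.range n, f (i + 1) * f (n - 1 - i + 1) / ((i : ℝ) + 1) +
      ∑ j ∈ Finset.range n, (fun i => f (i + 1) * f (n - 1 - i + 1) / ((i : ℝ) + 1))
        (n - 1 - j) := by
    rw [Finset.mul_sum, ← Finset.sum_add_distrib]
    apply Finset.sum_congr rfl
    intro i hi
    have hi' : i < n := by simpa using hi
    have e : n - 1 - (n - 1 - i) = i := by omega
    have c : ((n + 1 : ℕ) : ℝ) = ((i : ℝ) + 1) + (((n - 1 - i : ℕ) : ℝ) + 1) := by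
      have : n + 1 = (i + 1) + ((n - 1 - i) + 1) := by omega
      exact_mod_cast this
    simp only [e]
    rw [c]
    have p1 : (i : ℝ) + 1 ≠ 0 := by positivity
    have p2 : ((n - 1 - i : ℕ) : ℝ) + 1 ≠ 0 := by positivity
    field_simp
    ring
  rw [h1, div_mul_eq_mul_div, h3, h2]
  ring

lemma dh_harm (n : ℕ) :
    |((n + 1 : ℕ) : ℝ) * ((∑ i ∈ Finset.range n, 1 / ((i : ℝ) + 1)) -
      Real.log ((n + 1 : ℕ) : ℝ) - Real.eulerMascheroniConstant)| ≤ 1 := by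
  have a := Real.eulerMascheroniSeq_lt_eulerMascheroniConstant n
  have b := Real.eulerMascheroniConstant_lt_eulerMascheroniSeq' (n + 1)
  rw [Real.eulerMascheroniSeq] at a
  rw [Real.eulerMascheroniSeq'] at b
  simp only [Nat.add_eq_zero_iff, one_ne_zero, and_false, if_false, harmonic] at a b
  rw [Finset.sum_range_succ] at b
  push_cast at a b ⊢
  simp only [one_div]
  have p : (0 : ℝ) < n + 1 := by positivity
  rw [abs_le]
  have q : ((n : ℝ) + 1) * ((n : ℝ) + 1)⁻¹ = 1 := mul_inv_cancel₀ p.ne'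
  constructor
  · nlinarith
  · nlinarith

/-- `ζ(2(i+1)) - 1` -/
noncomputable def dhE (i : ℕ) : ℝ := ∑' n : ℕ, (1 / ((n : ℝ) + 2) ^ 2) ^ (i + 1)

lemma dh_summ2 : Summable (fun n : ℕ => 1 / ((n : ℝ) + 2) ^ 2) := by
  have := (summable_nat_add_iff 2).2 (Real.summable_one_div_nat_pow.2 (one_lt_two))
  simpa using this

lemma dh_x_le (n : ℕ) : 1 / ((n : ℝ) + 2) ^ 2 ≤ 1 / 4 := by
  apply one_div_le_one_div_of_le (by norm_num)
  have : (0 : ℝ) ≤ n := by positivity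
  nlinarith

lemma dh_term_le (n i : ℕ) :
    (1 / ((n : ℝ) + 2) ^ 2) ^ (i + 1) ≤ (1 / 4) ^ i * (1 / ((n : ℝ) + 2) ^ 2) := by
  rw [pow_succ]
  exact mul_le_mul_of_nonneg_right (pow_le_pow_left₀ (by positivity) (dh_x_le n) i)
    (by positivity)

lemma dh_summ (i : ℕ) : Summable (fun n : ℕ => (1 / ((n : ℝ) + 2) ^ 2) ^ (i + 1)) :=
  Summable.of_nonneg_of_le (fun n => by positivity) (fun n => dh_term_le n i)
    (dh_summ2.mul_left _)

lemma dhE_nonneg (i : ℕ) : 0 ≤ dhE i := tsum_nonneg (fun n => by positivity)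

lemma dhE_le (i : ℕ) : dhE i ≤ dhE 0 * (1 / 4) ^ i := by
  unfold dhE
  rw [mul_comm, ← tsum_mul_left]
  refine (dh_summ i).tsum_le_tsum (fun n => ?_) ((dh_summ 0).mul_left _)
  simpa using dh_term_le n i

lemma dh_zeta (i : ℕ) : zetaSum (2 * (i + 1)) = 1 + dhE i := by
  unfold zetaSum dhE
  have hs : Summable (fun n : ℕ => 1 / ((n : ℝ) + 1) ^ (2 * (i + 1))) := by
    rw [← summable_nat_add_iff 1]
    refine (dh_summ i).congr (fun n => ?_)
    rw [pow_mul, div_pow, one_pow]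
    push_cast
    ring
  rw [hs.tsum_eq_zero_add]
  congr 1
  · simp
  · congr 1
    ext n
    rw [pow_mul, div_pow, one_pow]
    push_cast
    ring

lemma dhE_summable_lin : Summable (fun i : ℕ => dhE i * ((i : ℝ) + 2)) := by
  have h1 : Summable (fun i : ℕ => ((i : ℝ) ^ 1 * (1 / 4 : ℝ) ^ i)) :=
    summable_pow_mul_geometric_of_norm_lt_one 1 (by norm_num)
  have h2 : Summable (fun i : ℕ => (1 / 4 : ℝ) ^ i) :=
    summable_geometric_of_lt_one (by norm_num) (by norm_num)
  refine Summable.of_nonneg_of_le (fun i => mul_nonneg (dhE_nonneg i) (by positivity))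
    (fun i => ?_) ((h1.add (h2.mul_left 2)).mul_left (dhE 0))
  have := mul_le_mul_of_nonneg_right (dhE_le i) (by positivity : (0 : ℝ) ≤ (i : ℝ) + 2)
  refine this.trans (le_of_eq (by ring))

lemma dhE_summable : Summable dhE :=
  Summable.of_nonneg_of_le dhE_nonneg (fun i => by
    have : (0 : ℝ) ≤ i := by positivity
    nlinarith [dhE_nonneg i]) dhE_summable_lin

lemma dh_tele : HasSum (fun n : ℕ => -Real.log (1 - 1 / ((n : ℝ) + 2) ^ 2)) (Real.log 2) := by
  rw [hasSum_iff_tendsto_nat_of_nonneg]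
  · have key : ∀ N : ℕ, ∑ n ∈ Finset.range N, -Real.log (1 - 1 / ((n : ℝ) + 2) ^ 2) =
        Real.log 2 - Real.log (1 + 1 / ((N : ℝ) + 1)) := by
      intro N
      induction N with
      | zero => norm_num
      | succ N ih =>
        rw [Finset.sum_range_succ, ih]
        have p : (0 : ℝ) ≤ N := by positivity
        have e1 : 1 - 1 / ((N : ℝ) + 2) ^ 2 =
            (1 + 1 / (((N + 1 : ℕ) : ℝ) + 1)) / (1 + 1 / ((N : ℝ) + 1)) := by
          push_cast
          have : (N : ℝ) + 2 ≠ 0 := by positivity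
          have : (N : ℝ) + 1 ≠ 0 := by positivity
          have : (N : ℝ) + 1 + 1 ≠ 0 := by positivity
          have : (N : ℝ) + 1 + 1 = N + 2 := by ring
          rw [this]
          have : 1 + 1 / ((N : ℝ) + 1) = (N + 2) / (N + 1) := by field_simp; ring
          rw [this]
          field_simp
          ring
        rw [e1, Real.log_div (by positivity) (by positivity)]
        ring
    simp_rw [key]
    have t : Tendsto (fun N : ℕ => 1 + 1 / ((N : ℝ) + 1)) atTop (nhds (1 + 0)) :=
      tendsto_const_nhds.add tendsto_one_div_add_atTop_nhds_zero_nat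
    rw [add_zero] at t
    have t2 := (Real.continuousAt_log one_ne_zero).tendsto.comp t
    rw [Real.log_one] at t2
    simpa using tendsto_const_nhds.sub t2
  · intro n
    have := dh_x_le n
    have h0 : 0 ≤ 1 / ((n : ℝ) + 2) ^ 2 := by positivity
    have := Real.log_nonpos (x := 1 - 1 / ((n : ℝ) + 2) ^ 2) (by linarith) (by linarith)
    linarith

lemma dh_log2 : HasSum (fun i : ℕ => dhE i / ((i : ℝ) + 1)) (Real.log 2) := by
  have row : ∀ n : ℕ, HasSum (fun i : ℕ => (1 / ((n : ℝ) + 2) ^ 2) ^ (i + 1) / ((i : ℝ) + 1))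
      (-Real.log (1 - 1 / ((n : ℝ) + 2) ^ 2)) := by
    intro n
    apply Real.hasSum_pow_div_log_of_abs_lt_one
    rw [abs_of_nonneg (by positivity)]
    linarith [dh_x_le n]
  have S : Summable (Function.uncurry
      (fun n i : ℕ => (1 / ((n : ℝ) + 2) ^ 2) ^ (i + 1) / ((i : ℝ) + 1))) := by
    rw [summable_prod_of_nonneg]
    · refine ⟨fun n => (row n).summable, ?_⟩
      convert dh_tele.summable using 2 with n
      exact (row n).tsum_eq
    · intro p
      simp only [Function.uncurry, Pi.zero_apply]
      positivity
  have c := S.tsum_comm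
  have sm : Summable (fun i : ℕ => dhE i / ((i : ℝ) + 1)) :=
    Summable.of_nonneg_of_le (fun i => div_nonneg (dhE_nonneg i) (by positivity))
      (fun i => div_le_self (dhE_nonneg i) (by linarith [(Nat.cast_nonneg i : (0 : ℝ) ≤ i)]))
      dhE_summable
  have e : ∑' i : ℕ, dhE i / ((i : ℝ) + 1) = Real.log 2 := by
    rw [← dh_tele.tsum_eq]
    simp_rw [← fun n => (row n).tsum_eq]
    rw [← c]
    simp_rw [dhE, tsum_div_const]
  rw [← e]
  exact sm.hasSum

lemma dh_tail (n : ℕ) :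
    |((n + 1 : ℕ) : ℝ) * ((∑ i ∈ Finset.range n, dhE i / ((i : ℝ) + 1)) - Real.log 2)| ≤
      ∑' i, dhE i := by
  have h := dh_log2.summable.sum_add_tsum_nat_add n
  rw [dh_log2.tsum_eq] at h
  have h' : (∑ i ∈ Finset.range n, dhE i / ((i : ℝ) + 1)) - Real.log 2 =
    -∑' i : ℕ, dhE (i + n) / (((i + n : ℕ) : ℝ) + 1) := by linarith
  have s1 := (summable_nat_add_iff n).2 dh_log2.summable
  have s2 := (summable_nat_add_iff n).2 dhE_summable
  have h3 := dhE_summable.sum_add_tsum_nat_add n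
  have h4 : 0 ≤ ∑ i ∈ Finset.range n, dhE i := Finset.sum_nonneg (fun i _ => dhE_nonneg i)
  rw [h', mul_neg, abs_neg, abs_of_nonneg (mul_nonneg (by positivity)
    (tsum_nonneg (fun i => div_nonneg (dhE_nonneg _) (by positivity)))), ← tsum_mul_left]
  have : ∑' i : ℕ, ((n + 1 : ℕ) : ℝ) * (dhE (i + n) / (((i + n : ℕ) : ℝ) + 1)) ≤
      ∑' i, dhE (i + n) := by
    refine (s1.mul_left _).tsum_le_tsum (fun i => ?_) s2
    rw [mul_div_assoc', div_le_iff₀ (by positivity), mul_comm]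
    apply mul_le_mul_of_nonneg_left _ (dhE_nonneg _)
    push_cast
    linarith [(Nat.cast_nonneg i : (0 : ℝ) ≤ i)]
  linarith

lemma dh_cross (n : ℕ) :
    |((n + 1 : ℕ) : ℝ) * ∑ i ∈ Finset.range n, (1 + dhE i) * dhE (n - 1 - i) / ((i : ℝ) + 1)| ≤
      (1 + dhE 0) * ∑' i : ℕ, dhE i * ((i : ℝ) + 2) := by
  have nn : ∀ i, 0 ≤ (1 + dhE i) * dhE (n - 1 - i) / ((i : ℝ) + 1) := fun i =>
    div_nonneg (mul_nonneg (by linarith [dhE_nonneg i]) (dhE_nonneg _)) (by positivity)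
  rw [abs_of_nonneg (mul_nonneg (by positivity) (Finset.sum_nonneg (fun i _ => nn i))),
    Finset.mul_sum]
  have r := Finset.sum_range_reflect (fun i : ℕ => dhE i * ((i : ℝ) + 2)) n
  have b := dhE_summable_lin.sum_le_tsum (Finset.range n)
    (fun i _ => mul_nonneg (dhE_nonneg i) (by positivity))
  have p0 := dhE_nonneg 0
  refine le_trans ?_ (mul_le_mul_of_nonneg_left b (by linarith))
  rw [← r, Finset.mul_sum]
  apply Finset.sum_le_sum
  intro i hi
  have hi' : i < n := by simpa using hi
  have c : ((n + 1 : ℕ) : ℝ) = ((i : ℝ) + 1) + (((n - 1 - i : ℕ) : ℝ) + 1) := by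
    have : n + 1 = (i + 1) + ((n - 1 - i) + 1) := by omega
    exact_mod_cast this
  have d : dhE i ≤ dhE 0 := by
    refine (dhE_le i).trans (mul_le_of_le_one_right p0 (pow_le_one₀ (by norm_num) (by norm_num)))
  rw [c]
  generalize n - 1 - i = j
  have q := dhE_nonneg j
  have e : ((i : ℝ) + 1 + ((j : ℝ) + 1)) / ((i : ℝ) + 1) ≤ (j : ℝ) + 2 := by
    rw [div_le_iff₀ (by positivity)]
    have : (0 : ℝ) ≤ (i : ℝ) * j := by positivity
    have : (0 : ℝ) ≤ (i : ℝ) := by positivity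
    nlinarith
  calc ((i : ℝ) + 1 + ((j : ℝ) + 1)) * ((1 + dhE i) * dhE j / ((i : ℝ) + 1))
      = (1 + dhE i) * (dhE j * (((i : ℝ) + 1 + ((j : ℝ) + 1)) / ((i : ℝ) + 1))) := by ring
    _ ≤ (1 + dhE 0) * (dhE j * ((j : ℝ) + 2)) := by
      gcongr

/-- As the integer `m` tends to infinity:
(i) `∑_{k=1}^{m−1} 1/(k(m−k)) = (2/m)(log m + γ + O(1/m))`, and
(ii) `∑_{k=1}^{m−1} ζ(2k)ζ(2(m−k))/(k(m−k)) = (2/m)(log(2m) + γ + O(1/m))`;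
precisely, the quantities `m·((m/2)·∑ 1/(k(m−k)) − log m − γ)` and
`m·((m/2)·∑ ζ(2k)ζ(2(m−k))/(k(m−k)) − log(2m) − γ)` remain bounded as `m → ∞`. -/
theorem double_harmonic_sum_asymptotics :
    ∃ C : ℝ, ∀ᶠ m : ℕ in atTop,
      |(m : ℝ) * ((m : ℝ) / 2 *
          (∑ k ∈ Finset.Icc 1 (m - 1), 1 / ((k : ℝ) * ((m - k : ℕ) : ℝ))) -
        Real.log m - Real.eulerMascheroniConstant)| ≤ C ∧
      |(m : ℝ) * ((m : ℝ) / 2 *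
          (∑ k ∈ Finset.Icc 1 (m - 1),
            zetaSum (2 * k) * zetaSum (2 * (m - k)) / ((k : ℝ) * ((m - k : ℕ) : ℝ))) -
        Real.log (2 * m) - Real.eulerMascheroniConstant)| ≤ C := by
  refine ⟨1 + ∑' i, dhE i + (1 + dhE 0) * ∑' i : ℕ, dhE i * ((i : ℝ) + 2), ?_⟩
  filter_upwards [eventually_ge_atTop 1] with m hm
  obtain ⟨n, rfl⟩ : ∃ n, m = n + 1 := ⟨m - 1, by omega⟩
  have hA := dh_harm n
  have hB := dh_tail n
  have hC := dh_cross n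
  constructor
  · have h := dh_sym (fun _ => 1) n
    simp only [one_mul] at h
    rw [h]
    linarith [abs_nonneg (((n + 1 : ℕ) : ℝ) *
      ((∑ i ∈ Finset.range n, dhE i / ((i : ℝ) + 1)) - Real.log 2)),
      abs_nonneg (((n + 1 : ℕ) : ℝ) *
        ∑ i ∈ Finset.range n, (1 + dhE i) * dhE (n - 1 - i) / ((i : ℝ) + 1))]
  · have h := dh_sym (fun k => zetaSum (2 * k)) n
    simp only [dh_zeta] at h
    rw [h, Real.log_mul (by norm_num) (by positivity)]
    have s : ∑ i ∈ Finset.range n, (1 + dhE i) * (1 + dhE (n - 1 - i)) / ((i : ℝ) + 1) =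
        (∑ i ∈ Finset.range n, 1 / ((i : ℝ) + 1)) +
        (∑ i ∈ Finset.range n, dhE i / ((i : ℝ) + 1)) +
        ∑ i ∈ Finset.range n, (1 + dhE i) * dhE (n - 1 - i) / ((i : ℝ) + 1) := by
      rw [← Finset.sum_add_distrib, ← Finset.sum_add_distrib]
      apply Finset.sum_congr rfl
      intro i _
      ring
    rw [s]
    refine le_trans (le_of_eq ?_) ((abs_add_three _ _ _).trans (add_le_add (add_le_add hA hB) hC))
    congr 1
    ring
end

section
/- Fix an integer k ≥ 3. Then as m → ∞: (i) H_k(m) = (k/m)·( (log m + γ)^{k−1} + O((log m)^{k−3}) ), and (ii) Z_k(m) = (k/m)·( (log(2m) + γ)^{k−1} + O((log m)^{k−3}) ). Precisely, the quantities ( (m/k)·H_k(m) − (log m + γ)^{k−1} )/(log m)^{k−3} and ( (m/k)·Z_k(m) − (log(2m) + γ)^{k−1} )/(log m)^{k−3} remain bounded as m → ∞ (for k = 3 the bound means that the differences themselves are bounded). -/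
open Filter

/-- The multiple harmonic sum `H_k(m) = ∑_{j₁+⋯+j_k=m} 1/(j₁⋯j_k)`, where the sum ranges
over ordered `k`-tuples of positive integers with sum `m`. -/
noncomputable def Hsum (k m : ℕ) : ℝ :=
  ∑ j ∈ (Fintype.piFinset fun _ : Fin k => Finset.Icc 1 m).filter
      (fun j => ∑ i, j i = m),
    ∏ i, (1 : ℝ) / (j i : ℝ)

/-- The multiple harmonic zeta sum `Z_k(m) = ∑_{j₁+⋯+j_k=m} ζ(2j₁)⋯ζ(2j_k)/(j₁⋯j_k)`. -/
noncomputable def Zsum (k m : ℕ) : ℝ :=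
  ∑ j ∈ (Fintype.piFinset fun _ : Fin k => Finset.Icc 1 m).filter
      (fun j => ∑ i, j i = m),
    ∏ i, zetaSum (2 * j i) / (j i : ℝ)

namespace MHS

open PowerSeries

/-- Generating series of `b j / j`. -/
noncomputable def A (b : ℕ → ℝ) : PowerSeries ℝ := PowerSeries.mk fun j => b j / (j : ℝ)

noncomputable def G (b : ℕ → ℝ) (k m : ℕ) : ℝ := coeff m (A b ^ k)

lemma sum_eq_G (b : ℕ → ℝ) (k m : ℕ) :
    ∑ j ∈ (Fintype.piFinset fun _ : Fin k => Finset.Icc 1 m).filter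
      (fun j => ∑ i, j i = m), ∏ i, b (j i) / (j i : ℝ) = G b k m := by
  classical
  have h : A b ^ k = ∏ _i : Fin k, A b := by simp
  rw [G, h, PowerSeries.coeff_prod]
  have h2 : ∑ l ∈ Finset.finsuppAntidiag (Finset.univ : Finset (Fin k)) m,
      ∏ i, coeff (l i) (A b) =
      ∑ l ∈ Finset.piAntidiag (Finset.univ : Finset (Fin k)) m, ∏ i, b (l i) / (l i : ℝ) := by
    refine Finset.sum_bij (fun l _ => (l : Fin k → ℕ)) ?_ ?_ ?_ ?_
    · intro l hl
      simpa [Finset.mem_finsuppAntidiag] using hl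
    · intro a _ c _ hac
      exact DFunLike.coe_injective hac
    · intro c hc
      refine ⟨Finsupp.equivFunOnFinite.symm c, ?_, by simp⟩
      simpa [Finset.mem_finsuppAntidiag] using hc
    · intro l _
      simp [A]
  rw [h2]
  refine Finset.sum_subset ?_ ?_
  · intro j hj
    simp only [Finset.mem_filter] at hj
    simp [hj.2]
  · intro j hj hj'
    have hs : ∑ i, j i = m := by simpa using hj
    have : ∃ i, j i = 0 := by
      by_contra hcon
      push Not at hcon
      apply hj'
      simp only [Finset.mem_filter, Fintype.mem_piFinset, Finset.mem_Icc]
      refine ⟨fun i => ⟨Nat.one_le_iff_ne_zero.mpr (hcon i), ?_⟩, hs⟩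
      rw [← hs]
      exact Finset.single_le_sum (fun _ _ => Nat.zero_le _) (Finset.mem_univ i)
    obtain ⟨i, hi⟩ := this
    exact Finset.prod_eq_zero (Finset.mem_univ i) (by simp [hi])

lemma G_zero (b : ℕ → ℝ) (k : ℕ) (hk : k ≠ 0) : G b k 0 = 0 := by
  simp [G, A, hk]

lemma G_one (b : ℕ → ℝ) (m : ℕ) : G b 1 m = b m / m := by
  simp [G, A]

lemma G_rec (b : ℕ → ℝ) (k m : ℕ) (hk : k ≠ 0) :
    ((m : ℝ) + 1) * G b (k + 1) (m + 1) =
      (k + 1) * ∑ i ∈ Finset.range m, G b k (i + 1) * b (m - i) := by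
  have h := PowerSeries.coeff_derivative (A b ^ (k + 1)) m
  rw [Derivation.leibniz_pow] at h
  have h1 : ∑ i ∈ Finset.range m, G b k (i + 1) * b (m - i) =
      coeff m (A b ^ k * PowerSeries.derivative ℝ (A b)) := by
    rw [PowerSeries.coeff_mul, Finset.Nat.sum_antidiagonal_eq_sum_range_succ_mk,
      Finset.sum_range_succ']
    have h0 := G_zero b k hk
    rw [G] at h0
    rw [h0, zero_mul, add_zero]
    refine Finset.sum_congr rfl fun i hi => ?_
    have hi := Finset.mem_range.mp hi
    rw [PowerSeries.coeff_derivative]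
    have e : m - (i + 1) + 1 = m - i := by omega
    have e2 : (((m - (i + 1) : ℕ) : ℝ) + 1) = ((m - i : ℕ) : ℝ) := by
      rw [← e]; push_cast; ring
    rw [e, e2, G, A, coeff_mk]
    have : ((m - i : ℕ) : ℝ) ≠ 0 := by
      have : m - i ≠ 0 := by omega
      exact_mod_cast this
    field_simp
  rw [h1, G, mul_comm, ← h, map_nsmul, nsmul_eq_mul]
  simp

/-- geometric lemmas -/
lemma geo (m : ℕ) : ∑ i ∈ Finset.range m, (1 / 2 : ℝ) ^ (m - i) ≤ 1 := by
  induction m with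
  | zero => simp
  | succ m ih =>
    rw [Finset.sum_range_succ]
    have : ∑ i ∈ Finset.range m, (1 / 2 : ℝ) ^ (m + 1 - i) =
        1 / 2 * ∑ i ∈ Finset.range m, (1 / 2 : ℝ) ^ (m - i) := by
      rw [Finset.mul_sum]
      refine Finset.sum_congr rfl fun i hi => ?_
      have hi := Finset.mem_range.mp hi
      rw [Nat.succ_sub hi.le, pow_succ]; ring
    rw [this, Nat.add_sub_cancel_left, pow_one]
    linarith

lemma geo2 (m : ℕ) : ∑ i ∈ Finset.range m, (1 / ((i : ℝ) + 1)) * (1 / 2 : ℝ) ^ (m - i)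
    ≤ 4 / ((m : ℝ) + 1) := by
  induction m with
  | zero => simp
  | succ m ih =>
    rw [Finset.sum_range_succ]
    have : ∑ i ∈ Finset.range m, (1 / ((i : ℝ) + 1)) * (1 / 2 : ℝ) ^ (m + 1 - i) =
        1 / 2 * ∑ i ∈ Finset.range m, (1 / ((i : ℝ) + 1)) * (1 / 2 : ℝ) ^ (m - i) := by
      rw [Finset.mul_sum]
      refine Finset.sum_congr rfl fun i hi => ?_
      have hi := Finset.mem_range.mp hi
      rw [Nat.succ_sub hi.le, pow_succ]; ring
    rw [this]
    rcases Nat.eq_zero_or_pos m with rfl | hm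
    · norm_num
    · have hm' : (1 : ℝ) ≤ m := by exact_mod_cast hm
      have h3 : 1 / 2 * (4 / ((m : ℝ) + 1)) + (1 / ((m : ℝ) + 1)) * (1 / 2) ≤
          4 / (((m + 1 : ℕ) : ℝ) + 1) := by
        push_cast
        rw [← sub_nonneg]
        have : 4 / ((m : ℝ) + 1 + 1) - (1 / 2 * (4 / ((m : ℝ) + 1)) + (1 / ((m : ℝ) + 1)) * (1 / 2))
          = (3 * m - 2) / (2 * (m + 1) * (m + 1 + 1)) := by field_simp; ring
        rw [this]
        apply div_nonneg <;> nlinarith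
      simp at h3 ⊢
      simp at ih
      linarith

lemma two_pow_bound (m : ℕ) : (1 / 2 : ℝ) ^ m ≤ 1 / ((m : ℝ) + 1) := by
  rw [div_pow, one_pow]
  apply one_div_le_one_div_of_le (by positivity)
  have : m + 1 ≤ 2 ^ m := Nat.lt_two_pow_self
  exact_mod_cast this

/-- Taylor bound -/
lemma taylor (p : ℕ) : ∃ K : ℝ, 0 ≤ K ∧ ∀ x δ : ℝ, |δ| ≤ 1 →
    |(x + δ) ^ (p + 1) - x ^ (p + 1) - (p + 1) * x ^ p * δ| ≤ K * δ ^ 2 * (1 + |x|) ^ p := by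
  induction p with
  | zero => exact ⟨0, le_rfl, fun x δ _ => by simp⟩
  | succ p ih =>
    obtain ⟨K, hK, h⟩ := ih
    refine ⟨K + (p + 1), by positivity, fun x δ hδ => ?_⟩
    have e : (x + δ) ^ (p + 1 + 1) - x ^ (p + 1 + 1) - ((p + 1 : ℕ) + 1) * x ^ (p + 1) * δ =
      (x + δ) * ((x + δ) ^ (p + 1) - x ^ (p + 1) - (p + 1) * x ^ p * δ)
        + (p + 1) * x ^ p * δ ^ 2 := by push_cast; ring
    rw [e]
    have hxd : |x + δ| ≤ 1 + |x| := (abs_add_le x δ).trans (by linarith)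
    have hx0 := abs_nonneg x
    calc _ ≤ |(x + δ) * ((x + δ) ^ (p + 1) - x ^ (p + 1) - (p + 1) * x ^ p * δ)|
        + |(p + 1) * x ^ p * δ ^ 2| := abs_add_le _ _
      _ ≤ (1 + |x|) * (K * δ ^ 2 * (1 + |x|) ^ p) + (p + 1) * (1 + |x|) ^ (p + 1) * δ ^ 2 := by
        apply add_le_add
        · rw [abs_mul]
          exact mul_le_mul hxd (h x δ hδ) (abs_nonneg _) (by positivity)
        · rw [abs_mul, abs_mul, abs_pow, abs_of_nonneg (by positivity : (0 : ℝ) ≤ (p : ℝ) + 1),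
            abs_of_nonneg (sq_nonneg δ)]
          gcongr
          calc |x| ^ p ≤ (1 + |x|) ^ p := by gcongr; linarith
            _ ≤ (1 + |x|) ^ (p + 1) := pow_le_pow_right₀ (by linarith) (Nat.le_succ p)
      _ = _ := by ring

lemma log_step (i : ℕ) : 0 ≤ Real.log ((i : ℝ) + 2) - Real.log ((i : ℝ) + 1) ∧
    Real.log ((i : ℝ) + 2) - Real.log ((i : ℝ) + 1) ≤ 1 / ((i : ℝ) + 1) ∧
    1 / ((i : ℝ) + 2) ≤ Real.log ((i : ℝ) + 2) - Real.log ((i : ℝ) + 1) := by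
  have h1 : (0 : ℝ) < (i : ℝ) + 1 := by positivity
  have h2 : (0 : ℝ) < (i : ℝ) + 2 := by positivity
  rw [← Real.log_div h2.ne' h1.ne']
  refine ⟨Real.log_nonneg ?_, ?_, ?_⟩
  · rw [le_div_iff₀ h1]; linarith
  · have := Real.log_le_sub_one_of_pos (div_pos h2 h1)
    refine this.trans (le_of_eq ?_)
    field_simp; ring
  · have := Real.one_sub_inv_le_log_of_pos (div_pos h2 h1)
    refine le_trans (le_of_eq ?_) this
    field_simp; ring


lemma ell_ge (i : ℕ) : 1 ≤ 1 + Real.log ((i : ℝ) + 1) := by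
  have : 0 ≤ Real.log ((i : ℝ) + 1) := Real.log_nonneg (by
    have : (0 : ℝ) ≤ i := Nat.cast_nonneg i
    linarith)
  linarith

lemma ell_mono {i m : ℕ} (h : i ≤ m) :
    1 + Real.log ((i : ℝ) + 1) ≤ 1 + Real.log ((m : ℝ) + 1) := by
  have : (i : ℝ) ≤ m := by exact_mod_cast h
  gcongr

lemma ell_le (i : ℕ) : 1 + Real.log ((i : ℝ) + 1) ≤ (i : ℝ) + 1 := by
  have := Real.log_le_sub_one_of_pos (by positivity : (0 : ℝ) < (i : ℝ) + 1)
  linarith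

lemma ell_sum : ∃ S : ℝ, 0 ≤ S ∧ ∀ m : ℕ,
    ∑ i ∈ Finset.range m, (1 + Real.log ((i : ℝ) + 1)) / ((i : ℝ) + 1) ^ 2 ≤ S := by
  have hs : Summable fun i : ℕ => 2 * (((i + 1 : ℕ) : ℝ) ^ (3 / 2 : ℝ))⁻¹ := by
    apply Summable.mul_left
    exact (summable_nat_add_iff 1).mpr (Real.summable_nat_rpow_inv.mpr (by norm_num))
  refine ⟨∑' i : ℕ, 2 * (((i + 1 : ℕ) : ℝ) ^ (3 / 2 : ℝ))⁻¹,
    tsum_nonneg fun i => by positivity, fun m => ?_⟩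
  refine le_trans (Finset.sum_le_sum fun i _ => ?_)
    (hs.sum_le_tsum (Finset.range m) fun i _ => by positivity)
  push_cast
  have hx : (0 : ℝ) < (i : ℝ) + 1 := by positivity
  set x : ℝ := (i : ℝ) + 1
  have h1 : 1 + Real.log x ≤ 2 * x ^ (1 / 2 : ℝ) := by
    have := Real.log_le_sub_one_of_pos (Real.rpow_pos_of_pos hx (1 / 2))
    rw [Real.log_rpow hx] at this
    linarith
  have h2 : x ^ 2 = x ^ (1 / 2 : ℝ) * x ^ (3 / 2 : ℝ) := by
    rw [← Real.rpow_add hx, ← Real.rpow_natCast]; norm_num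
  have h3 := Real.rpow_pos_of_pos hx (1 / 2)
  have h4 := Real.rpow_pos_of_pos hx (3 / 2)
  rw [div_le_iff₀ (by positivity), h2]
  refine h1.trans (le_of_eq ?_)
  field_simp

lemma L_le (c : ℝ) (i : ℕ) : 1 + |Real.log ((i : ℝ) + 1) + c| ≤
    (2 + |c|) * (1 + Real.log ((i : ℝ) + 1)) := by
  have h := ell_ge i
  have h1 := abs_add_le (Real.log ((i : ℝ) + 1)) c
  rw [abs_of_nonneg (by linarith : 0 ≤ Real.log ((i : ℝ) + 1))] at h1
  nlinarith [abs_nonneg c, mul_nonneg (abs_nonneg c) (by linarith : 0 ≤ Real.log ((i : ℝ) + 1))]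

lemma main_sum (c : ℝ) (r : ℕ) : ∃ C : ℝ, 0 ≤ C ∧ ∀ m : ℕ,
    |∑ i ∈ Finset.range m, ((r : ℝ) + 2) * (Real.log ((i : ℝ) + 1) + c) ^ (r + 1) / ((i : ℝ) + 1)
      - (Real.log ((m : ℝ) + 1) + c) ^ (r + 2)| ≤ C * (1 + Real.log ((m : ℝ) + 1)) ^ r := by
  obtain ⟨K, hK, hT⟩ := taylor (r + 1)
  obtain ⟨S, hS, hSm⟩ := ell_sum
  set D : ℝ := (K + (r + 2)) * (2 + |c|) ^ (r + 1) with hD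
  have hc0 := abs_nonneg c
  have hD0 : 0 ≤ D := by positivity
  refine ⟨D * S + |c| ^ (r + 2), by positivity, fun m => ?_⟩
  have tel : (Real.log ((m : ℝ) + 1) + c) ^ (r + 2) = c ^ (r + 2) +
      ∑ i ∈ Finset.range m, ((Real.log ((i : ℝ) + 2) + c) ^ (r + 2) -
        (Real.log ((i : ℝ) + 1) + c) ^ (r + 2)) := by
    have := Finset.sum_range_sub (fun i : ℕ => (Real.log ((i : ℝ) + 1) + c) ^ (r + 2)) m
    simp only [Nat.cast_add, Nat.cast_one, Nat.cast_zero, zero_add, Real.log_one] at this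
    have e : ∀ i : ℕ, (i : ℝ) + 1 + 1 = i + 2 := fun i => by ring
    simp only [e] at this
    rw [this]; ring
  have hterm : ∀ i ∈ Finset.range m,
      |((r : ℝ) + 2) * (Real.log ((i : ℝ) + 1) + c) ^ (r + 1) / ((i : ℝ) + 1) -
        ((Real.log ((i : ℝ) + 2) + c) ^ (r + 2) - (Real.log ((i : ℝ) + 1) + c) ^ (r + 2))| ≤
      D * (1 + Real.log ((m : ℝ) + 1)) ^ r *
        ((1 + Real.log ((i : ℝ) + 1)) / ((i : ℝ) + 1) ^ 2) := by
    intro i hi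
    obtain ⟨d0, d1, d2⟩ := log_step i
    have hl := L_le c i
    have he := ell_ge i
    have hem := ell_mono (Finset.mem_range.mp hi).le
    have hip : (0 : ℝ) < (i : ℝ) + 1 := by positivity
    set δ := Real.log ((i : ℝ) + 2) - Real.log ((i : ℝ) + 1) with hδ
    have e2 : Real.log ((i : ℝ) + 2) + c = Real.log ((i : ℝ) + 1) + c + δ := by rw [hδ]; ring
    rw [e2]
    set x := Real.log ((i : ℝ) + 1) + c
    set l := 1 + Real.log ((i : ℝ) + 1)
    set lm := 1 + Real.log ((m : ℝ) + 1)
    set y := (i : ℝ) + 1 with hy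
    have hy1 : 1 ≤ y := by rw [hy]; linarith [(Nat.cast_nonneg i : (0 : ℝ) ≤ i)]
    have hδ1 : |δ| ≤ 1 := by
      rw [abs_of_nonneg d0]
      exact d1.trans (by rw [div_le_one hip]; exact hy1)
    have t := hT x δ hδ1
    have hd2 : δ ^ 2 ≤ 1 / y ^ 2 := by
      rw [← one_div_pow]; gcongr
    have hdd : |1 / y - δ| ≤ 1 / y ^ 2 := by
      rw [abs_of_nonneg (by linarith)]
      have : 1 / y - 1 / (i + 2) ≤ 1 / y ^ 2 := by
        have e3 : (i : ℝ) + 2 = y + 1 := by rw [hy]; ring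
        rw [e3]
        have : 1 / y - 1 / (y + 1) = 1 / (y * (y + 1)) := by field_simp; ring
        rw [this]
        apply one_div_le_one_div_of_le (by positivity)
        nlinarith
      linarith
    have hpow : (1 + |x|) ^ (r + 1) ≤ (2 + |c|) ^ (r + 1) * l ^ (r + 1) := by
      rw [← mul_pow]
      have := abs_nonneg x
      gcongr
    have hxp : |x| ^ (r + 1) ≤ (1 + |x|) ^ (r + 1) := by gcongr; linarith
    have hx0 := abs_nonneg x
    have hl0 : 0 ≤ l := by linarith
    have heq : ((r : ℝ) + 2) * x ^ (r + 1) / y - ((x + δ) ^ (r + 2) - x ^ (r + 2)) =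
      ((r : ℝ) + 2) * x ^ (r + 1) * (1 / y - δ) -
        ((x + δ) ^ (r + 1 + 1) - x ^ (r + 1 + 1) - ((r + 1 : ℕ) + 1) * x ^ (r + 1) * δ) := by
      push_cast; ring
    rw [heq]
    calc _ ≤ |((r : ℝ) + 2) * x ^ (r + 1) * (1 / y - δ)| + |((x + δ) ^ (r + 1 + 1) -
            x ^ (r + 1 + 1) - ((r + 1 : ℕ) + 1) * x ^ (r + 1) * δ)| := abs_sub _ _
      _ ≤ ((r : ℝ) + 2) * (1 + |x|) ^ (r + 1) * (1 / y ^ 2) +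
          K * (1 / y ^ 2) * (1 + |x|) ^ (r + 1) := by
        apply add_le_add
        · rw [abs_mul, abs_mul, abs_pow, abs_of_nonneg (by positivity : (0 : ℝ) ≤ (r : ℝ) + 2)]
          gcongr
        · refine t.trans ?_
          gcongr
      _ = (K + (r + 2)) * (1 + |x|) ^ (r + 1) * (1 / y ^ 2) := by ring
      _ ≤ (K + (r + 2)) * ((2 + |c|) ^ (r + 1) * l ^ (r + 1)) * (1 / y ^ 2) := by gcongr
      _ = D * l ^ r * (l / y ^ 2) := by rw [hD]; ring
      _ ≤ _ := by gcongr
  rw [tel]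
  have hlm := ell_ge m
  have hlr : 1 ≤ (1 + Real.log ((m : ℝ) + 1)) ^ r := one_le_pow₀ hlm
  have e4 : ∀ a b d : ℝ, a - (b + d) = (a - d) - b := fun a b d => by ring
  rw [e4, ← Finset.sum_sub_distrib]
  calc _ ≤ |∑ i ∈ Finset.range m, (((r : ℝ) + 2) * (Real.log ((i : ℝ) + 1) + c) ^ (r + 1) /
        ((i : ℝ) + 1) - ((Real.log ((i : ℝ) + 2) + c) ^ (r + 2) -
          (Real.log ((i : ℝ) + 1) + c) ^ (r + 2)))| + |c ^ (r + 2)| := abs_sub _ _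
    _ ≤ D * (1 + Real.log ((m : ℝ) + 1)) ^ r * S + |c| ^ (r + 2) := by
      apply add_le_add
      · refine (Finset.abs_sum_le_sum_abs _ _).trans ((Finset.sum_le_sum hterm).trans ?_)
        rw [← Finset.mul_sum]
        exact mul_le_mul_of_nonneg_left (hSm m) (by positivity)
      · rw [abs_pow]
    _ ≤ _ := by
      have : 0 ≤ |c| ^ (r + 2) := by positivity
      nlinarith

lemma step (b : ℕ → ℝ) (C0 : ℝ) (hC0 : 0 ≤ C0) (hb : ∀ j, 1 ≤ j → |b j - 1| ≤ C0 * (1 / 2) ^ j)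
    (c : ℝ) (r : ℕ) (g e : ℕ → ℝ) (Ce : ℝ)
    (he : ∀ i : ℕ, |g (i + 1) - ((r : ℝ) + 2) * (Real.log ((i : ℝ) + 1) + c) ^ (r + 1) /
      ((i : ℝ) + 1)| ≤ e i)
    (hes : ∀ m : ℕ, ∑ i ∈ Finset.range m, e i ≤ Ce * (1 + Real.log ((m : ℝ) + 1)) ^ r)
    (hei : ∀ i : ℕ, e i ≤ Ce * (1 + Real.log ((i : ℝ) + 1)) ^ r) :
    ∃ C : ℝ, 0 ≤ C ∧ ∀ m : ℕ,
      |∑ i ∈ Finset.range m, g (i + 1) * b (m - i) - (Real.log ((m : ℝ) + 1) + c) ^ (r + 2)| ≤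
        C * (1 + Real.log ((m : ℝ) + 1)) ^ r := by
  obtain ⟨CM, hCM, hM⟩ := main_sum c r
  have hCe : 0 ≤ Ce := by
    have h1 := (abs_nonneg _).trans (he 0)
    have h2 := hei 0
    simp at h2
    linarith
  set B : ℝ := Ce + (r + 2) * (2 + |c|) ^ (r + 1) with hB
  have hc0 := abs_nonneg c
  have hB0 : 0 ≤ B := by positivity
  have hg : ∀ i : ℕ, |g (i + 1)| ≤ B * (1 + Real.log ((i : ℝ) + 1)) ^ r := by
    intro i
    have h1 := he i
    have h2 := hei i
    have hl := ell_ge i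
    have hle := ell_le i
    have hL := L_le c i
    have hyp : (0 : ℝ) < (i : ℝ) + 1 := by positivity
    set l := 1 + Real.log ((i : ℝ) + 1)
    set x := Real.log ((i : ℝ) + 1) + c
    set y := (i : ℝ) + 1
    have h3 : |((r : ℝ) + 2) * x ^ (r + 1) / y| ≤ (r + 2) * (2 + |c|) ^ (r + 1) * l ^ r := by
      rw [abs_div, abs_mul, abs_pow, abs_of_nonneg (by positivity : (0 : ℝ) ≤ (r : ℝ) + 2),
        abs_of_pos hyp, div_le_iff₀ hyp]
      calc ((r : ℝ) + 2) * |x| ^ (r + 1) ≤ (r + 2) * ((2 + |c|) * l) ^ (r + 1) := by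
            gcongr; linarith
        _ = (r + 2) * (2 + |c|) ^ (r + 1) * l ^ r * l := by rw [mul_pow]; ring
        _ ≤ _ := by gcongr
    have h4 := abs_sub_abs_le_abs_sub (g (i + 1)) (((r : ℝ) + 2) * x ^ (r + 1) / y)
    rw [hB]; nlinarith
  refine ⟨CM + Ce + B * C0, by positivity, fun m => ?_⟩
  set lm := 1 + Real.log ((m : ℝ) + 1) with hlm
  have hl1 : 1 ≤ lm := ell_ge m
  have e1 : ∑ i ∈ Finset.range m, g (i + 1) * b (m - i) - (Real.log ((m : ℝ) + 1) + c) ^ (r + 2) =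
    (∑ i ∈ Finset.range m, ((r : ℝ) + 2) * (Real.log ((i : ℝ) + 1) + c) ^ (r + 1) / ((i : ℝ) + 1)
      - (Real.log ((m : ℝ) + 1) + c) ^ (r + 2)) +
    ∑ i ∈ Finset.range m, (g (i + 1) - ((r : ℝ) + 2) * (Real.log ((i : ℝ) + 1) + c) ^ (r + 1) /
      ((i : ℝ) + 1)) + ∑ i ∈ Finset.range m, g (i + 1) * (b (m - i) - 1) := by
    simp only [Finset.sum_sub_distrib, mul_sub, mul_one]; ring
  rw [e1]
  refine (abs_add_three _ _ _).trans ?_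
  have p1 := hM m
  have p2 : |∑ i ∈ Finset.range m, (g (i + 1) - ((r : ℝ) + 2) *
      (Real.log ((i : ℝ) + 1) + c) ^ (r + 1) / ((i : ℝ) + 1))| ≤ Ce * lm ^ r :=
    (Finset.abs_sum_le_sum_abs _ _).trans ((Finset.sum_le_sum fun i _ => he i).trans (hes m))
  have p3 : |∑ i ∈ Finset.range m, g (i + 1) * (b (m - i) - 1)| ≤ B * C0 * lm ^ r := by
    refine (Finset.abs_sum_le_sum_abs _ _).trans ?_
    have : ∀ i ∈ Finset.range m, |g (i + 1) * (b (m - i) - 1)| ≤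
        B * C0 * lm ^ r * (1 / 2) ^ (m - i) := by
      intro i hi
      have hi := Finset.mem_range.mp hi
      rw [abs_mul]
      have hl0 := ell_ge i
      have hlm := ell_mono hi.le
      calc _ ≤ (B * lm ^ r) * (C0 * (1 / 2) ^ (m - i)) := by
            apply mul_le_mul _ (hb _ (by omega)) (abs_nonneg _) (by positivity)
            refine (hg i).trans ?_
            gcongr
        _ = _ := by ring
    refine (Finset.sum_le_sum this).trans ?_
    rw [← Finset.mul_sum]
    exact mul_le_of_le_one_right (by positivity) (geo m)
  linarith

lemma harm (m : ℕ) : ∑ i ∈ Finset.range m, 1 / ((i : ℝ) + 1) = (harmonic m : ℝ) := by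
  simp [harmonic]

lemma harm_le (m : ℕ) : ∑ i ∈ Finset.range m, 1 / ((i : ℝ) + 1) ≤ 1 + Real.log ((m : ℝ) + 1) := by
  rw [harm]
  rcases Nat.eq_zero_or_pos m with rfl | hm
  · simp
  · refine (harmonic_le_one_add_log m).trans ?_
    have : (0 : ℝ) < m := by exact_mod_cast hm
    gcongr
    linarith

lemma harm_gamma (m : ℕ) : |∑ i ∈ Finset.range m, 1 / ((i : ℝ) + 1) - Real.log ((m : ℝ) + 1) -
    Real.eulerMascheroniConstant| ≤ 2 / ((m : ℝ) + 1) := by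
  rw [harm]
  have h1 := Real.eulerMascheroniSeq_lt_eulerMascheroniConstant m
  have h2 := Real.eulerMascheroniConstant_lt_eulerMascheroniSeq' m
  rw [Real.eulerMascheroniSeq] at h1
  rw [abs_of_nonpos (by linarith)]
  cases m with
  | zero =>
    have := Real.eulerMascheroniConstant_lt_two_thirds
    simp; linarith
  | succ n =>
    rw [Real.eulerMascheroniSeq', if_neg (Nat.succ_ne_zero n)] at h2
    obtain ⟨d0, d1, d2⟩ := log_step n
    push_cast at *
    have e : (n : ℝ) + 1 + 1 = n + 2 := by ring
    rw [e] at *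
    have : 1 / ((n : ℝ) + 1) ≤ 2 / (n + 2) := by
      rw [div_le_div_iff₀ (by positivity) (by positivity)]
      linarith [(Nat.cast_nonneg n : (0 : ℝ) ≤ n)]
    linarith

lemma stage2 (b : ℕ → ℝ) (C0 : ℝ) (hC0 : 0 ≤ C0)
    (hb : ∀ j, 1 ≤ j → |b j - 1| ≤ C0 * (1 / 2) ^ j) (s : ℝ)
    (hs : HasSum (fun j : ℕ => (b (j + 1) - 1) / ((j : ℝ) + 1)) s) :
    ∃ C : ℝ, 0 ≤ C ∧ ∀ m : ℕ,
      |∑ i ∈ Finset.range m, G b 1 (i + 1) * b (m - i) -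
        (Real.log ((m : ℝ) + 1) + (Real.eulerMascheroniConstant + s))| ≤ C / ((m : ℝ) + 1) := by
  have tail : ∀ m : ℕ, |s - ∑ i ∈ Finset.range m, (b (i + 1) - 1) / ((i : ℝ) + 1)| ≤
      C0 / ((m : ℝ) + 1) := by
    intro m
    have h1 := hs.summable.sum_add_tsum_nat_add m
    rw [hs.tsum_eq] at h1
    rw [← h1, add_sub_cancel_left]
    have hgeo : HasSum (fun j : ℕ => C0 * (1 / 2) ^ m * ((1 / 2) * (1 / 2 : ℝ) ^ j))
        (C0 * (1 / 2) ^ m * ((1 / 2) * 2)) :=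
      (hasSum_geometric_two.mul_left _).mul_left _
    have h2 := tsum_of_norm_bounded (f := fun j : ℕ => (b (j + m + 1) - 1) /
      (((j + m : ℕ) : ℝ) + 1)) hgeo (fun j => by
        rw [Real.norm_eq_abs, abs_div]
        have hp : (1 : ℝ) ≤ |((j + m : ℕ) : ℝ) + 1| := by
          rw [abs_of_nonneg (by positivity)]
          linarith [(Nat.cast_nonneg (j + m) : (0 : ℝ) ≤ ((j + m : ℕ) : ℝ))]
        refine (div_le_self (abs_nonneg _) hp).trans ((hb _ (by omega)).trans (le_of_eq ?_))
        ring)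
    rw [Real.norm_eq_abs] at h2
    refine h2.trans ?_
    have := two_pow_bound m
    calc _ = C0 * (1 / 2) ^ m := by ring
      _ ≤ C0 * (1 / ((m : ℝ) + 1)) := by gcongr
      _ = _ := by ring
  refine ⟨2 + C0 + (1 + C0) * C0 * 4, by positivity, fun m => ?_⟩
  have e1 : ∑ i ∈ Finset.range m, G b 1 (i + 1) * b (m - i) -
        (Real.log ((m : ℝ) + 1) + (Real.eulerMascheroniConstant + s)) =
      (∑ i ∈ Finset.range m, 1 / ((i : ℝ) + 1) - Real.log ((m : ℝ) + 1) -
        Real.eulerMascheroniConstant) -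
      (s - ∑ i ∈ Finset.range m, (b (i + 1) - 1) / ((i : ℝ) + 1)) +
      ∑ i ∈ Finset.range m, G b 1 (i + 1) * (b (m - i) - 1) := by
    have : ∑ i ∈ Finset.range m, G b 1 (i + 1) = ∑ i ∈ Finset.range m, 1 / ((i : ℝ) + 1) +
        ∑ i ∈ Finset.range m, (b (i + 1) - 1) / ((i : ℝ) + 1) := by
      rw [← Finset.sum_add_distrib]
      refine Finset.sum_congr rfl fun i _ => ?_
      rw [G_one]; push_cast; ring
    simp only [mul_sub, mul_one, Finset.sum_sub_distrib (f := fun i => G b 1 (i + 1) * b (m - i)),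
      this]
    ring
  rw [e1]
  have p1 := harm_gamma m
  have p2 := tail m
  have p3 : |∑ i ∈ Finset.range m, G b 1 (i + 1) * (b (m - i) - 1)| ≤
      (1 + C0) * C0 * (4 / ((m : ℝ) + 1)) := by
    refine (Finset.abs_sum_le_sum_abs _ _).trans ?_
    have : ∀ i ∈ Finset.range m, |G b 1 (i + 1) * (b (m - i) - 1)| ≤
        (1 + C0) * C0 * ((1 / ((i : ℝ) + 1)) * (1 / 2) ^ (m - i)) := by
      intro i hi
      have hi := Finset.mem_range.mp hi
      have hbi : |b (i + 1)| ≤ 1 + C0 := by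
        have h1 := hb (i + 1) (by omega)
        have h2 : (1 / 2 : ℝ) ^ (i + 1) ≤ 1 := pow_le_one₀ (by norm_num) (by norm_num)
        have h3 := abs_sub_abs_le_abs_sub (b (i + 1)) 1
        rw [abs_one] at h3
        nlinarith
      rw [abs_mul, G_one, abs_div]
      calc _ ≤ ((1 + C0) / ((i : ℝ) + 1)) * (C0 * (1 / 2) ^ (m - i)) := by
            apply mul_le_mul _ (hb _ (by omega)) (abs_nonneg _) (by positivity)
            push_cast
            rw [abs_of_nonneg (by positivity : (0 : ℝ) ≤ (i : ℝ) + 1)]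
            gcongr
        _ = _ := by ring
    refine (Finset.sum_le_sum this).trans ?_
    rw [← Finset.mul_sum]
    exact mul_le_mul_of_nonneg_left (geo2 m) (by positivity)
  refine (abs_add_le _ _).trans ((add_le_add_left (abs_sub _ _) _).trans ?_)
  refine (add_le_add (add_le_add p1 p2) p3).trans (le_of_eq ?_)
  ring

lemma G_succ_eq (b : ℕ → ℝ) (k m : ℕ) (hk : k ≠ 0) : G b (k + 1) (m + 1) =
    (k + 1) / ((m : ℝ) + 1) * ∑ i ∈ Finset.range m, G b k (i + 1) * b (m - i) := by
  have := G_rec b k m hk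
  field_simp
  linarith

lemma all_stages (b : ℕ → ℝ) (C0 : ℝ) (hC0 : 0 ≤ C0)
    (hb : ∀ j, 1 ≤ j → |b j - 1| ≤ C0 * (1 / 2) ^ j) (s : ℝ)
    (hs : HasSum (fun j : ℕ => (b (j + 1) - 1) / ((j : ℝ) + 1)) s) (r : ℕ) :
    ∃ C : ℝ, 0 ≤ C ∧ ∀ m : ℕ,
      |∑ i ∈ Finset.range m, G b (r + 2) (i + 1) * b (m - i) -
        (Real.log ((m : ℝ) + 1) + (Real.eulerMascheroniConstant + s)) ^ (r + 2)| ≤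
        C * (1 + Real.log ((m : ℝ) + 1)) ^ r := by
  induction r with
  | zero =>
    obtain ⟨C, hC, h⟩ := stage2 b C0 hC0 hb s hs
    obtain ⟨S, hS, hSm⟩ := ell_sum
    refine step b C0 hC0 hb _ 0 (G b 2) (fun i => 2 * C * (1 / ((i : ℝ) + 1) ^ 2))
      (2 * C * (S + 1)) ?_ ?_ ?_
    · intro i
      have h1 := h i
      rw [G_succ_eq b 1 i one_ne_zero]
      have hy : (0 : ℝ) < (i : ℝ) + 1 := by positivity
      have e : ∀ W L y : ℝ, (((1 : ℕ) : ℝ) + 1) / y * W - (((0 : ℕ) : ℝ) + 2) * L ^ (0 + 1) / y =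
        2 / y * (W - L) := fun W L y => by push_cast; ring
      rw [e, abs_mul, abs_of_pos (by positivity : 0 < 2 / ((i : ℝ) + 1))]
      refine (mul_le_mul_of_nonneg_left h1 (by positivity)).trans (le_of_eq ?_)
      field_simp
    · intro m
      rw [← Finset.mul_sum, pow_zero, mul_one]
      apply mul_le_mul_of_nonneg_left _ (by positivity)
      refine le_trans (Finset.sum_le_sum fun i _ => ?_) ((hSm m).trans (by linarith))
      have := ell_ge i
      gcongr
    · intro i
      rw [pow_zero, mul_one]
      apply mul_le_mul_of_nonneg_left _ (by positivity)
      have : 1 / ((i : ℝ) + 1) ^ 2 ≤ 1 := by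
        rw [div_le_one (by positivity)]
        apply one_le_pow₀
        linarith [(Nat.cast_nonneg i : (0 : ℝ) ≤ i)]
      linarith
  | succ r ih =>
    obtain ⟨C, hC, h⟩ := ih
    refine step b C0 hC0 hb _ (r + 1) (G b (r + 3))
      (fun i => (r + 3) * C * ((1 + Real.log ((i : ℝ) + 1)) ^ r * (1 / ((i : ℝ) + 1))))
      ((r + 3) * C) ?_ ?_ ?_
    · intro i
      have h1 := h i
      rw [G_succ_eq b (r + 2) i (by omega)]
      have hy : (0 : ℝ) < (i : ℝ) + 1 := by positivity
      have e : ∀ W L y : ℝ, (((r + 2 : ℕ) : ℝ) + 1) / y * W -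
          (((r + 1 : ℕ) : ℝ) + 2) * L ^ (r + 1 + 1) / y =
        (r + 3) / y * (W - L ^ (r + 2)) := fun W L y => by push_cast; ring
      rw [e, abs_mul, abs_of_pos (by positivity : 0 < ((r : ℝ) + 3) / ((i : ℝ) + 1))]
      refine (mul_le_mul_of_nonneg_left h1 (by positivity)).trans (le_of_eq ?_)
      field_simp
    · intro m
      rw [← Finset.mul_sum]
      apply mul_le_mul_of_nonneg_left _ (by positivity)
      have hm := ell_ge m
      calc _ ≤ ∑ i ∈ Finset.range m, (1 + Real.log ((m : ℝ) + 1)) ^ r * (1 / ((i : ℝ) + 1)) := by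
            refine Finset.sum_le_sum fun i hi => ?_
            have h1 := ell_ge i
            have h2 := ell_mono (Finset.mem_range.mp hi).le
            gcongr
        _ = (1 + Real.log ((m : ℝ) + 1)) ^ r * ∑ i ∈ Finset.range m, (1 / ((i : ℝ) + 1)) := by
            rw [Finset.mul_sum]
        _ ≤ (1 + Real.log ((m : ℝ) + 1)) ^ r * (1 + Real.log ((m : ℝ) + 1)) := by
            gcongr
            exact harm_le m
        _ = _ := by ring
    · intro i
      apply mul_le_mul_of_nonneg_left _ (by positivity)
      have h1 := ell_ge i
      rw [pow_succ]
      gcongr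
      refine le_trans ?_ h1
      rw [div_le_one (by positivity)]
      linarith [(Nat.cast_nonneg i : (0 : ℝ) ≤ i)]

/-- The general asymptotic statement. -/
lemma general (b : ℕ → ℝ) (C0 : ℝ) (hC0 : 0 ≤ C0)
    (hb : ∀ j, 1 ≤ j → |b j - 1| ≤ C0 * (1 / 2) ^ j) (s : ℝ)
    (hs : HasSum (fun j : ℕ => (b (j + 1) - 1) / ((j : ℝ) + 1)) s) (k : ℕ) (hk : 3 ≤ k) :
    ∃ C : ℝ, ∀ m : ℕ, 3 ≤ m →
      |((m : ℝ) / (k : ℝ) * G b k m -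
          (Real.log m + (Real.eulerMascheroniConstant + s)) ^ (k - 1)) /
        (Real.log m) ^ (k - 3)| ≤ C := by
  obtain ⟨r, rfl⟩ : ∃ r, k = r + 3 := ⟨k - 3, by omega⟩
  obtain ⟨C, hC, h⟩ := all_stages b C0 hC0 hb s hs r
  refine ⟨C * 2 ^ r, fun m hm => ?_⟩
  obtain ⟨n, rfl⟩ : ∃ n, m = n + 1 := ⟨m - 1, by omega⟩
  have h1 := h n
  have hlog : 1 ≤ Real.log ((n : ℝ) + 1) := by
    rw [Real.le_log_iff_exp_le (by positivity)]
    have : (3 : ℝ) ≤ (n : ℝ) + 1 := by exact_mod_cast hm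
    linarith [Real.exp_one_lt_d9]
  rw [G_succ_eq b (r + 2) n (by omega)]
  have e1 : r + 3 - 1 = r + 2 := by omega
  have e2 : r + 3 - 3 = r := by omega
  rw [e1, e2]
  have e3 : ∀ W : ℝ, ((n + 1 : ℕ) : ℝ) / ((r + 3 : ℕ) : ℝ) *
      ((((r + 2 : ℕ) : ℝ) + 1) / ((n : ℝ) + 1) * W) = W := by
    intro W; push_cast; field_simp; ring
  rw [e3]
  push_cast
  rw [abs_div, abs_of_pos (by positivity : 0 < Real.log ((n : ℝ) + 1) ^ r),
    div_le_iff₀ (by positivity)]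
  refine h1.trans ?_
  rw [mul_assoc, ← mul_pow]
  gcongr
  linarith


lemma summ_zeta (j : ℕ) : Summable fun n : ℕ => 1 / ((n : ℝ) + 1) ^ (2 * (j + 1)) := by
  have h : Summable fun n : ℕ => 1 / (n : ℝ) ^ (2 * (j + 1)) :=
    Real.summable_one_div_nat_pow.mpr (by omega)
  have := (summable_nat_add_iff 1).mpr h
  simpa using this

/-- the summand `x_n = 1/(n+2)^2` -/
noncomputable def xx (n : ℕ) : ℝ := 1 / ((n : ℝ) + 2) ^ 2

lemma xx_nonneg (n : ℕ) : 0 ≤ xx n := by unfold xx; positivity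

lemma xx_le (n : ℕ) : xx n ≤ 1 / 4 := by
  unfold xx
  apply one_div_le_one_div_of_le (by norm_num)
  nlinarith [(Nat.cast_nonneg n : (0 : ℝ) ≤ n)]

lemma zeta_sub (j : ℕ) : HasSum (fun n : ℕ => xx n ^ (j + 1)) (zetaSum (2 * (j + 1)) - 1) := by
  have h := (hasSum_nat_add_iff' 1).mpr (summ_zeta j).hasSum
  simp only [Finset.range_one, Finset.sum_singleton, Nat.cast_zero, zero_add, one_pow,
    div_one] at h
  unfold zetaSum
  have hfun : (fun n : ℕ => xx n ^ (j + 1)) =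
      fun n : ℕ => 1 / (((n + 1 : ℕ) : ℝ) + 1) ^ (2 * (j + 1)) := by
    funext n
    unfold xx
    rw [div_pow, one_pow, ← pow_mul]
    push_cast
    congr 2
    ring
  rw [hfun]
  exact h

lemma zeta_bound : ∃ C0 : ℝ, 0 ≤ C0 ∧
    ∀ j, 1 ≤ j → |zetaSum (2 * j) - 1| ≤ C0 * (1 / 2) ^ j := by
  have h0 := zeta_sub 0
  have hz : 0 ≤ zetaSum (2 * (0 + 1)) - 1 := h0.nonneg fun n => pow_nonneg (xx_nonneg n) _
  refine ⟨2 * (zetaSum (2 * (0 + 1)) - 1), by positivity, fun j hj => ?_⟩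
  obtain ⟨i, rfl⟩ : ∃ i, j = i + 1 := ⟨j - 1, by omega⟩
  have hi := zeta_sub i
  rw [abs_of_nonneg (hi.nonneg fun n => pow_nonneg (xx_nonneg n) _)]
  have hle := hasSum_le (fun n => ?_) hi (h0.mul_left ((1 / 2) ^ i))
  · refine hle.trans (le_of_eq ?_)
    ring
  · show xx n ^ (i + 1) ≤ (1 / 2) ^ i * xx n ^ (0 + 1)
    have h1 := xx_nonneg n
    have h2 := xx_le n
    rw [pow_succ, zero_add, pow_one]
    gcongr
    linarith

lemma log_sum : HasSum (fun n : ℕ => -Real.log (1 - xx n)) (Real.log 2) := by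
  rw [hasSum_iff_tendsto_nat_of_nonneg]
  · have e : ∀ N : ℕ, ∑ n ∈ Finset.range N, -Real.log (1 - xx n) =
        Real.log 2 - Real.log (1 + 1 / ((N : ℝ) + 1)) := by
      intro N
      induction N with
      | zero => norm_num
      | succ N ih =>
        rw [Finset.sum_range_succ, ih]
        have h1 : (1 - xx N) * (1 + 1 / ((N : ℝ) + 1)) = 1 + 1 / (((N + 1 : ℕ) : ℝ) + 1) := by
          unfold xx; push_cast
          field_simp
          ring
        have h2 := xx_le N
        rw [← h1, Real.log_mul (by linarith) (by positivity)]
        ring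
    simp only [e]
    have h1 : Tendsto (fun N : ℕ => 1 + 1 / ((N : ℝ) + 1)) atTop (nhds (1 + 0)) :=
      tendsto_one_div_add_atTop_nhds_zero_nat.const_add 1
    rw [add_zero] at h1
    have h2 := (h1.log one_ne_zero).const_sub (Real.log 2)
    simpa using h2
  · intro n
    have h1 := xx_nonneg n
    have h2 := xx_le n
    have := Real.log_nonpos (x := 1 - xx n) (by linarith) (by linarith)
    linarith

lemma zeta_log : HasSum (fun j : ℕ => (zetaSum (2 * (j + 1)) - 1) / ((j : ℝ) + 1))
    (Real.log 2) := by
  have hrow : ∀ n : ℕ, HasSum (fun j : ℕ => xx n ^ (j + 1) / ((j : ℝ) + 1))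
      (-Real.log (1 - xx n)) := fun n =>
    Real.hasSum_pow_div_log_of_abs_lt_one (by
      rw [abs_of_nonneg (xx_nonneg n)]; linarith [xx_le n])
  let f : ℕ × ℕ → ℝ := fun p => xx p.1 ^ (p.2 + 1) / ((p.2 : ℝ) + 1)
  have hf0 : 0 ≤ f := fun p => div_nonneg (pow_nonneg (xx_nonneg _) _) (by positivity)
  have hsum : Summable f := by
    rw [summable_prod_of_nonneg hf0]
    refine ⟨fun n => (hrow n).summable, ?_⟩
    have : (fun n => ∑' j, f (n, j)) = fun n => -Real.log (1 - xx n) :=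
      funext fun n => (hrow n).tsum_eq
    rw [this]
    exact log_sum.summable
  have hF : HasSum f (Real.log 2) := by
    have h1 := hsum.hasSum.prod_fiberwise hrow
    rw [← h1.unique log_sum]
    exact hsum.hasSum
  have hF2 : HasSum (f ∘ (Equiv.prodComm ℕ ℕ)) (Real.log 2) :=
    (Equiv.prodComm ℕ ℕ).hasSum_iff.mpr hF
  exact hF2.prod_fiberwise fun j => (zeta_sub j).div_const _

end MHS

/-- For a fixed integer `k ≥ 3`, as `m → ∞`:
`H_k(m) = (k/m)((log m + γ)^{k−1} + O((log m)^{k−3}))` and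
`Z_k(m) = (k/m)((log(2m) + γ)^{k−1} + O((log m)^{k−3}))`; precisely, the quantities
`((m/k)H_k(m) − (log m + γ)^{k−1})/(log m)^{k−3}` and
`((m/k)Z_k(m) − (log(2m) + γ)^{k−1})/(log m)^{k−3}` remain bounded as `m → ∞`. -/
theorem multiple_harmonic_sum_asymptotics (k : ℕ) (hk : 3 ≤ k) :
    ∃ C : ℝ, ∀ᶠ m : ℕ in atTop,
      |((m : ℝ) / (k : ℝ) * Hsum k m -
          (Real.log m + Real.eulerMascheroniConstant) ^ (k - 1)) /
        (Real.log m) ^ (k - 3)| ≤ C ∧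
      |((m : ℝ) / (k : ℝ) * Zsum k m -
          (Real.log (2 * m) + Real.eulerMascheroniConstant) ^ (k - 1)) /
        (Real.log m) ^ (k - 3)| ≤ C := by
  obtain ⟨C1, h1⟩ := MHS.general (fun _ => 1) 0 le_rfl (fun j _ => by simp) 0
    (by simp) k hk
  obtain ⟨C0, hC0, hb⟩ := MHS.zeta_bound
  obtain ⟨C2, h2⟩ := MHS.general (fun j => zetaSum (2 * j)) C0 hC0 hb (Real.log 2)
    MHS.zeta_log k hk
  refine ⟨max C1 C2, ?_⟩
  filter_upwards [eventually_ge_atTop 3] with m hm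
  have e1 : Hsum k m = MHS.G (fun _ => 1) k m := MHS.sum_eq_G (fun _ => 1) k m
  have e2 : Zsum k m = MHS.G (fun j => zetaSum (2 * j)) k m :=
    MHS.sum_eq_G (fun j => zetaSum (2 * j)) k m
  have hm0 : (m : ℝ) ≠ 0 := by
    have : m ≠ 0 := by omega
    exact_mod_cast this
  have e3 : Real.log (2 * m) + Real.eulerMascheroniConstant =
      Real.log m + (Real.eulerMascheroniConstant + Real.log 2) := by
    rw [Real.log_mul two_ne_zero hm0]; ring
  rw [e1, e2, e3]
  have h1' := h1 m hm
  rw [add_zero] at h1'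
  exact ⟨h1'.trans (le_max_left _ _), (h2 m hm).trans (le_max_right _ _)⟩
end
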